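/- arXiv:2002.09314 — 3 statements merged into one kernel-verified Lean document; each statement's English description precedes it below -/
import Mathlib

section
/- Let 0 < α < 1, 0 < β₁, β₂ < 1 with 1 < β₁ + β₂, ν > 0, −∞ < a < b < +∞, T > 0, let φ : [a,b] → ℝ be continuous, and let F : [a,b] × [0,T] × ℝ → ℝ be continuously differentiable and nonincreasing in its third argument (∂F/∂u ≤ 0). Then there is at most one continuous function u : [a,b] × [0,T] → ℝ (with x ↦ u(x,t) continuously differentiable on [a,b] for each t, t ↦ u(x,t) continuously differentiable on (0,T] for each x, and 𝒟^α_{0+,t} u and 𝒟^{β₁}_{a+,x}𝒟^{β₂}_{a+,x} u continuous on [a,b] × [0,T]) satisfying the nonlinear equation 𝒟^α_{0+,t} u(x,t) = ν · 𝒟^{β₁}_{a+,x}𝒟^{β₂}_{a+,x} u(x,t) + F(x,t,u(x,t)) on (a,b) × (0,T], the initial condition u(x,0) = φ(x) for x ∈ [a,b], and the Dirichlet conditions u(a,t) = u(b,t) = 0 for t ∈ [0,T]. -/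
open Set

/-- The Caputo fractional derivative of order `γ` with base point `a`:
`(𝒟^γ_{a+} f)(t) = (1/Γ(1−γ)) ∫_a^t (t−s)^{−γ} f′(s) ds`. -/
noncomputable def caputo (γ a : ℝ) (f : ℝ → ℝ) (t : ℝ) : ℝ :=
  (1 / Real.Gamma (1 - γ)) * ∫ s in a..t, (t - s) ^ (-γ) * deriv f s

/-- The fractional integral appearing in the sequential Caputo derivative:
`t ↦ (1/Γ(1−α)) ∫_a^t (t−s)^{−α} (𝒟^β_{a+} f)(s) ds`. -/
noncomputable def seqCaputoAux (α β a : ℝ) (f : ℝ → ℝ) (t : ℝ) : ℝ :=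
  (1 / Real.Gamma (1 - α)) * ∫ s in a..t, (t - s) ^ (-α) * caputo β a f s

/-- The sequential Caputo derivative
`(𝒟^α_{a+}𝒟^β_{a+} f)(t) = (d/dt)[(1/Γ(1−α)) ∫_a^t (t−s)^{−α} (𝒟^β_{a+} f)(s) ds]`. -/
noncomputable def seqCaputo (α β a : ℝ) (f : ℝ → ℝ) : ℝ → ℝ :=
  deriv (seqCaputoAux α β a f)

open MeasureTheory Filter Topology

namespace FracDiff

/-- Integrability of the singular kernel. -/
lemma kernel_int (γ p q : ℝ) (hγ : γ < 1) (r : ℝ) :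
    IntervalIntegrable (fun s => (q - s) ^ (-γ)) volume p r := by
  have h := (intervalIntegral.intervalIntegrable_rpow' (a := q - p) (b := q - r) (r := -γ)
    (by linarith)).comp_sub_left q
  simpa using h

lemma kernel_mul_int (γ p q : ℝ) (hγ : γ < 1) (r : ℝ) (g : ℝ → ℝ)
    (hg : ContinuousOn g (Set.uIcc p r)) :
    IntervalIntegrable (fun s => (q - s) ^ (-γ) * g s) volume p r :=
  (kernel_int γ p q hγ r).mul_continuousOn hg

lemma good_int (γ T t : ℝ) (hγ : γ < 1) (g : ℝ → ℝ) (ht : t ∈ Set.Ioc 0 T)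
    (hg : ContinuousOn g (Set.Ioc 0 T)) (hi : IntervalIntegrable g volume 0 T) :
    IntervalIntegrable (fun s => (t - s) ^ (-γ) * g s) volume 0 t := by
  obtain ⟨h0, hT⟩ := ht
  have h1 : IntervalIntegrable (fun s => (t - s) ^ (-γ) * g s) volume 0 (t/2) := by
    refine IntervalIntegrable.continuousOn_mul (hi.mono_set ?_) ?_
    · rw [uIcc_of_le (by linarith), uIcc_of_le (by linarith)]
      exact Icc_subset_Icc le_rfl (by linarith)
    · rw [uIcc_of_le (by linarith)]
      refine ContinuousOn.rpow_const (by fun_prop) ?_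
      rintro s ⟨_, hs⟩
      left; linarith
  refine h1.trans (kernel_mul_int γ _ t hγ _ g (hg.mono ?_))
  rw [uIcc_of_le (by linarith)]
  rintro s ⟨hs, hs'⟩
  constructor <;> linarith

lemma good_of_int (γ T t : ℝ) (g : ℝ → ℝ) (ht : t ∈ Set.Ioc 0 T)
    (hg : ContinuousOn g (Set.Ioc 0 T))
    (hi : IntervalIntegrable (fun s => (t - s) ^ (-γ) * g s) volume 0 t) :
    IntervalIntegrable g volume 0 T := by
  obtain ⟨h0, hT⟩ := ht
  have h1 : IntervalIntegrable g volume 0 (t/2) := by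
    have h2 : IntervalIntegrable (fun s => (t - s) ^ γ * ((t - s) ^ (-γ) * g s)) volume 0 (t/2) := by
      refine IntervalIntegrable.continuousOn_mul (hi.mono_set ?_) ?_
      · rw [uIcc_of_le (by linarith), uIcc_of_le (by linarith)]
        exact Icc_subset_Icc le_rfl (by linarith)
      · rw [uIcc_of_le (by linarith)]
        refine ContinuousOn.rpow_const (by fun_prop) ?_
        rintro s ⟨_, hs⟩
        left; linarith
    refine h2.congr ?_
    rw [uIoc_of_le (by linarith)]
    rintro s ⟨hs, hs'⟩
    have : 0 < t - s := by linarith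
    simp only
    rw [← mul_assoc, ← Real.rpow_add this]
    simp
  refine h1.trans (ContinuousOn.intervalIntegrable (hg.mono ?_))
  rw [uIcc_of_le (by linarith)]
  rintro s ⟨hs, hs'⟩
  constructor <;> linarith

/-- continuity of a kernel times a small function at the singular endpoint -/
lemma cont_end (γ ρ C p q : ℝ) (hγ : 0 < γ) (hρ : γ < ρ) (e : ℝ → ℝ)
    (he : ∀ᶠ s in 𝓝[Set.Icc p q] q, |e s| ≤ C * (q - s) ^ ρ) :
    ContinuousWithinAt (fun s => (q - s) ^ (-γ) * e s) (Set.Icc p q) q := by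
  have h0 : (q - q) ^ (-γ) * e q = 0 := by
    rw [sub_self, Real.zero_rpow (by linarith), zero_mul]
  suffices h : Tendsto (fun s => (q - s) ^ (-γ) * e s) (𝓝[Set.Icc p q] q) (𝓝 0) by
    unfold ContinuousWithinAt
    convert h using 2
  have hlim : Tendsto (fun s => C * (q - s) ^ (ρ - γ)) (𝓝[Set.Icc p q] q) (𝓝 0) := by
    have : ContinuousAt (fun s => C * (q - s) ^ (ρ - γ)) q := by
      refine ContinuousAt.mul continuousAt_const (ContinuousAt.rpow_const (by fun_prop) ?_)
      right; linarith
    have h := this.tendsto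
    simp only [sub_self] at h
    rw [Real.zero_rpow (by linarith), mul_zero] at h
    exact h.mono_left nhdsWithin_le_nhds
  refine squeeze_zero_norm' ?_ hlim
  filter_upwards [he, self_mem_nhdsWithin] with s hs hm
  rcases eq_or_lt_of_le hm.2 with h | h
  · subst h
    rw [h0, sub_self, Real.zero_rpow (by linarith)]
    simp
  · have hp : 0 < q - s := by linarith
    rw [norm_mul, Real.norm_eq_abs, Real.norm_eq_abs, abs_of_pos (Real.rpow_pos_of_pos hp _)]
    calc (q - s) ^ (-γ) * |e s| ≤ (q - s) ^ (-γ) * (C * (q - s) ^ ρ) := by gcongr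
      _ = C * (q - s) ^ (ρ - γ) := by
        rw [sub_eq_add_neg ρ γ, Real.rpow_add hp]; ring

lemma hasDerivAt_kernel (γ q s : ℝ) (hs : s < q) :
    HasDerivAt (fun s => (q - s) ^ (-γ)) (γ * (q - s) ^ (-γ - 1)) s := by
  have h := ((hasDerivAt_id' s).const_sub q).rpow_const (p := -γ) (Or.inl (by linarith))
  have e : γ * (q - s) ^ (-γ - 1) = -1 * -γ * (q - s) ^ (-γ - 1) := by ring
  rw [e]
  exact h

/-- One-piece integration by parts inequality. -/
lemma time_piece (α p r q : ℝ) (hα : 0 < α) (hpr : p ≤ r) (hrq : r ≤ q) (g g' : ℝ → ℝ)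
    (hc : ContinuousOn (fun s => (q - s) ^ (-α) * g s) (Set.Icc p r))
    (hd : ∀ s ∈ Set.Ioo p r, HasDerivAt g (g' s) s)
    (hi : IntervalIntegrable (fun s => (q - s) ^ (-α) * g' s) volume p r)
    (hg : ∀ s ∈ Set.Icc p r, g s ≤ 0) :
    (q - r) ^ (-α) * g r - (q - p) ^ (-α) * g p ≤ ∫ s in p..r, (q - s) ^ (-α) * g' s := by
  refine intervalIntegral.sub_le_integral_of_hasDeriv_right_of_le hpr hc
    (g' := fun s => α * (q - s) ^ (-α - 1) * g s + (q - s) ^ (-α) * g' s) ?_ ?_ ?_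
  · intro s hs
    exact ((hasDerivAt_kernel α q s (by linarith [hs.2])).mul (hd s hs)).hasDerivWithinAt
  · rwa [intervalIntegrable_iff_integrableOn_Icc_of_le hpr] at hi
  · intro s hs
    have h1 : 0 < q - s := by linarith [hs.2]
    have h2 := hg s ⟨hs.1.le, hs.2.le⟩
    have h3 : 0 < (q - s) ^ (-α - 1) := Real.rpow_pos_of_pos h1 _
    have : α * (q - s) ^ (-α - 1) * g s ≤ 0 := mul_nonpos_of_nonneg_of_nonpos (by positivity) h2
    linarith

/-- continuity up to the endpoint. -/
lemma cont_full (γ ρ C p q : ℝ) (hγ : 0 < γ) (hρ : γ < ρ) (e : ℝ → ℝ)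
    (hce : ContinuousOn e (Set.Icc p q))
    (he : ∀ᶠ s in 𝓝[Set.Icc p q] q, |e s| ≤ C * (q - s) ^ ρ) :
    ContinuousOn (fun s => (q - s) ^ (-γ) * e s) (Set.Icc p q) := by
  intro s hs
  rcases eq_or_lt_of_le hs.2 with h | h
  · subst h
    exact cont_end γ ρ C p s hγ hρ e he
  · refine ContinuousWithinAt.mul ?_ (hce s hs)
    refine ContinuousWithinAt.rpow_const (by fun_prop) ?_
    left; linarith

lemma deriv_bound (q p g' : ℝ) (g : ℝ → ℝ) (hq : HasDerivAt g g' q) (hgq : g q = 0) :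
    ∃ C, ∀ᶠ s in 𝓝[Set.Icc p q] q, |g s| ≤ C * (q - s) ^ (1:ℝ) := by
  obtain ⟨C, hC⟩ := hq.isBigO_sub.bound
  refine ⟨C, ?_⟩
  filter_upwards [nhdsWithin_le_nhds hC, self_mem_nhdsWithin] with s hs hm
  rw [hgq, sub_zero, Real.norm_eq_abs, Real.norm_eq_abs, abs_sub_comm,
    abs_of_nonneg (sub_nonneg.2 hm.2)] at hs
  rwa [Real.rpow_one]

/-- Maximum principle in time. -/
lemma time_max (α t : ℝ) (hα : 0 < α ∧ α < 1) (ht : 0 < t) (w w' : ℝ → ℝ)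
    (hc : ContinuousOn w (Set.Icc 0 t)) (hd : ∀ s ∈ Set.Ioc 0 t, HasDerivAt w (w' s) s)
    (hi : IntervalIntegrable (fun s => (t - s) ^ (-α) * w' s) volume 0 t)
    (hm : ∀ s ∈ Set.Icc 0 t, w s ≤ w t) :
    0 ≤ ∫ s in (0:ℝ)..t, (t - s) ^ (-α) * w' s := by
  obtain ⟨C, hC⟩ := deriv_bound t 0 (w' t) (fun s => w s - w t)
    ((hd t ⟨ht, le_rfl⟩).sub_const _) (by simp)
  have h := time_piece α 0 t t hα.1 ht.le le_rfl (fun s => w s - w t) w'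
    (cont_full α 1 C 0 t hα.1 hα.2 _ (hc.sub continuousOn_const) hC)
    (fun s hs => (hd s ⟨hs.1, hs.2.le⟩).sub_const _) hi
    (fun s hs => by linarith [hm s hs])
  have h1 : 0 ≤ (t - 0) ^ (-α) := Real.rpow_nonneg (by linarith) _
  have h2 := hm 0 ⟨le_rfl, ht.le⟩
  have h3 : (t - 0) ^ (-α) * (w 0 - w t) ≤ 0 :=
    mul_nonpos_of_nonneg_of_nonpos h1 (by linarith)
  simp only [sub_self, mul_zero] at h
  linarith

/-- Maximum principle in time for shifted differences. -/
lemma time_shift (α σ h : ℝ) (hα : 0 < α ∧ α < 1) (hσ : 0 < σ) (hh : 0 < h) (f f' : ℝ → ℝ)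
    (hc : ContinuousOn f (Set.Icc 0 (σ + h)))
    (hd : ∀ s ∈ Set.Ioc 0 (σ + h), HasDerivAt f (f' s) s)
    (hi1 : IntervalIntegrable (fun s => (σ + h - s) ^ (-α) * f' s) volume 0 (σ + h))
    (hi2 : IntervalIntegrable (fun s => (σ - s) ^ (-α) * f' s) volume 0 σ)
    (hm1 : ∀ s ∈ Set.Icc 0 σ, f (s + h) - f s ≤ f (σ + h) - f σ)
    (hm2 : ∀ s ∈ Set.Icc 0 h, f s - f 0 ≤ f (σ + h) - f σ) :
    ∫ s in (0:ℝ)..σ, (σ - s) ^ (-α) * f' s ≤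
      ∫ s in (0:ℝ)..(σ + h), (σ + h - s) ^ (-α) * f' s := by
  have hiA : IntervalIntegrable (fun s => (σ + h - s) ^ (-α) * f' s) volume 0 h := by
    refine hi1.mono_set ?_
    rw [uIcc_of_le hh.le, uIcc_of_le (by linarith)]
    exact Icc_subset_Icc le_rfl (by linarith)
  have hiB : IntervalIntegrable (fun s => (σ + h - s) ^ (-α) * f' s) volume h (σ + h) := by
    refine hi1.mono_set ?_
    rw [uIcc_of_le (by linarith), uIcc_of_le (by linarith)]
    exact Icc_subset_Icc hh.le le_rfl
  have hiB' : IntervalIntegrable (fun s => (σ - s) ^ (-α) * f' (s + h)) volume 0 σ := by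
    have := hiB.comp_add_right h
    simp only [sub_self, add_sub_cancel_right] at this
    convert this using 3
    ring_nf
  have hsplit := intervalIntegral.integral_add_adjacent_intervals hiA hiB
  have hshift : ∫ s in h..(σ + h), (σ + h - s) ^ (-α) * f' s =
      ∫ s in (0:ℝ)..σ, (σ - s) ^ (-α) * f' (s + h) := by
    have := intervalIntegral.integral_comp_add_right (a := 0) (b := σ)
      (fun s => (σ + h - s) ^ (-α) * f' s) h
    rw [zero_add] at this
    rw [← this]
    congr 1; ext s; ring_nf
  set M := f (σ + h) - f σ with hM
  have hcs : ContinuousOn (fun s => f (s + h) - f s - M) (Set.Icc 0 σ) := by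
    refine (ContinuousOn.sub (hc.comp (by fun_prop) ?_) (hc.mono ?_)).sub continuousOn_const
    · intro s hs
      exact ⟨by linarith [hs.1], by linarith [hs.2]⟩
    · exact Icc_subset_Icc le_rfl (by linarith)
  have hds : ∀ s ∈ Set.Ioc 0 σ, HasDerivAt (fun s => f (s + h) - f s - M) (f' (s + h) - f' s) s := by
    intro s hs
    refine HasDerivAt.sub_const _ (HasDerivAt.sub ?_ (hd s ⟨hs.1, by linarith [hs.2]⟩))
    exact (hd (s + h) ⟨by linarith [hs.1], by linarith [hs.2]⟩).comp_add_const s h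
  obtain ⟨C, hC⟩ := deriv_bound σ 0 _ _ (hds σ ⟨hσ, le_rfl⟩) (by simp [hM])
  have hi3 : IntervalIntegrable (fun s => (σ - s) ^ (-α) * (f' (s + h) - f' s)) volume 0 σ := by
    refine (hiB'.sub hi2).congr ?_
    intro s _
    simp only; ring
  have e1 := time_piece α 0 σ σ hα.1 hσ.le le_rfl (fun s => f (s + h) - f s - M)
    (fun s => f' (s + h) - f' s) (cont_full α 1 C 0 σ hα.1 hα.2 _ hcs hC)
    (fun s hs => hds s ⟨hs.1, hs.2.le⟩) hi3 (fun s hs => by linarith [hm1 s hs])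
  have e2 := time_piece α 0 h (σ + h) hα.1 hh.le (by linarith) (fun s => f s - f 0 - M) f' ?_
    (fun s hs => ((hd s ⟨hs.1, by linarith [hs.2]⟩).sub_const _).sub_const _) hiA
    (fun s hs => by linarith [hm2 s hs])
  · have e3 : ∫ s in (0:ℝ)..σ, (σ - s) ^ (-α) * (f' (s + h) - f' s) =
        (∫ s in (0:ℝ)..σ, (σ - s) ^ (-α) * f' (s + h)) - ∫ s in (0:ℝ)..σ, (σ - s) ^ (-α) * f' s := by
      rw [← intervalIntegral.integral_sub hiB' hi2]
      congr 1; ext s; ring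
    have hM0 : 0 ≤ M := by simpa using hm2 0 ⟨le_rfl, hh.le⟩
    have h4 : 0 ≤ (σ + h - 0) ^ (-α) * M := mul_nonneg (Real.rpow_nonneg (by linarith) _) hM0
    simp only [hM, sub_self, mul_zero, zero_add, add_sub_cancel_right, sub_zero, zero_sub] at e1 e2 h4
    rw [← hsplit, hshift]
    have : (σ + h) ^ (-α) * -(f (σ + h) - f σ) = - ((σ + h) ^ (-α) * (f (σ + h) - f σ)) := by ring
    rw [e3] at e1
    linarith
  · refine ContinuousOn.mul (ContinuousOn.rpow_const (by fun_prop) ?_)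
      (((hc.mono (Icc_subset_Icc le_rfl (by linarith))).sub continuousOn_const).sub continuousOn_const)
    intro s hs
    left; linarith [hs.2]

/-- Key inequality for the spatial operator at a maximum of the averaged function. -/
lemma space_step (a b δ h x K : ℝ) (hδ : 0 < δ ∧ δ < 1) (hh : 0 < h) (hax : a + h < x) (hxb : x < b)
    (f g A : ℝ → ℝ)
    (hfd : ∀ y ∈ Set.Icc a b, HasDerivAt f (g y) y) (hg : ContinuousOn g (Set.Icc a b))
    (hK : ∀ y ∈ Set.Icc a b, |g y| ≤ K)
    (hAd : ∀ s ∈ Set.Ioo (a + h) b, HasDerivAt A (f s - f (s - h)) s)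
    (hAc : ContinuousOn A (Set.Icc (a + h) b))
    (hAm : ∀ s ∈ Set.Icc (a + h) b, A s ≤ A x) :
    (∫ s in a..x, (x - s) ^ (-δ) * g s) - (∫ s in a..(x - h), (x - h - s) ^ (-δ) * g s) ≤
      K * h * ((x - a - h) ^ (-δ) - (x - a) ^ (-δ))
        - δ * (x - a - h) ^ (-(δ + 1)) * (A x - A (a + h)) := by
  have hK0 : 0 ≤ K := (abs_nonneg _).trans (hK a ⟨le_rfl, by linarith⟩)
  have hx0 : f x - f (x - h) = 0 := by
    have hloc : IsLocalMax A x := by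
      filter_upwards [Ioo_mem_nhds hax hxb] with s hs
      exact hAm s ⟨hs.1.le, hs.2.le⟩
    exact hloc.hasDerivAt_eq_zero (hAd x ⟨hax, hxb⟩)
  set G : ℝ → ℝ := fun s => f s - f (s - h) with hG
  have hGd : ∀ s ∈ Set.Icc (a + h) x, HasDerivAt G (g s - g (s - h)) s := by
    intro s hs
    refine (hfd s ⟨by linarith [hs.1], by linarith [hs.2]⟩).sub ?_
    exact (hfd (s - h) ⟨by linarith [hs.1], by linarith [hs.2]⟩).comp_sub_const s h
  have hGb : ∀ s ∈ Set.Icc (a + h) x, |G s| ≤ 2 * K * (x - s) := by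
    intro s hs
    have := Convex.norm_image_sub_le_of_norm_hasDerivWithin_le (f := G)
      (f' := fun s => g s - g (s - h)) (s := Set.Icc (a + h) x) (C := 2 * K)
      (fun y hy => (hGd y hy).hasDerivWithinAt) ?_ (convex_Icc _ _) (x := x) (y := s)
      ⟨hax.le, le_rfl⟩ hs
    · have hGx : G x = 0 := hx0
      rw [hGx, sub_zero, Real.norm_eq_abs, Real.norm_eq_abs, abs_sub_comm s x,
        abs_of_nonneg (sub_nonneg.2 hs.2)] at this
      exact this
    · intro y hy
      have h1 := hK y ⟨by linarith [hy.1], by linarith [hy.2]⟩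
      have h2 := hK (y - h) ⟨by linarith [hy.1], by linarith [hy.2]⟩
      rw [Real.norm_eq_abs]
      exact (abs_sub _ _).trans (by linarith)
  have hAb : ∀ s ∈ Set.Ioc (a + h) x, |A s - A x| ≤ 2 * K * (x - s) ^ 2 := by
    intro s hs
    have := Convex.norm_image_sub_le_of_norm_hasDerivWithin_le (f := A)
      (f' := G) (s := Set.Icc s x) (C := 2 * K * (x - s))
      (fun y hy => (hAd y ⟨by linarith [hy.1, hs.1], by linarith [hy.2]⟩).hasDerivWithinAt) ?_
      (convex_Icc _ _) (x := x) (y := s)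
      ⟨hs.2, le_rfl⟩ ⟨le_rfl, hs.2⟩
    · rw [Real.norm_eq_abs, Real.norm_eq_abs, abs_sub_comm s x,
        abs_of_nonneg (sub_nonneg.2 hs.2)] at this
      linarith
    · intro y hy
      rw [Real.norm_eq_abs]
      refine (hGb y ⟨by linarith [hy.1, hs.1], hy.2⟩).trans ?_
      have := hy.1
      gcongr
  have hGc : ContinuousOn G (Set.Icc (a + h) x) := fun s hs => (hGd s hs).continuousAt.continuousWithinAt
  have hAc' : ContinuousOn A (Set.Icc (a + h) x) := hAc.mono (Icc_subset_Icc le_rfl hxb.le)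
  have hev : ∀ᶠ s in 𝓝[Set.Icc (a + h) x] x, s ∈ Set.Ioc (a + h) x := by
    filter_upwards [self_mem_nhdsWithin, nhdsWithin_le_nhds (Ioi_mem_nhds hax)] with s hs hs'
    exact ⟨hs', hs.2⟩
  have c1 : ContinuousOn (fun s => (x - s) ^ (-δ) * G s) (Set.Icc (a + h) x) := by
    refine cont_full δ 1 (2 * K) _ _ hδ.1 hδ.2 _ hGc ?_
    filter_upwards [hev] with s hs
    rw [Real.rpow_one]
    exact hGb s ⟨hs.1.le, hs.2⟩
  have c2 : ContinuousOn (fun s => (x - s) ^ (-(δ + 1)) * (A s - A x)) (Set.Icc (a + h) x) := by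
    refine cont_full (δ + 1) 2 (2 * K) _ _ (by linarith) (by linarith) _
      (hAc'.sub continuousOn_const) ?_
    filter_upwards [hev] with s hs
    rw [Real.rpow_two]
    exact hAb s hs
  have iL : IntervalIntegrable (fun s => (x - s) ^ (-δ) * g s) volume a (a + h) := by
    refine kernel_mul_int _ _ _ hδ.2 _ _ (hg.mono ?_)
    rw [uIcc_of_le (by linarith)]
    exact Icc_subset_Icc le_rfl (by linarith)
  have iR : IntervalIntegrable (fun s => (x - s) ^ (-δ) * g s) volume (a + h) x := by
    refine kernel_mul_int _ _ _ hδ.2 _ _ (hg.mono ?_)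
    rw [uIcc_of_le (by linarith)]
    exact Icc_subset_Icc (by linarith) (by linarith)
  have iS : IntervalIntegrable (fun s => (x - s) ^ (-δ) * g (s - h)) volume (a + h) x := by
    refine kernel_mul_int _ _ _ hδ.2 _ _ (hg.comp (by fun_prop) ?_)
    rw [uIcc_of_le (by linarith)]
    intro s hs
    exact ⟨by linarith [hs.1], by linarith [hs.2]⟩
  have hsplit := intervalIntegral.integral_add_adjacent_intervals iL iR
  have hshift : ∫ s in a..(x - h), (x - h - s) ^ (-δ) * g s =
      ∫ s in (a + h)..x, (x - s) ^ (-δ) * g (s - h) := by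
    have := intervalIntegral.integral_comp_sub_right (a := a + h) (b := x)
      (fun s => (x - h - s) ^ (-δ) * g s) h
    rw [add_sub_cancel_right] at this
    rw [← this]
    congr 1; ext s; ring_nf
  have main : ∫ s in (a + h)..x, (x - s) ^ (-δ) * (g s - g (s - h)) ≤
      ((x - x) ^ (-δ) * G x - δ * ((x - x) ^ (-(δ + 1)) * (A x - A x))) -
      ((x - (a + h)) ^ (-δ) * G (a + h) - δ * ((x - (a + h)) ^ (-(δ + 1)) * (A (a + h) - A x))) := by
    refine intervalIntegral.integral_le_sub_of_hasDeriv_right_of_le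
      (g := fun s => (x - s) ^ (-δ) * G s - δ * ((x - s) ^ (-(δ + 1)) * (A s - A x)))
      (g' := fun s => (δ * (x - s) ^ (-δ - 1) * G s + (x - s) ^ (-δ) * (g s - g (s - h))) -
        δ * ((δ + 1) * (x - s) ^ (-(δ + 1) - 1) * (A s - A x) + (x - s) ^ (-(δ + 1)) * G s))
      hax.le (c1.sub (continuousOn_const.mul c2)) ?_ ?_ ?_
    · intro s hs
      refine HasDerivAt.hasDerivWithinAt ?_
      refine HasDerivAt.sub ((hasDerivAt_kernel δ x s hs.2).mul (hGd s ⟨hs.1.le, hs.2.le⟩)) ?_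
      refine HasDerivAt.const_mul δ ((hasDerivAt_kernel (δ + 1) x s hs.2).mul ?_)
      exact (hAd s ⟨hs.1, by linarith [hs.2]⟩).sub_const _
    · rw [← intervalIntegrable_iff_integrableOn_Icc_of_le hax.le]
      refine (iR.sub iS).congr ?_
      intro s _
      simp only; ring
    · intro s hs
      have h1 : 0 < x - s := by linarith [hs.2]
      have h2 : 0 < (x - s) ^ (-(δ + 1) - 1) := Real.rpow_pos_of_pos h1 _
      have h3 : A s - A x ≤ 0 := by linarith [hAm s ⟨hs.1.le, by linarith [hs.2]⟩]
      have h4 : δ * ((δ + 1) * (x - s) ^ (-(δ + 1) - 1)) * (A s - A x) ≤ 0 := by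
        have := hδ.1
        exact mul_nonpos_of_nonneg_of_nonpos (by positivity) h3
      have h5 : -δ - 1 = -(δ + 1) := by ring
      simp only [h5]
      linarith
  have hGa : G (a + h) = ∫ s in a..(a + h), g s := by
    rw [intervalIntegral.integral_eq_sub_of_hasDerivAt (f := f)]
    · simp [hG]
    · intro s hs
      rw [uIcc_of_le (by linarith)] at hs
      exact hfd s ⟨hs.1, by linarith [hs.2]⟩
    · refine ContinuousOn.intervalIntegrable (hg.mono ?_)
      rw [uIcc_of_le (by linarith)]
      exact Icc_subset_Icc le_rfl (by linarith)
  have ig : IntervalIntegrable (fun s => (x - (a + h)) ^ (-δ) * g s) volume a (a + h) := by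
    refine ContinuousOn.intervalIntegrable (continuousOn_const.mul (hg.mono ?_))
    rw [uIcc_of_le (by linarith)]
    exact Icc_subset_Icc le_rfl (by linarith)
  have first : (∫ s in a..(a + h), (x - s) ^ (-δ) * g s) - (x - (a + h)) ^ (-δ) * G (a + h) ≤
      K * h * ((x - a - h) ^ (-δ) - (x - a) ^ (-δ)) := by
    rw [hGa, ← intervalIntegral.integral_const_mul, ← intervalIntegral.integral_sub iL ig]
    have := intervalIntegral.norm_integral_le_of_norm_le_const (a := a) (b := a + h)
      (f := fun s => (x - s) ^ (-δ) * g s - (x - (a + h)) ^ (-δ) * g s)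
      (C := ((x - a - h) ^ (-δ) - (x - a) ^ (-δ)) * K) ?_
    · refine (le_abs_self _).trans (this.trans (le_of_eq ?_))
      rw [add_sub_cancel_left, abs_of_pos hh]; ring
    · intro s hs
      rw [uIoc_of_le (by linarith)] at hs
      rw [← sub_mul, norm_mul, Real.norm_eq_abs, Real.norm_eq_abs]
      have e1 : (x - a) ^ (-δ) ≤ (x - s) ^ (-δ) :=
        Real.rpow_le_rpow_of_nonpos (by linarith [hs.2]) (by linarith [hs.1]) (by linarith)
      have e2 : (x - s) ^ (-δ) ≤ (x - (a + h)) ^ (-δ) :=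
        Real.rpow_le_rpow_of_nonpos (by linarith [hs.2]) (by linarith [hs.2]) (by linarith)
      have e3 : x - a - h = x - (a + h) := by ring
      rw [e3, abs_of_nonpos (by linarith)]
      refine mul_le_mul (by linarith) (hK s ⟨hs.1.le, by linarith [hs.2]⟩) (abs_nonneg _) (by linarith)
  have e4 : ∫ s in (a + h)..x, (x - s) ^ (-δ) * (g s - g (s - h)) =
      (∫ s in (a + h)..x, (x - s) ^ (-δ) * g s) - ∫ s in (a + h)..x, (x - s) ^ (-δ) * g (s - h) := by
    rw [← intervalIntegral.integral_sub iR iS]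
    congr 1; ext s; ring
  have hGx : G x = 0 := hx0
  rw [hGx, e4] at main
  rw [← hsplit, hshift]
  have e3 : x - a - h = x - (a + h) := by ring
  rw [e3] at first ⊢
  simp only [sub_self, mul_zero] at main
  linarith

/-- Maximum principle in space. -/
lemma space_max (a b δ : ℝ) (hδ : 0 < δ ∧ δ < 1) (hab : a < b) (f g J H : ℝ → ℝ)
    (hfd : ∀ y ∈ Set.Icc a b, HasDerivAt f (g y) y) (hg : ContinuousOn g (Set.Icc a b))
    (hfa : f a = 0) (hfb : f b = 0)
    (hJ : ∀ y ∈ Set.Icc a b, J y = ∫ s in a..y, (y - s) ^ (-δ) * g s)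
    (hJd : ∀ x ∈ Set.Ioo a b, HasDerivAt J (H x) x) (hH : ContinuousOn H (Set.Ioo a b))
    (x0 : ℝ) (hx0 : x0 ∈ Set.Icc a b) (hpos : 0 < f x0) :
    ∃ x ∈ Set.Ioo a b, (∀ y ∈ Set.Icc a b, f y ≤ f x) ∧
      H x ≤ - (δ * (b - a) ^ (-(δ + 1)) * f x) := by
  obtain ⟨K, hK⟩ := isCompact_Icc.exists_bound_of_continuousOn hg
  simp only [Real.norm_eq_abs] at hK
  have hK0 : 0 ≤ K := (abs_nonneg _).trans (hK a ⟨le_rfl, hab.le⟩)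
  have hfc : ContinuousOn f (Set.Icc a b) := fun s hs => (hfd s hs).continuousAt.continuousWithinAt
  have hfL : ∀ y ∈ Set.Icc a b, ∀ z ∈ Set.Icc a b, |f y - f z| ≤ K * |y - z| := by
    intro y hy z hz
    exact Convex.norm_image_sub_le_of_norm_hasDerivWithin_le (f := f)
      (f' := g) (s := Set.Icc a b) (C := K)
      (fun y hy => (hfd y hy).hasDerivWithinAt) hK (convex_Icc _ _) hz hy
  have hfi : ∀ p ∈ Set.Icc a b, ∀ q ∈ Set.Icc a b, IntervalIntegrable f volume p q := by
    intro p hp q hq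
    exact (hfc.mono (uIcc_subset_Icc hp hq)).intervalIntegrable
  set Φ : ℝ → ℝ := fun y => ∫ s in a..y, f s with hΦ
  have hΦd : ∀ y ∈ Set.Ioo a b, HasDerivAt Φ (f y) y := by
    intro y hy
    refine intervalIntegral.integral_hasDerivAt_right
      (hfi a ⟨le_rfl, hab.le⟩ y ⟨hy.1.le, hy.2.le⟩) ?_ (hfd y ⟨hy.1.le, hy.2.le⟩).continuousAt
    exact (hfc.mono Ioo_subset_Icc_self).stronglyMeasurableAtFilter isOpen_Ioo y hy
  have hΦc : ContinuousOn Φ (Set.Icc a b) := by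
    have := intervalIntegral.continuousOn_primitive_interval' (a := a)
      (hfi a ⟨le_rfl, hab.le⟩ b ⟨hab.le, le_rfl⟩) left_mem_uIcc
    rwa [uIcc_of_le hab.le] at this
  -- averaged function
  set A : ℝ → ℝ → ℝ := fun h s => Φ s - Φ (s - h) with hA
  have hAavg : ∀ h, 0 < h → ∀ s ∈ Set.Icc (a + h) b, |A h s - h * f s| ≤ K * h * h := by
    intro h hh s hs
    have hs1 : s ∈ Set.Icc a b := ⟨by linarith [hs.1], hs.2⟩
    have hs2 : s - h ∈ Set.Icc a b := ⟨by linarith [hs.1], by linarith [hs.2]⟩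
    have h1 : A h s = ∫ r in (s - h)..s, f r := by
      simp only [hA, hΦ]
      exact intervalIntegral.integral_interval_sub_left (hfi _ ⟨le_rfl, hab.le⟩ _ hs1)
        (hfi _ ⟨le_rfl, hab.le⟩ _ hs2)
    have h2 : h * f s = ∫ r in (s - h)..s, f s := by simp
    rw [h1, h2, ← intervalIntegral.integral_sub (hfi _ hs2 _ hs1) (by simp)]
    have := intervalIntegral.norm_integral_le_of_norm_le_const (a := s - h) (b := s)
      (f := fun r => f r - f s) (C := K * h) ?_
    · rwa [sub_sub_cancel, abs_of_pos hh] at this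
    · intro r hr
      rw [uIoc_of_le (by linarith)] at hr
      refine (hfL r ⟨by linarith [hr.1, hs.1], by linarith [hr.2, hs.2]⟩ s hs1).trans ?_
      gcongr
      rw [abs_le]; constructor <;> linarith [hr.1, hr.2]
  have hAd : ∀ h, 0 < h → ∀ s ∈ Set.Ioo (a + h) b, HasDerivAt (A h) (f s - f (s - h)) s := by
    intro h hh s hs
    refine (hΦd s ⟨by linarith [hs.1], hs.2⟩).sub ?_
    exact (hΦd (s - h) ⟨by linarith [hs.1], by linarith [hs.2]⟩).comp_sub_const s h
  have hAc : ∀ h, 0 < h → ContinuousOn (A h) (Set.Icc (a + h) b) := by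
    intro h hh
    refine (hΦc.mono (Icc_subset_Icc (by linarith) le_rfl)).sub (hΦc.comp (by fun_prop) ?_)
    intro s hs
    exact ⟨by linarith [hs.1], by linarith [hs.2]⟩
  -- sequence of maxima
  set η : ℕ → ℝ := fun n => (b - a) / (n + 1) with hη
  have hη0 : ∀ n, 0 < η n := fun n => div_pos (by linarith) (by positivity)
  have hηle : ∀ n, η n ≤ b - a := fun n => div_le_self (by linarith) (by
    have : (0:ℝ) ≤ n := by positivity
    linarith)
  have hηlim : Tendsto η atTop (𝓝 0) := by
    have := (tendsto_one_div_add_atTop_nhds_zero_nat (𝕜 := ℝ)).const_mul (b - a)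
    rw [mul_zero] at this
    refine this.congr (fun n => ?_)
    simp [hη, div_eq_mul_inv]
  have hex : ∀ n, ∃ x ∈ Set.Icc (a + η n) b, ∀ s ∈ Set.Icc (a + η n) b, A (η n) s ≤ A (η n) x := by
    intro n
    exact isCompact_Icc.exists_isMaxOn ⟨b, by linarith [hηle n], le_rfl⟩ (hAc _ (hη0 n))
  choose X hX hXm using hex
  have hXab : ∀ n, X n ∈ Set.Icc a b := fun n => ⟨by linarith [(hX n).1, hη0 n], (hX n).2⟩
  obtain ⟨x, hx, ψ, hψ, hlim⟩ := isCompact_Icc.tendsto_subseq hXab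
  have hηψ : Tendsto (fun n => η (ψ n)) atTop (𝓝 0) := hηlim.comp hψ.tendsto_atTop
  have hlim' : Tendsto (fun n => X (ψ n)) atTop (𝓝 x) := hlim
  have hfX : Tendsto (fun n => f (X (ψ n))) atTop (𝓝 (f x)) := (hfd x hx).continuousAt.tendsto.comp hlim'
  have hmaxpos : ∀ y ∈ Set.Ioc a b, f y ≤ f x := by
    intro y hy
    have hev : ∀ᶠ n in atTop, f y ≤ f (X (ψ n)) + 2 * K * η (ψ n) := by
      have : ∀ᶠ n in atTop, η (ψ n) < y - a := (tendsto_order.1 hηψ).2 _ (by linarith [hy.1])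
      filter_upwards [this] with n hn
      have hyI : y ∈ Set.Icc (a + η (ψ n)) b := ⟨by linarith, hy.2⟩
      have h1 := (abs_le.1 (hAavg _ (hη0 (ψ n)) y hyI)).1
      have h2 := (abs_le.1 (hAavg _ (hη0 (ψ n)) _ (hX (ψ n)))).2
      have h3 := hXm (ψ n) y hyI
      have h4 := hη0 (ψ n)
      have h5 : η (ψ n) * f y ≤ η (ψ n) * (f (X (ψ n)) + 2 * K * η (ψ n)) := by linarith
      exact le_of_mul_le_mul_left h5 h4
    have hl : Tendsto (fun n => f (X (ψ n)) + 2 * K * η (ψ n)) atTop (𝓝 (f x + 2 * K * 0)) :=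
      hfX.add (hηψ.const_mul _)
    simpa using ge_of_tendsto hl hev
  have hx0a : x0 ≠ a := by rintro rfl; linarith
  have hxpos : 0 < f x := hpos.trans_le (hmaxpos x0 ⟨lt_of_le_of_ne hx0.1 (Ne.symm hx0a), hx0.2⟩)
  have hxI : x ∈ Set.Ioo a b := by
    refine ⟨lt_of_le_of_ne hx.1 ?_, lt_of_le_of_ne hx.2 ?_⟩
    · rintro rfl; linarith
    · rintro rfl; linarith
  refine ⟨x, hxI, ?_, ?_⟩
  · intro y hy
    rcases eq_or_lt_of_le hy.1 with h | h
    · rw [← h, hfa]; exact hxpos.le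
    · exact hmaxpos y ⟨h, hy.2⟩
  -- limit inequality
  have hXh : Tendsto (fun n => X (ψ n) - η (ψ n)) atTop (𝓝 x) := by
    simpa using hlim'.sub hηψ
  have hev1 : ∀ᶠ n in atTop, a < X (ψ n) - η (ψ n) := (tendsto_order.1 hXh).1 _ hxI.1
  have hev2 : ∀ᶠ n in atTop, X (ψ n) < b := (tendsto_order.1 hlim').2 _ hxI.2
  have hmvt : ∀ n, ∃ ξ, a < X (ψ n) - η (ψ n) → X (ψ n) < b →
      ξ ∈ Set.Ioo (X (ψ n) - η (ψ n)) (X (ψ n)) ∧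
      H ξ = (J (X (ψ n)) - J (X (ψ n) - η (ψ n))) / η (ψ n) := by
    intro n
    by_cases hc : a < X (ψ n) - η (ψ n) ∧ X (ψ n) < b
    · have h4 := hη0 (ψ n)
      obtain ⟨ξ, hξ, he⟩ := exists_hasDerivAt_eq_slope J H
        (a := X (ψ n) - η (ψ n)) (b := X (ψ n)) (by linarith)
        (fun s hs => (hJd s ⟨by linarith [hs.1, hc.1], by linarith [hs.2, hc.2]⟩).continuousAt.continuousWithinAt)
        (fun s hs => hJd s ⟨by linarith [hs.1, hc.1], by linarith [hs.2, hc.2]⟩)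
      refine ⟨ξ, fun _ _ => ⟨hξ, ?_⟩⟩
      rw [he, sub_sub_cancel]
    · exact ⟨0, fun h1 h2 => absurd ⟨h1, h2⟩ hc⟩
  choose ξ hξ using hmvt
  have hξlim : Tendsto ξ atTop (𝓝 x) := by
    refine tendsto_of_tendsto_of_tendsto_of_le_of_le' hXh hlim' ?_ ?_
    · filter_upwards [hev1, hev2] with n h1 h2
      exact (hξ n h1 h2).1.1.le
    · filter_upwards [hev1, hev2] with n h1 h2
      exact (hξ n h1 h2).1.2.le
  have hHlim : Tendsto (fun n => H (ξ n)) atTop (𝓝 (H x)) :=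
    (hH.continuousAt (isOpen_Ioo.mem_nhds hxI)).tendsto.comp hξlim
  have hbound : ∀ᶠ n in atTop, H (ξ n) ≤
      K * ((X (ψ n) - a - η (ψ n)) ^ (-δ) - (X (ψ n) - a) ^ (-δ))
        - δ * (X (ψ n) - a - η (ψ n)) ^ (-(δ + 1)) * (f (X (ψ n)) - 3 * K * η (ψ n)) := by
    filter_upwards [hev1, hev2] with n h1 h2
    rw [(hξ n h1 h2).2]
    have h4 := hη0 (ψ n)
    set h := η (ψ n)
    set z := X (ψ n) with hz
    rw [div_le_iff₀ h4, hJ z (hXab _), hJ (z - h) ⟨h1.le, by linarith⟩]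
    have hst := space_step a b δ h z K hδ h4 (by linarith) h2 f g (A h) hfd hg hK (hAd h h4) (hAc h h4)
      (hXm (ψ n))
    refine hst.trans ?_
    have h5 := (abs_le.1 (hAavg _ h4 z (hX (ψ n)))).1
    have h6 := (abs_le.1 (hAavg _ h4 (a + h) ⟨le_rfl, by linarith⟩)).2
    have h7 : f (a + h) ≤ K * h := by
      have := hfL (a + h) ⟨by linarith, by linarith⟩ a ⟨le_rfl, hab.le⟩
      rw [hfa, sub_zero, add_sub_cancel_left, abs_of_pos h4] at this
      exact (le_abs_self _).trans this
    have h8 : h * f (a + h) ≤ h * (K * h) := by gcongr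
    have h9 : (f z - 3 * K * h) * h ≤ A h z - A h (a + h) := by linarith
    have h10 : 0 ≤ δ * (z - a - h) ^ (-(δ + 1)) :=
      mul_nonneg hδ.1.le (Real.rpow_nonneg (by linarith) _)
    have h11 := mul_le_mul_of_nonneg_left h9 h10
    linarith
  have hxa : 0 < x - a := by linarith [hxI.1]
  have t1 : Tendsto (fun n => X (ψ n) - a) atTop (𝓝 (x - a)) := hlim'.sub_const a
  have t2 : Tendsto (fun n => X (ψ n) - a - η (ψ n)) atTop (𝓝 (x - a)) := by
    simpa using t1.sub hηψ
  have t3 : Tendsto (fun n => K * ((X (ψ n) - a - η (ψ n)) ^ (-δ) - (X (ψ n) - a) ^ (-δ))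
        - δ * (X (ψ n) - a - η (ψ n)) ^ (-(δ + 1)) * (f (X (ψ n)) - 3 * K * η (ψ n))) atTop
      (𝓝 (K * ((x - a) ^ (-δ) - (x - a) ^ (-δ)) - δ * (x - a) ^ (-(δ + 1)) * (f x - 3 * K * 0))) := by
    refine Tendsto.sub (Tendsto.const_mul _ (Tendsto.sub (t2.rpow_const (Or.inl hxa.ne'))
      (t1.rpow_const (Or.inl hxa.ne')))) (Tendsto.mul (Tendsto.const_mul _ (t2.rpow_const (Or.inl hxa.ne')))
      (hfX.sub (hηψ.const_mul _)))
  have hfin := le_of_tendsto_of_tendsto hHlim t3 hbound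
  have e1 : (b - a) ^ (-(δ + 1)) ≤ (x - a) ^ (-(δ + 1)) :=
    Real.rpow_le_rpow_of_nonpos hxa (by linarith [hxI.2]) (by linarith)
  have e2 : δ * (b - a) ^ (-(δ + 1)) * f x ≤ δ * (x - a) ^ (-(δ + 1)) * f x := by
    have := hδ.1
    gcongr
  simp only [sub_self, mul_zero, sub_zero, zero_sub] at hfin
  linarith

/-- The Beta constant. -/
noncomputable def betaC (β₁ β₂ : ℝ) : ℝ := ∫ θ in (0:ℝ)..1, (1 - θ) ^ (-β₁) * θ ^ (-β₂)

lemma betaC_pos (β₁ β₂ : ℝ) (h₁ : β₁ < 1) (h₂ : β₂ < 1) : 0 < betaC β₁ β₂ := by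
  refine intervalIntegral.intervalIntegral_pos_of_pos_on ?_ ?_ one_pos
  · refine good_int β₁ 1 1 h₁ (fun θ => θ ^ (-β₂)) ⟨one_pos, le_rfl⟩ ?_
      (intervalIntegral.intervalIntegrable_rpow' (by linarith))
    refine ContinuousOn.rpow_const continuousOn_id ?_
    intro s hs
    left; exact hs.1.ne'
  · intro s hs
    exact mul_pos (Real.rpow_pos_of_pos (by linarith [hs.2]) _) (Real.rpow_pos_of_pos hs.1 _)

lemma beta_inner (β₁ β₂ r y : ℝ) (hry : r < y) :
    ∫ s in r..y, (y - s) ^ (-β₁) * (s - r) ^ (-β₂) =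
      (y - r) ^ (-(β₁ + β₂ - 1)) * betaC β₁ β₂ := by
  have hp : 0 < y - r := by linarith
  have h := intervalIntegral.integral_comp_mul_add (a := 0) (b := 1)
    (fun s => (y - s) ^ (-β₁) * (s - r) ^ (-β₂)) hp.ne' r
  have e1 : (y - r) * 0 + r = r := by ring
  have e2 : (y - r) * 1 + r = y := by ring
  rw [e1, e2] at h
  have h2 : ∫ θ in (0:ℝ)..1, (y - ((y - r) * θ + r)) ^ (-β₁) * ((y - r) * θ + r - r) ^ (-β₂) =
      (y - r) ^ (-β₁ + -β₂) * betaC β₁ β₂ := by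
    unfold betaC
    rw [← intervalIntegral.integral_const_mul]
    refine intervalIntegral.integral_congr ?_
    intro θ hθ
    rw [uIcc_of_le zero_le_one] at hθ
    simp only
    have e3 : y - ((y - r) * θ + r) = (y - r) * (1 - θ) := by ring
    have e4 : (y - r) * θ + r - r = (y - r) * θ := by ring
    rw [e3, e4, Real.mul_rpow hp.le (by linarith [hθ.2]), Real.mul_rpow hp.le hθ.1, Real.rpow_add hp]
    ring
  simp only [smul_eq_mul] at h
  rw [h2] at h
  have e5 : -(β₁ + β₂ - 1) = 1 + (-β₁ + -β₂) := by ring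
  rw [e5, Real.rpow_add hp, Real.rpow_one, mul_assoc, h, ← mul_assoc, mul_inv_cancel₀ hp.ne', one_mul]

lemma kernel_integral (γ p q : ℝ) (hγ : γ < 1) :
    ∫ r in p..q, (q - r) ^ (-γ) = (q - p) ^ (1 - γ) / (1 - γ) := by
  rw [intervalIntegral.integral_comp_sub_left (fun r => r ^ (-γ)), sub_self,
    integral_rpow (Or.inl (by linarith)), Real.zero_rpow (by linarith)]
  have : -γ + 1 = 1 - γ := by ring
  rw [this, sub_zero]

/-- Composition of two fractional integrals. -/
lemma semigroup (β₁ β₂ a b : ℝ) (h₁ : β₁ < 1) (h₂ : β₂ < 1) (hs : 1 < β₁ + β₂)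
    (g : ℝ → ℝ) (hg : ContinuousOn g (Set.Icc a b)) (y : ℝ) (hy : y ∈ Set.Icc a b) :
    ∫ s in a..y, (y - s) ^ (-β₁) * ∫ r in a..s, (s - r) ^ (-β₂) * g r =
      betaC β₁ β₂ * ∫ r in a..y, (y - r) ^ (-(β₁ + β₂ - 1)) * g r := by
  obtain ⟨hay, hyb⟩ := hy
  obtain ⟨K, hK⟩ := isCompact_Icc.exists_bound_of_continuousOn hg
  set μ := volume.restrict (Set.Ioc a y) with hμ
  set k : ℝ → ℝ → ℝ := fun s r => (Set.Iio s).indicator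
    (fun r => (y - s) ^ (-β₁) * (s - r) ^ (-β₂)) r with hk
  have hkm : Measurable (Function.uncurry k) := by
    have : Function.uncurry k = fun p : ℝ × ℝ =>
        if p.2 < p.1 then (y - p.1) ^ (-β₁) * (p.1 - p.2) ^ (-β₂) else 0 := by
      ext ⟨s, r⟩
      simp [hk, Set.indicator_apply]
    rw [this]
    refine Measurable.ite (measurableSet_lt measurable_snd measurable_fst) ?_ measurable_const
    fun_prop
  -- inner integrals of the kernel
  have hin : ∀ s ∈ Set.Ioc a y, ∀ q : ℝ → ℝ, ∫ r, k s r * q r ∂μ =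
      (y - s) ^ (-β₁) * ∫ r in a..s, (s - r) ^ (-β₂) * q r := by
    intro s hs q
    have e1 : (fun r => k s r * q r) = (Set.Iio s).indicator
        (fun r => (y - s) ^ (-β₁) * ((s - r) ^ (-β₂) * q r)) := by
      ext r
      simp only [hk, Set.indicator_apply]
      split_ifs <;> ring
    have e2 : Set.Iio s ∩ Set.Ioc a y = Set.Ioo a s := by
      ext r; simp only [Set.mem_inter_iff, Set.mem_Iio, Set.mem_Ioc, Set.mem_Ioo]
      constructor
      · rintro ⟨h1, h2, h3⟩; exact ⟨h2, h1⟩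
      · rintro ⟨h1, h2⟩; exact ⟨h2, h1, by linarith [hs.2]⟩
    rw [e1, integral_indicator measurableSet_Iio, hμ, Measure.restrict_restrict measurableSet_Iio, e2,
      intervalIntegral.integral_of_le hs.1.le, ← integral_Ioc_eq_integral_Ioo, integral_const_mul]
  have hkn : ∀ s ∈ Set.Ioc a y, ∀ r, 0 ≤ k s r := by
    intro s hs r
    refine Set.indicator_apply_nonneg ?_
    intro hr
    have hr' : r < s := hr
    exact mul_nonneg (Real.rpow_nonneg (by linarith [hs.2]) _) (Real.rpow_nonneg (by linarith) _)
  have hkint : Integrable (Function.uncurry k) (μ.prod μ) := by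
    rw [integrable_prod_iff hkm.aestronglyMeasurable]
    constructor
    · refine Eventually.of_forall (fun s => ?_)
      have h := (kernel_int β₂ a s h₂ y)
      rw [intervalIntegrable_iff_integrableOn_Ioc_of_le hay] at h
      exact (h.const_mul ((y - s) ^ (-β₁))).indicator measurableSet_Iio
    · have h : IntervalIntegrable (fun s => (y - s) ^ (-β₁) * ((s - a) ^ (1 - β₂) / (1 - β₂)))
          volume a y := by
        refine kernel_mul_int _ _ _ h₁ _ _ ?_
        refine ContinuousOn.div_const (ContinuousOn.rpow_const (by fun_prop) ?_) _
        intro s _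
        right; linarith
      rw [intervalIntegrable_iff_integrableOn_Ioc_of_le hay] at h
      refine Integrable.congr h ?_
      refine (ae_restrict_iff' measurableSet_Ioc).2 (Eventually.of_forall (fun s hs => ?_))
      have e1 : ∀ r, ‖Function.uncurry k (s, r)‖ = k s r * 1 := by
        intro r
        rw [mul_one, Function.uncurry_apply_pair, Real.norm_of_nonneg (hkn s hs r)]
      simp only [e1]
      rw [hin s hs (fun _ => 1)]
      simp only [mul_one]
      rw [kernel_integral _ _ _ h₂]
  have hgm : AEStronglyMeasurable g μ :=
    (hg.mono (Set.Ioc_subset_Icc_self.trans (Icc_subset_Icc le_rfl hyb))).aestronglyMeasurable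
      measurableSet_Ioc
  have hFint : Integrable (Function.uncurry (fun s r => k s r * g r)) (μ.prod μ) := by
    refine Integrable.mono' (hkint.norm.const_mul K) (hkm.aestronglyMeasurable.mul hgm.comp_snd) ?_
    rw [hμ, Measure.prod_restrict]
    refine (ae_restrict_iff' (measurableSet_Ioc.prod measurableSet_Ioc)).2
      (Eventually.of_forall ?_)
    rintro ⟨s, r⟩ ⟨_, hr⟩
    simp only [Function.uncurry_apply_pair, norm_mul]
    rw [mul_comm]
    have := hK r ⟨hr.1.le, hr.2.trans hyb⟩
    gcongr
  have hswap := integral_integral_swap hFint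
  rw [intervalIntegral.integral_of_le hay, intervalIntegral.integral_of_le hay,
    ← integral_const_mul]
  have l1 : ∫ s in Set.Ioc a y, (y - s) ^ (-β₁) * ∫ r in a..s, (s - r) ^ (-β₂) * g r =
      ∫ s, ∫ r, k s r * g r ∂μ ∂μ := by
    refine setIntegral_congr_fun measurableSet_Ioc ?_
    intro s hs
    exact (hin s hs g).symm
  rw [l1, hswap]
  refine setIntegral_congr_fun measurableSet_Ioc ?_
  intro r hr
  simp only
  have e1 : (fun s => k s r * g r) = (Set.Ioi r).indicator
      (fun s => g r * ((y - s) ^ (-β₁) * (s - r) ^ (-β₂))) := by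
    ext s
    simp only [hk, Set.indicator_apply, Set.mem_Iio, Set.mem_Ioi]
    split_ifs <;> ring
  have e2 : Set.Ioi r ∩ Set.Ioc a y = Set.Ioc r y := by
    ext s; simp only [Set.mem_inter_iff, Set.mem_Ioi, Set.mem_Ioc]
    constructor
    · rintro ⟨h1, h2, h3⟩; exact ⟨h1, h3⟩
    · rintro ⟨h1, h2⟩; exact ⟨h1, by linarith [hr.1], h2⟩
  rw [e1, integral_indicator measurableSet_Ioi, hμ, Measure.restrict_restrict measurableSet_Ioi, e2,
    integral_const_mul, ← intervalIntegral.integral_of_le hr.2]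
  rcases eq_or_lt_of_le hr.2 with h | h
  · subst h
    rw [intervalIntegral.integral_same, sub_self, Real.zero_rpow (by linarith)]
    ring
  · rw [beta_inner _ _ _ _ h]; ring

/-- The constant relating the sequential derivative to a single fractional integral. -/
noncomputable def seqC (β₁ β₂ : ℝ) : ℝ :=
  (1 / Real.Gamma (1 - β₁)) * (1 / Real.Gamma (1 - β₂)) * betaC β₁ β₂

lemma seqC_pos (β₁ β₂ : ℝ) (h₁ : β₁ < 1) (h₂ : β₂ < 1) : 0 < seqC β₁ β₂ := by
  have := betaC_pos β₁ β₂ h₁ h₂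
  have := Real.Gamma_pos_of_pos (sub_pos.2 h₁)
  have := Real.Gamma_pos_of_pos (sub_pos.2 h₂)
  unfold seqC
  positivity

lemma seqCaputoAux_eq (β₁ β₂ a b : ℝ) (h₁ : β₁ < 1) (h₂ : β₂ < 1) (hs : 1 < β₁ + β₂)
    (f : ℝ → ℝ) (hg : ContinuousOn (deriv f) (Set.Icc a b)) (y : ℝ) (hy : y ∈ Set.Icc a b) :
    seqCaputoAux β₁ β₂ a f y =
      seqC β₁ β₂ * ∫ r in a..y, (y - r) ^ (-(β₁ + β₂ - 1)) * deriv f r := by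
  unfold seqCaputoAux caputo seqC
  have e : ∀ s, (y - s) ^ (-β₁) * ((1 / Real.Gamma (1 - β₂)) *
      ∫ r in a..s, (s - r) ^ (-β₂) * deriv f r) = (1 / Real.Gamma (1 - β₂)) *
      ((y - s) ^ (-β₁) * ∫ r in a..s, (s - r) ^ (-β₂) * deriv f r) := by
    intro s; ring
  simp only [e]
  rw [intervalIntegral.integral_const_mul, semigroup β₁ β₂ a b h₁ h₂ hs _ hg y hy]
  ring

/-- Maximum principle for the sequential Caputo derivative of a difference. -/
lemma seq_max (β₁ β₂ a b : ℝ) (hβ₁ : 0 < β₁ ∧ β₁ < 1) (hβ₂ : 0 < β₂ ∧ β₂ < 1)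
    (hsum : 1 < β₁ + β₂) (hab : a < b) :
    ∃ c > 0, ∀ f₁ f₂ : ℝ → ℝ,
      (∀ x ∈ Set.Icc a b, HasDerivAt f₁ (deriv f₁ x) x) →
      (∀ x ∈ Set.Icc a b, HasDerivAt f₂ (deriv f₂ x) x) →
      ContinuousOn (deriv f₁) (Set.Icc a b) → ContinuousOn (deriv f₂) (Set.Icc a b) →
      (∀ x ∈ Set.Ioo a b, HasDerivAt (seqCaputoAux β₁ β₂ a f₁) (seqCaputo β₁ β₂ a f₁ x) x) →
      (∀ x ∈ Set.Ioo a b, HasDerivAt (seqCaputoAux β₁ β₂ a f₂) (seqCaputo β₁ β₂ a f₂ x) x) →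
      ContinuousOn (seqCaputo β₁ β₂ a f₁) (Set.Icc a b) →
      ContinuousOn (seqCaputo β₁ β₂ a f₂) (Set.Icc a b) →
      f₁ a = 0 → f₁ b = 0 → f₂ a = 0 → f₂ b = 0 →
      ∀ x0 ∈ Set.Icc a b, f₂ x0 < f₁ x0 →
      ∃ x ∈ Set.Ioo a b, (∀ y ∈ Set.Icc a b, f₁ y - f₂ y ≤ f₁ x - f₂ x) ∧
        seqCaputo β₁ β₂ a f₁ x - seqCaputo β₁ β₂ a f₂ x ≤ - (c * (f₁ x - f₂ x)) := by
  have hC := seqC_pos β₁ β₂ hβ₁.2 hβ₂.2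
  have hba : 0 < (b - a) ^ (-((β₁ + β₂ - 1) + 1)) := Real.rpow_pos_of_pos (by linarith) _
  have hδ : 0 < β₁ + β₂ - 1 := by linarith
  refine ⟨seqC β₁ β₂ * ((β₁ + β₂ - 1) * (b - a) ^ (-((β₁ + β₂ - 1) + 1))), by positivity, ?_⟩
  intro f₁ f₂ hd1 hd2 hc1 hc2 hs1 hs2 hH1 hH2 h1a h1b h2a h2b x0 hx0 hlt
  have hJ : ∀ y ∈ Set.Icc a b,
      (seqC β₁ β₂)⁻¹ * (seqCaputoAux β₁ β₂ a f₁ y - seqCaputoAux β₁ β₂ a f₂ y) =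
      ∫ s in a..y, (y - s) ^ (-(β₁ + β₂ - 1)) * (deriv f₁ s - deriv f₂ s) := by
    intro y hy
    rw [seqCaputoAux_eq β₁ β₂ a b hβ₁.2 hβ₂.2 hsum f₁ hc1 y hy,
      seqCaputoAux_eq β₁ β₂ a b hβ₁.2 hβ₂.2 hsum f₂ hc2 y hy, ← mul_sub,
      inv_mul_cancel_left₀ hC.ne', ← intervalIntegral.integral_sub]
    · congr 1; ext s; ring
    · refine kernel_mul_int _ _ _ (by linarith [hβ₁.2, hβ₂.2]) _ _ (hc1.mono ?_)
      rw [uIcc_of_le hy.1]; exact Icc_subset_Icc le_rfl hy.2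
    · refine kernel_mul_int _ _ _ (by linarith [hβ₁.2, hβ₂.2]) _ _ (hc2.mono ?_)
      rw [uIcc_of_le hy.1]; exact Icc_subset_Icc le_rfl hy.2
  obtain ⟨x, hx, hm, hle⟩ := space_max a b (β₁ + β₂ - 1) ⟨hδ, by linarith [hβ₁.2, hβ₂.2]⟩ hab
    (fun y => f₁ y - f₂ y) (fun y => deriv f₁ y - deriv f₂ y)
    (fun y => (seqC β₁ β₂)⁻¹ * (seqCaputoAux β₁ β₂ a f₁ y - seqCaputoAux β₁ β₂ a f₂ y))
    (fun y => (seqC β₁ β₂)⁻¹ * (seqCaputo β₁ β₂ a f₁ y - seqCaputo β₁ β₂ a f₂ y))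
    (fun y hy => (hd1 y hy).sub (hd2 y hy)) (hc1.sub hc2) (by simp [h1a, h2a]) (by simp [h1b, h2b])
    hJ (fun y hy => ((hs1 y hy).sub (hs2 y hy)).const_mul _)
    (continuousOn_const.mul ((hH1.sub hH2).mono Ioo_subset_Icc_self)) x0 hx0 (by simpa using hlt)
  refine ⟨x, hx, hm, ?_⟩
  have hle' := mul_le_mul_of_nonneg_left hle hC.le
  rw [mul_inv_cancel_left₀ hC.ne'] at hle'
  linarith

/-- A solution of the problem. -/
structure IsSol (α β₁ β₂ ν a b T : ℝ) (F : ℝ → ℝ → ℝ → ℝ) (φ : ℝ → ℝ) (u : ℝ → ℝ → ℝ) : Prop where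
  cont : ContinuousOn (Function.uncurry u) (Set.Icc a b ×ˢ Set.Icc 0 T)
  dx : ∀ t ∈ Set.Icc (0:ℝ) T, ∀ x ∈ Set.Icc a b,
      HasDerivAt (fun y => u y t) (deriv (fun y => u y t) x) x
  dxc : ∀ t ∈ Set.Icc (0:ℝ) T, ContinuousOn (deriv (fun y => u y t)) (Set.Icc a b)
  dt : ∀ x ∈ Set.Icc a b, ∀ t ∈ Set.Ioc (0:ℝ) T, HasDerivAt (u x) (deriv (u x) t) t
  dtc : ∀ x ∈ Set.Icc a b, ContinuousOn (deriv (u x)) (Set.Ioc 0 T)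
  capc : ContinuousOn (fun p : ℝ × ℝ => caputo α 0 (u p.1) p.2)
      (Set.Icc a b ×ˢ Set.Icc 0 T)
  seqd : ∀ t ∈ Set.Icc (0:ℝ) T, ∀ x ∈ Set.Ioo a b,
      HasDerivAt (seqCaputoAux β₁ β₂ a (fun y => u y t))
        (seqCaputo β₁ β₂ a (fun y => u y t) x) x
  seqc : ContinuousOn (fun p : ℝ × ℝ => seqCaputo β₁ β₂ a (fun y => u y p.2) p.1)
      (Set.Icc a b ×ˢ Set.Icc 0 T)
  eqn : ∀ x ∈ Set.Ioo a b, ∀ t ∈ Set.Ioc (0:ℝ) T,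
      caputo α 0 (u x) t = ν * seqCaputo β₁ β₂ a (fun y => u y t) x + F x t (u x t)
  init : ∀ x ∈ Set.Icc a b, u x 0 = φ x
  bd : ∀ t ∈ Set.Icc (0:ℝ) T, u a t = 0 ∧ u b t = 0

section
variable {α β₁ β₂ ν a b T : ℝ} {F : ℝ → ℝ → ℝ → ℝ} {φ : ℝ → ℝ} {u v : ℝ → ℝ → ℝ}

lemma IsSol.cont_t (hu : IsSol α β₁ β₂ ν a b T F φ u) {x : ℝ} (hx : x ∈ Set.Icc a b) :
    ContinuousOn (u x) (Set.Icc 0 T) :=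
  hu.cont.comp (f := fun t => (x, t)) (by fun_prop) (fun t ht => ⟨hx, ht⟩)

lemma IsSol.seqc_x (hu : IsSol α β₁ β₂ ν a b T F φ u) {t : ℝ} (ht : t ∈ Set.Icc 0 T) :
    ContinuousOn (seqCaputo β₁ β₂ a (fun y => u y t)) (Set.Icc a b) :=
  hu.seqc.comp (f := fun x => (x, t)) (by fun_prop) (fun x hx => ⟨hx, ht⟩)

/-- The equation extends to `t = 0`. -/
lemma IsSol.eqn_closed (hu : IsSol α β₁ β₂ ν a b T F φ u) (hT : 0 < T)
    (hF : ContinuousOn (fun p : ℝ × ℝ × ℝ => F p.1 p.2.1 p.2.2)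
      (Set.Icc a b ×ˢ Set.Icc 0 T ×ˢ (Set.univ : Set ℝ)))
    {x : ℝ} (hx : x ∈ Set.Ioo a b) {t : ℝ} (ht : t ∈ Set.Icc 0 T) :
    caputo α 0 (u x) t = ν * seqCaputo β₁ β₂ a (fun y => u y t) x + F x t (u x t) := by
  have hx' : x ∈ Set.Icc a b := ⟨hx.1.le, hx.2.le⟩
  have hL : ContinuousOn (fun t => caputo α 0 (u x) t) (Set.Icc 0 T) :=
    hu.capc.comp (f := fun t => (x, t)) (by fun_prop) (fun t ht => ⟨hx', ht⟩)
  have hS : ContinuousOn (fun t => seqCaputo β₁ β₂ a (fun y => u y t) x) (Set.Icc 0 T) :=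
    hu.seqc.comp (f := fun t => (x, t)) (by fun_prop) (fun t ht => ⟨hx', ht⟩)
  have hR : ContinuousOn (fun t => F x t (u x t)) (Set.Icc 0 T) :=
    hF.comp (f := fun t => (x, t, u x t))
      (continuousOn_const.prodMk (continuousOn_id.prodMk (hu.cont_t hx')))
      (fun t ht => ⟨hx', ht, trivial⟩)
  have h := Set.EqOn.of_subset_closure (s := Set.Ioc 0 T) (t := Set.Icc 0 T)
    (f := fun t => caputo α 0 (u x) t)
    (g := fun t => ν * seqCaputo β₁ β₂ a (fun y => u y t) x + F x t (u x t))
    (fun t ht => hu.eqn x hx t ht) hL ((continuousOn_const.mul hS).add hR)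
    Ioc_subset_Icc_self (by rw [closure_Ioc hT.ne])
  exact h ht

lemma caputo_zero (α : ℝ) (f : ℝ → ℝ) : caputo α 0 f 0 = 0 := by
  simp [caputo]

lemma caputo_bad (f : ℝ → ℝ) (hc : ContinuousOn (deriv f) (Set.Ioc 0 T))
    (hbad : ¬ IntervalIntegrable (deriv f) volume 0 T) {t : ℝ} (ht : t ∈ Set.Icc 0 T) :
    caputo α 0 f t = 0 := by
  rcases eq_or_lt_of_le ht.1 with h | h
  · rw [← h, caputo_zero]
  · unfold caputo
    rw [intervalIntegral.integral_undef, mul_zero]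
    exact fun hi => hbad (good_of_int α T t _ ⟨h, ht.2⟩ hc hi)

lemma IsSol.lipschitz (hu : IsSol α β₁ β₂ ν a b T F φ u)
    (hα : 0 < α ∧ α < 1) (hβ₁ : 0 < β₁ ∧ β₁ < 1) (hβ₂ : 0 < β₂ ∧ β₂ < 1)
    (hsum : 1 < β₁ + β₂) (hν : 0 < ν) (hab : a < b) (hT : 0 < T)
    (hF : ContDiffOn ℝ 1 (fun p : ℝ × ℝ × ℝ => F p.1 p.2.1 p.2.2)
      (Set.Icc a b ×ˢ Set.Icc 0 T ×ˢ (Set.univ : Set ℝ)))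
    (hFanti : ∀ x ∈ Set.Icc a b, ∀ t ∈ Set.Icc (0:ℝ) T, Antitone (F x t)) :
    ∃ C, 0 ≤ C ∧ ∀ h > 0, ∀ x ∈ Set.Icc a b, ∀ τ ∈ Set.Icc 0 T,
      u x τ - u x (max (τ - h) 0) ≤ C * h := by
  obtain ⟨c, hc, hmax⟩ := seq_max β₁ β₂ a b hβ₁ hβ₂ hsum hab
  obtain ⟨K, hK⟩ := (isCompact_Icc.prod isCompact_Icc).exists_bound_of_continuousOn hu.cont
  have hF' : ContDiffOn ℝ 1 (fun p : ℝ × ℝ × ℝ => F p.1 p.2.1 p.2.2)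
      (Set.Icc a b ×ˢ Set.Icc 0 T ×ˢ Set.Icc (-K) K) :=
    hF.mono (Set.prod_mono_right (Set.prod_mono_right (Set.subset_univ _)))
  obtain ⟨L, hL⟩ := ContDiffOn.exists_lipschitzOnWith hF' one_ne_zero
    ((convex_Icc _ _).prod ((convex_Icc _ _).prod (convex_Icc _ _)))
    (isCompact_Icc.prod (isCompact_Icc.prod isCompact_Icc))
  refine ⟨L / (ν * c), by positivity, ?_⟩
  intro h hh
  have hσ : ∀ τ ∈ Set.Icc 0 T, max (τ - h) 0 ∈ Set.Icc 0 T :=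
    fun τ hτ => ⟨le_max_right _ _, max_le (by linarith [hτ.2]) hT.le⟩
  have hWc : ContinuousOn (fun p : ℝ × ℝ => u p.1 p.2 - u p.1 (max (p.2 - h) 0))
      (Set.Icc a b ×ˢ Set.Icc 0 T) := by
    refine ContinuousOn.sub hu.cont ?_
    exact hu.cont.comp (f := fun p : ℝ × ℝ => (p.1, max (p.2 - h) 0)) (by fun_prop)
      (fun p hp => ⟨hp.1, hσ p.2 hp.2⟩)
  obtain ⟨⟨x1, τ⟩, ⟨hx1, hτ⟩, hm⟩ := (isCompact_Icc.prod isCompact_Icc).exists_isMaxOn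
    ⟨(a, 0), ⟨le_rfl, hab.le⟩, ⟨le_rfl, hT.le⟩⟩ hWc
  have hm' : ∀ x ∈ Set.Icc a b, ∀ t ∈ Set.Icc 0 T,
      u x t - u x (max (t - h) 0) ≤ u x1 τ - u x1 (max (τ - h) 0) :=
    fun x hx t ht => hm (show (x, t) ∈ _ from ⟨hx, ht⟩)
  change x1 ∈ Set.Icc a b at hx1
  change τ ∈ Set.Icc 0 T at hτ
  by_contra hcon
  push Not at hcon
  obtain ⟨xb, hxb, tb, htb, hb⟩ := hcon
  have hM : L / (ν * c) * h < u x1 τ - u x1 (max (τ - h) 0) := hb.trans_le (hm' xb hxb tb htb)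
  have hpos : 0 < u x1 τ - u x1 (max (τ - h) 0) := lt_of_le_of_lt (by positivity) hM
  set σ := max (τ - h) 0 with hσdef
  have hσI := hσ τ hτ
  rw [← hσdef] at hσI
  obtain ⟨x, hx, hxm, hxle⟩ := hmax (fun y => u y τ) (fun y => u y σ) (hu.dx τ hτ) (hu.dx σ hσI)
    (hu.dxc τ hτ) (hu.dxc σ hσI) (hu.seqd τ hτ) (hu.seqd σ hσI) (hu.seqc_x hτ) (hu.seqc_x hσI)
    (hu.bd τ hτ).1 (hu.bd τ hτ).2 (hu.bd σ hσI).1 (hu.bd σ hσI).2 x1 hx1 (by linarith)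
  have hx' : x ∈ Set.Icc a b := ⟨hx.1.le, hx.2.le⟩
  have hge := hxm x1 hx1
  have hmx : ∀ t ∈ Set.Icc 0 T, u x t - u x (max (t - h) 0) ≤ u x τ - u x σ :=
    fun t ht => (hm' x hx' t ht).trans hge
  have hτ0 : 0 < τ := by
    rcases eq_or_lt_of_le hτ.1 with h0 | h0
    · exfalso
      have : σ = 0 := by rw [hσdef, ← h0]; exact max_eq_right (by linarith)
      rw [this, ← h0] at hpos
      linarith
    · exact h0
  -- time inequality
  have htime : caputo α 0 (u x) σ ≤ caputo α 0 (u x) τ := by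
    by_cases hgood : IntervalIntegrable (deriv (u x)) volume 0 T
    · have hGam : 0 ≤ 1 / Real.Gamma (1 - α) :=
        one_div_nonneg.2 (Real.Gamma_pos_of_pos (by linarith [hα.2])).le
      have hiτ := good_int α T τ hα.2 _ ⟨hτ0, hτ.2⟩ (hu.dtc x hx') hgood
      rcases le_or_gt τ h with hle | hlt
      · have hσ0 : σ = 0 := max_eq_right (by linarith)
        rw [hσ0, caputo_zero]
        refine mul_nonneg hGam (time_max α τ hα hτ0 (u x) _
          ((hu.cont_t hx').mono (Icc_subset_Icc le_rfl hτ.2))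
          (fun s hs => hu.dt x hx' s ⟨hs.1, hs.2.trans hτ.2⟩) hiτ ?_)
        intro s hs
        have := hmx s ⟨hs.1, hs.2.trans hτ.2⟩
        rw [hσ0, max_eq_right (by linarith [hs.2])] at this
        linarith
      · have hσ1 : σ = τ - h := max_eq_left (by linarith)
        have hτσ : τ = σ + h := by linarith
        have hσpos : 0 < σ := by linarith
        have hiσ := good_int α T σ hα.2 _ ⟨hσpos, hσI.2⟩ (hu.dtc x hx') hgood
        refine mul_le_mul_of_nonneg_left ?_ hGam
        rw [hτσ] at hiτ hmx ⊢
        have hle : σ + h ≤ T := by rw [← hτσ]; exact hτ.2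
        refine time_shift α σ h hα hσpos hh (u x) _
          ((hu.cont_t hx').mono (Icc_subset_Icc le_rfl hle))
          (fun s hs => hu.dt x hx' s ⟨hs.1, hs.2.trans hle⟩) hiτ hiσ ?_ ?_
        · intro s hs
          have := hmx (s + h) ⟨by linarith [hs.1], by linarith [hs.2]⟩
          rwa [add_sub_cancel_right, max_eq_left hs.1] at this
        · intro s hs
          have := hmx s ⟨hs.1, by linarith [hs.2]⟩
          rwa [max_eq_right (by linarith [hs.2])] at this
    · rw [caputo_bad _ (hu.dtc x hx') hgood hσI, caputo_bad _ (hu.dtc x hx') hgood hτ]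
  rw [hu.eqn_closed hT hF.continuousOn hx hσI, hu.eqn_closed hT hF.continuousOn hx hτ] at htime
  have hanti : F x σ (u x τ) ≤ F x σ (u x σ) := hFanti x hx' σ hσI (by linarith)
  have hστ : |τ - σ| ≤ h := by
    rw [abs_le]
    constructor
    · linarith [max_le (show τ - h ≤ τ by linarith) hτ.1]
    · linarith [le_max_left (τ - h) 0]
  have hlip : F x τ (u x τ) - F x σ (u x τ) ≤ L * h := by
    have huK := hK (x, τ) ⟨hx', hτ⟩
    rw [Real.norm_eq_abs, abs_le] at huK
    have := hL.dist_le_mul (x, τ, u x τ) ⟨hx', hτ, huK⟩ (x, σ, u x τ) ⟨hx', hσI, huK⟩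
    simp only [Prod.dist_eq, dist_self, Real.dist_eq] at this
    have e : max 0 (max |τ - σ| 0) = |τ - σ| := by simp
    rw [e] at this
    refine (le_abs_self _).trans (this.trans ?_)
    gcongr
  have h1 := mul_le_mul_of_nonneg_left hxle hν.le
  have h2 : ν * c * (u x τ - u x σ) ≤ L * h := by linarith
  have h3 : ν * c * (L / (ν * c) * h) = L * h := by field_simp
  have h4 : ν * c * (L / (ν * c) * h) < ν * c * (u x τ - u x σ) :=
    mul_lt_mul_of_pos_left (by linarith) (by positivity)
  linarith

lemma IsSol.good (hu : IsSol α β₁ β₂ ν a b T F φ u)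
    (hα : 0 < α ∧ α < 1) (hβ₁ : 0 < β₁ ∧ β₁ < 1) (hβ₂ : 0 < β₂ ∧ β₂ < 1)
    (hsum : 1 < β₁ + β₂) (hν : 0 < ν) (hab : a < b) (hT : 0 < T)
    (hF : ContDiffOn ℝ 1 (fun p : ℝ × ℝ × ℝ => F p.1 p.2.1 p.2.2)
      (Set.Icc a b ×ˢ Set.Icc 0 T ×ˢ (Set.univ : Set ℝ)))
    (hFanti : ∀ x ∈ Set.Icc a b, ∀ t ∈ Set.Icc (0:ℝ) T, Antitone (F x t))
    {x : ℝ} (hx : x ∈ Set.Icc a b) : IntervalIntegrable (deriv (u x)) volume 0 T := by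
  obtain ⟨C, hC, hlip⟩ := hu.lipschitz hα hβ₁ hβ₂ hsum hν hab hT hF hFanti
  have hmono : MonotoneOn (fun s => C * s - u x s) (Set.Icc 0 T) := by
    intro s hs t ht hst
    rcases eq_or_lt_of_le hst with h | h
    · rw [h]
    · have := hlip (t - s) (by linarith) x hx t ht
      rw [sub_sub_cancel, max_eq_left hs.1] at this
      simp only
      linarith
  have hd : ∀ s ∈ Set.Ioo 0 T, HasDerivAt (fun s => C * s - u x s) (C - deriv (u x) s) s := by
    intro s hs
    have := ((hasDerivAt_id' s).const_mul C).sub (hu.dt x hx s ⟨hs.1, hs.2.le⟩)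
    rwa [mul_one] at this
  have hi : IntegrableOn (fun s => C - deriv (u x) s) (Set.Ioc 0 T) := by
    refine intervalIntegral.integrableOn_deriv_of_nonneg (g := fun s => C * s - u x s)
      ((by fun_prop : ContinuousOn (fun s : ℝ => C * s) (Set.Icc 0 T)).sub (hu.cont_t hx)) hd ?_
    intro s hs
    have h1 := (hd s hs).hasDerivWithinAt.derivWithin
      (uniqueDiffOn_Icc hT s ⟨hs.1.le, hs.2.le⟩)
    rw [← h1]
    exact hmono.derivWithin_nonneg
  have hi' : IntervalIntegrable (fun s => C - deriv (u x) s) volume 0 T := by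
    rwa [intervalIntegrable_iff_integrableOn_Ioc_of_le hT.le]
  have h2 := (intervalIntegrable_const (c := C)).sub hi'
  simpa using h2

lemma IsSol.le (hu : IsSol α β₁ β₂ ν a b T F φ u) (hv : IsSol α β₁ β₂ ν a b T F φ v)
    (hα : 0 < α ∧ α < 1) (hβ₁ : 0 < β₁ ∧ β₁ < 1) (hβ₂ : 0 < β₂ ∧ β₂ < 1)
    (hsum : 1 < β₁ + β₂) (hν : 0 < ν) (hab : a < b) (hT : 0 < T)
    (hF : ContDiffOn ℝ 1 (fun p : ℝ × ℝ × ℝ => F p.1 p.2.1 p.2.2)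
      (Set.Icc a b ×ˢ Set.Icc 0 T ×ˢ (Set.univ : Set ℝ)))
    (hFanti : ∀ x ∈ Set.Icc a b, ∀ t ∈ Set.Icc (0:ℝ) T, Antitone (F x t)) :
    ∀ x ∈ Set.Icc a b, ∀ t ∈ Set.Icc (0:ℝ) T, u x t ≤ v x t := by
  obtain ⟨c, hc, hmax⟩ := seq_max β₁ β₂ a b hβ₁ hβ₂ hsum hab
  obtain ⟨⟨x1, τ⟩, ⟨hx1, hτ⟩, hm⟩ := (isCompact_Icc.prod isCompact_Icc).exists_isMaxOn
    ⟨(a, 0), ⟨le_rfl, hab.le⟩, ⟨le_rfl, hT.le⟩⟩ (hu.cont.sub hv.cont)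
  have hm' : ∀ x ∈ Set.Icc a b, ∀ t ∈ Set.Icc 0 T, u x t - v x t ≤ u x1 τ - v x1 τ :=
    fun x hx t ht => hm (show (x, t) ∈ _ from ⟨hx, ht⟩)
  change x1 ∈ Set.Icc a b at hx1
  change τ ∈ Set.Icc 0 T at hτ
  by_contra hcon
  push Not at hcon
  obtain ⟨xb, hxb, tb, htb, hb⟩ := hcon
  have hpos : 0 < u x1 τ - v x1 τ := by linarith [hm' xb hxb tb htb]
  obtain ⟨x, hx, hxm, hxle⟩ := hmax (fun y => u y τ) (fun y => v y τ) (hu.dx τ hτ) (hv.dx τ hτ)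
    (hu.dxc τ hτ) (hv.dxc τ hτ) (hu.seqd τ hτ) (hv.seqd τ hτ) (hu.seqc_x hτ) (hv.seqc_x hτ)
    (hu.bd τ hτ).1 (hu.bd τ hτ).2 (hv.bd τ hτ).1 (hv.bd τ hτ).2 x1 hx1 (by linarith)
  have hx' : x ∈ Set.Icc a b := ⟨hx.1.le, hx.2.le⟩
  have hge := hxm x1 hx1
  have hτ0 : 0 < τ := by
    rcases eq_or_lt_of_le hτ.1 with h0 | h0
    · exfalso
      rw [← h0, hu.init x1 hx1, hv.init x1 hx1] at hpos
      linarith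
    · exact h0
  have hiu := good_int α T τ hα.2 _ ⟨hτ0, hτ.2⟩ (hu.dtc x hx')
    (hu.good hα hβ₁ hβ₂ hsum hν hab hT hF hFanti hx')
  have hiv := good_int α T τ hα.2 _ ⟨hτ0, hτ.2⟩ (hv.dtc x hx')
    (hv.good hα hβ₁ hβ₂ hsum hν hab hT hF hFanti hx')
  have htime : caputo α 0 (v x) τ ≤ caputo α 0 (u x) τ := by
    have hGam : 0 ≤ 1 / Real.Gamma (1 - α) :=
      one_div_nonneg.2 (Real.Gamma_pos_of_pos (by linarith [hα.2])).le
    refine mul_le_mul_of_nonneg_left ?_ hGam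
    rw [← sub_nonneg, ← intervalIntegral.integral_sub hiu hiv]
    have h := time_max α τ hα hτ0 (fun s => u x s - v x s) (fun s => deriv (u x) s - deriv (v x) s)
      (((hu.cont_t hx').sub (hv.cont_t hx')).mono (Icc_subset_Icc le_rfl hτ.2))
      (fun s hs => (hu.dt x hx' s ⟨hs.1, hs.2.trans hτ.2⟩).sub
        (hv.dt x hx' s ⟨hs.1, hs.2.trans hτ.2⟩)) ?_
      (fun s hs => (hm' x hx' s ⟨hs.1, hs.2.trans hτ.2⟩).trans hge)
    · simpa only [mul_sub] using h
    · simpa only [mul_sub] using hiu.sub hiv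
  rw [hu.eqn x hx τ ⟨hτ0, hτ.2⟩, hv.eqn x hx τ ⟨hτ0, hτ.2⟩] at htime
  have hanti : F x τ (u x τ) ≤ F x τ (v x τ) := hFanti x hx' τ hτ (by linarith)
  have h1 := mul_le_mul_of_nonneg_left hxle hν.le
  have h2 : 0 < ν * (c * (u x τ - v x τ)) :=
    mul_pos hν (mul_pos hc (by linarith))
  linarith

end

end FracDiff

/-- uniqueness for the nonlinear time-space fractional diffusion
equation `𝒟^α_{0+,t} u = ν 𝒟^{β₁}𝒟^{β₂} u + F(x,t,u)` with Dirichlet boundary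
conditions, for `F` continuously differentiable and nonincreasing in `u`. -/
theorem nonlinear_time_space_diffusion_unique
    (α β₁ β₂ ν a b T : ℝ)
    (hα : 0 < α ∧ α < 1) (hβ₁ : 0 < β₁ ∧ β₁ < 1) (hβ₂ : 0 < β₂ ∧ β₂ < 1)
    (hsum : 1 < β₁ + β₂) (hν : 0 < ν) (hab : a < b) (hT : 0 < T)
    (F : ℝ → ℝ → ℝ → ℝ) (φ : ℝ → ℝ)
    (hφ : ContinuousOn φ (Set.Icc a b))
    -- `F` is continuously differentiable on `[a,b] × [0,T] × ℝ`
    (hF : ContDiffOn ℝ 1 (fun p : ℝ × ℝ × ℝ => F p.1 p.2.1 p.2.2)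
      (Set.Icc a b ×ˢ Set.Icc 0 T ×ˢ (Set.univ : Set ℝ)))
    -- `F` is nonincreasing in its third argument
    (hFanti : ∀ x ∈ Set.Icc a b, ∀ t ∈ Set.Icc (0:ℝ) T, Antitone (F x t))
    (u v : ℝ → ℝ → ℝ)
    -- regularity of `u`
    (hu : ContinuousOn (Function.uncurry u) (Set.Icc a b ×ˢ Set.Icc 0 T))
    (hux : ∀ t ∈ Set.Icc (0:ℝ) T, ∀ x ∈ Set.Icc a b,
      HasDerivAt (fun y => u y t) (deriv (fun y => u y t) x) x)
    (hux' : ∀ t ∈ Set.Icc (0:ℝ) T, ContinuousOn (deriv (fun y => u y t)) (Set.Icc a b))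
    (hut : ∀ x ∈ Set.Icc a b, ∀ t ∈ Set.Ioc (0:ℝ) T, HasDerivAt (u x) (deriv (u x) t) t)
    (hut' : ∀ x ∈ Set.Icc a b, ContinuousOn (deriv (u x)) (Set.Ioc 0 T))
    (hDtu : ContinuousOn (fun p : ℝ × ℝ => caputo α 0 (u p.1) p.2)
      (Set.Icc a b ×ˢ Set.Icc 0 T))
    (hDxexu : ∀ t ∈ Set.Icc (0:ℝ) T, ∀ x ∈ Set.Ioo a b,
      HasDerivAt (seqCaputoAux β₁ β₂ a (fun y => u y t))
        (seqCaputo β₁ β₂ a (fun y => u y t) x) x)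
    (hDxu : ContinuousOn (fun p : ℝ × ℝ => seqCaputo β₁ β₂ a (fun y => u y p.2) p.1)
      (Set.Icc a b ×ˢ Set.Icc 0 T))
    -- regularity of `v`
    (hv : ContinuousOn (Function.uncurry v) (Set.Icc a b ×ˢ Set.Icc 0 T))
    (hvx : ∀ t ∈ Set.Icc (0:ℝ) T, ∀ x ∈ Set.Icc a b,
      HasDerivAt (fun y => v y t) (deriv (fun y => v y t) x) x)
    (hvx' : ∀ t ∈ Set.Icc (0:ℝ) T, ContinuousOn (deriv (fun y => v y t)) (Set.Icc a b))
    (hvt : ∀ x ∈ Set.Icc a b, ∀ t ∈ Set.Ioc (0:ℝ) T, HasDerivAt (v x) (deriv (v x) t) t)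
    (hvt' : ∀ x ∈ Set.Icc a b, ContinuousOn (deriv (v x)) (Set.Ioc 0 T))
    (hDtv : ContinuousOn (fun p : ℝ × ℝ => caputo α 0 (v p.1) p.2)
      (Set.Icc a b ×ˢ Set.Icc 0 T))
    (hDxexv : ∀ t ∈ Set.Icc (0:ℝ) T, ∀ x ∈ Set.Ioo a b,
      HasDerivAt (seqCaputoAux β₁ β₂ a (fun y => v y t))
        (seqCaputo β₁ β₂ a (fun y => v y t) x) x)
    (hDxv : ContinuousOn (fun p : ℝ × ℝ => seqCaputo β₁ β₂ a (fun y => v y p.2) p.1)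
      (Set.Icc a b ×ˢ Set.Icc 0 T))
    -- both satisfy the nonlinear equation, initial and Dirichlet conditions
    (hequ : ∀ x ∈ Set.Ioo a b, ∀ t ∈ Set.Ioc (0:ℝ) T,
      caputo α 0 (u x) t = ν * seqCaputo β₁ β₂ a (fun y => u y t) x + F x t (u x t))
    (heqv : ∀ x ∈ Set.Ioo a b, ∀ t ∈ Set.Ioc (0:ℝ) T,
      caputo α 0 (v x) t = ν * seqCaputo β₁ β₂ a (fun y => v y t) x + F x t (v x t))
    (hinitu : ∀ x ∈ Set.Icc a b, u x 0 = φ x)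
    (hinitv : ∀ x ∈ Set.Icc a b, v x 0 = φ x)
    (hbdu : ∀ t ∈ Set.Icc (0:ℝ) T, u a t = 0 ∧ u b t = 0)
    (hbdv : ∀ t ∈ Set.Icc (0:ℝ) T, v a t = 0 ∧ v b t = 0) :
    ∀ x ∈ Set.Icc a b, ∀ t ∈ Set.Icc (0:ℝ) T, u x t = v x t := by
  have hu' : FracDiff.IsSol α β₁ β₂ ν a b T F φ u :=
    ⟨hu, hux, hux', hut, hut', hDtu, hDxexu, hDxu, hequ, hinitu, hbdu⟩
  have hv' : FracDiff.IsSol α β₁ β₂ ν a b T F φ v :=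
    ⟨hv, hvx, hvx', hvt, hvt', hDtv, hDxexv, hDxv, heqv, hinitv, hbdv⟩
  intro x hx t ht
  exact le_antisymm (hu'.le hv' hα hβ₁ hβ₂ hsum hν hab hT hF hFanti x hx t ht)
    (hv'.le hu' hα hβ₁ hβ₂ hsum hν hab hT hF hFanti x hx t ht)
end

section
/- Let 0 < α < 1, 0 < β₁, β₂ < 1 with 1 < β₁ + β₂, ν > 0, −∞ < a < b < +∞, T > 0, and set Ω = (a,b) × (0,T]. Let u : [a,b] × [0,T] → ℝ be continuous, with t ↦ u(x,t) continuously differentiable on (0,T] for each x, x ↦ u(x,t) continuously differentiable on [a,b] for each t, such that the spatial sequential Caputo derivative w(x,t) = 𝒟^{β₁}_{a+,x}𝒟^{β₂}_{a+,x} u(x,t) is continuous on [a,b] × [0,T], its Riemann–Liouville time derivative D^{1−α}_{0+,t} w exists and is continuous on [a,b] × (0,T], and u satisfies the pseudo-parabolic equation ∂u/∂t(x,t) = ν · D^{1−α}_{0+,t}[𝒟^{β₁}_{a+,x}𝒟^{β₂}_{a+,x} u](x,t) + F(x,t) on Ω, with u(x,0) = φ(x) for x ∈ [a,b] and u(a,t)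 = ψ₁(t), u(b,t) = ψ₂(t) for t ∈ [0,T], where F, φ, ψ₁, ψ₂ are continuous. If F(x,t) ≥ 0 on [a,b] × [0,T], φ(x) ≥ 0 on [a,b], and ψ₁(t) ≥ 0, ψ₂(t) ≥ 0 on [0,T], then u(x,t) ≥ 0 for all (x,t) ∈ [a,b] × [0,T]. -/
open Set

/-- The fractional integral appearing in the Riemann–Liouville derivative with
base point `0`: `t ↦ (1/Γ(1−γ)) ∫_0^t (t−s)^{−γ} g(s) ds`. -/
noncomputable def rlAux (γ : ℝ) (g : ℝ → ℝ) (t : ℝ) : ℝ :=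
  (1 / Real.Gamma (1 - γ)) * ∫ s in (0:ℝ)..t, (t - s) ^ (-γ) * g s

/-- The Riemann–Liouville fractional derivative of order `γ` with base point `0`:
`(D^γ_{0+} g)(t) = (d/dt)[(1/Γ(1−γ)) ∫_0^t (t−s)^{−γ} g(s) ds]`. -/
noncomputable def rlDeriv (γ : ℝ) (g : ℝ → ℝ) : ℝ → ℝ :=
  deriv (rlAux γ g)

open MeasureTheory

lemma kerInt (p : ℝ) (hp : p < 1) (t x y : ℝ) :
    IntervalIntegrable (fun r : ℝ => (t - r) ^ (-p)) volume x y := by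
  have h := (intervalIntegral.intervalIntegrable_rpow' (r := -p) (a := t - x) (b := t - y) (by linarith)).comp_sub_left t
  simpa using h

lemma kerInt2 (p : ℝ) (hp : p < 1) (t x y : ℝ) :
    IntervalIntegrable (fun r : ℝ => (r - t) ^ (-p)) volume x y := by
  have h := (intervalIntegral.intervalIntegrable_rpow' (r := -p) (a := x - t) (b := y - t) (by linarith)).comp_sub_right t
  simpa using h

lemma betaInt (p q : ℝ) (hp0 : 0 ≤ p) (hp : p < 1) (hq0 : 0 ≤ q) (hq : q < 1) (s t : ℝ) (hst : s < t) :
    IntervalIntegrable (fun r : ℝ => (t - r) ^ (-p) * (r - s) ^ (-q)) volume s t := by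
  set m := (t - s) / 2 with hm
  have hmpos : 0 < m := by rw [hm]; linarith
  have hB : IntervalIntegrable (fun r : ℝ => m ^ (-p) * (r - s) ^ (-q) + m ^ (-q) * (t - r) ^ (-p)) volume s t :=
    ((kerInt2 q hq s s t).const_mul _).add ((kerInt p hp t s t).const_mul _)
  refine hB.mono_fun (by apply Measurable.aestronglyMeasurable; fun_prop) ?_
  rw [uIoc_of_le hst.le]
  refine (ae_restrict_iff' measurableSet_Ioc).2 (Filter.Eventually.of_forall fun r hr => ?_)
  have h1 : 0 ≤ (t - r) ^ (-p) := Real.rpow_nonneg (by linarith [hr.2]) _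
  have h2 : 0 ≤ (r - s) ^ (-q) := Real.rpow_nonneg (by linarith [hr.1]) _
  have h3 : 0 ≤ m ^ (-p) := Real.rpow_nonneg hmpos.le _
  have h4 : 0 ≤ m ^ (-q) := Real.rpow_nonneg hmpos.le _
  show ‖(t - r) ^ (-p) * (r - s) ^ (-q)‖ ≤ ‖m ^ (-p) * (r - s) ^ (-q) + m ^ (-q) * (t - r) ^ (-p)‖
  rw [Real.norm_of_nonneg (by positivity), Real.norm_of_nonneg (by positivity)]
  rcases le_total (r - s) m with h | h
  · have : (t - r) ^ (-p) ≤ m ^ (-p) :=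
      Real.rpow_le_rpow_of_nonpos hmpos (by linarith) (by linarith)
    nlinarith [mul_le_mul_of_nonneg_right this h2, mul_nonneg h4 h1]
  · have : (r - s) ^ (-q) ≤ m ^ (-q) :=
      Real.rpow_le_rpow_of_nonpos hmpos (by linarith) (by linarith)
    nlinarith [mul_le_mul_of_nonneg_left this h1, mul_nonneg h3 h2]

noncomputable def betaC (p q : ℝ) : ℝ := ∫ x in (0:ℝ)..1, (1 - x) ^ (-p) * (x - 0) ^ (-q)

lemma betaC_pos (p q : ℝ) (hp0 : 0 ≤ p) (hp : p < 1) (hq0 : 0 ≤ q) (hq : q < 1) : 0 < betaC p q := by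
  apply intervalIntegral.intervalIntegral_pos_of_pos_on (betaInt p q hp0 hp hq0 hq 0 1 one_pos) _ one_pos
  intro x hx
  exact mul_pos (Real.rpow_pos_of_pos (by linarith [hx.2]) _) (Real.rpow_pos_of_pos (by linarith [hx.1]) _)

lemma betaVal (p q s t : ℝ) (hst : s < t) :
    ∫ r in s..t, (t - r) ^ (-p) * (r - s) ^ (-q) = betaC p q * (t - s) ^ (1 - p - q) := by
  have h := intervalIntegral.mul_integral_comp_add_mul (a := 0) (b := 1) (f := fun r : ℝ => (t - r) ^ (-p) * (r - s) ^ (-q)) (t - s) s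
  have hts : 0 < t - s := by linarith
  rw [show s + (t - s) * 0 = s by ring, show s + (t - s) * 1 = t by ring] at h
  rw [← h, betaC]
  have : ∫ x in (0:ℝ)..1, (t - (s + (t - s) * x)) ^ (-p) * (s + (t - s) * x - s) ^ (-q)
      = ∫ x in (0:ℝ)..1, (t - s) ^ (-p - q) * ((1 - x) ^ (-p) * (x - 0) ^ (-q)) := by
    apply intervalIntegral.integral_congr
    intro x hx
    rw [uIcc_of_le zero_le_one] at hx
    simp only
    rw [show t - (s + (t - s) * x) = (t - s) * (1 - x) by ring, show s + (t - s) * x - s = (t - s) * (x - 0) by ring,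
      Real.mul_rpow hts.le (by linarith [hx.2]), Real.mul_rpow hts.le (by linarith [hx.1]),
      sub_eq_add_neg (-p) q, Real.rpow_add hts]
    ring
  rw [this, intervalIntegral.integral_const_mul, show 1 - p - q = 1 + (-p - q) by ring, Real.rpow_add hts, Real.rpow_one]
  ring

lemma integral_Ioo_of_le {f : ℝ → ℝ} {a b : ℝ} (h : a ≤ b) : ∫ x in a..b, f x = ∫ x in Ioo a b, f x := by
  rw [intervalIntegral.integral_of_le h, integral_Ioc_eq_integral_Ioo]

lemma semigroup_aux (p q : ℝ) (hp0 : 0 ≤ p) (hp : p < 1) (hq0 : 0 ≤ q) (hq : q < 1) (a t : ℝ) (hat : a ≤ t)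
    (f : ℝ → ℝ) (hf : Continuous f) :
    IntervalIntegrable (fun r => (t - r) ^ (-p) * ∫ s in a..r, (r - s) ^ (-q) * f s) volume a t ∧
    ∫ r in a..t, (t - r) ^ (-p) * (∫ s in a..r, (r - s) ^ (-q) * f s)
      = betaC p q * ∫ s in a..t, (t - s) ^ (1 - p - q) * f s := by
  set μ := volume.restrict (Ioo a t) with hμ
  let K : ℝ → ℝ → ℝ := fun r s => if s < r then (t - r) ^ (-p) * (r - s) ^ (-q) * f s else 0
  have hK1 : ∀ s, (fun r => K r s) = (Ioi s).indicator (fun r => (t - r) ^ (-p) * (r - s) ^ (-q) * f s) := by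
    intro s; ext r; simp [K, indicator]
  have hK2 : ∀ r, (fun s => K r s) = (Iio r).indicator (fun s => (t - r) ^ (-p) * (r - s) ^ (-q) * f s) := by
    intro r; ext s; simp [K, indicator]
  have hK1n : ∀ s, (fun r => ‖K r s‖) = (Ioi s).indicator (fun r => ‖(t - r) ^ (-p) * (r - s) ^ (-q) * f s‖) := by
    intro s; ext r; by_cases h : s < r <;> simp [K, indicator, h]
  have hsec : ∀ s ∈ Ioo a t, Ioi s ∩ Ioo a t = Ioo s t := by
    intro s hs; ext r; simp only [mem_inter_iff, mem_Ioi, mem_Ioo]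
    exact ⟨fun h => ⟨h.1, h.2.2⟩, fun h => ⟨h.1, hs.1.trans h.1, h.2⟩⟩
  have hsec2 : ∀ r ∈ Ioo a t, Iio r ∩ Ioo a t = Ioo a r := by
    intro s hs; ext r; simp only [mem_inter_iff, mem_Iio, mem_Ioo]
    exact ⟨fun h => ⟨h.2.1, h.1⟩, fun h => ⟨h.2, h.1, h.2.trans hs.2⟩⟩
  have hin1 : ∀ s ∈ Ioo a t, ∫ r, K r s ∂μ = betaC p q * ((t - s) ^ (1 - p - q) * f s) := by
    intro s hs
    rw [hK1 s, integral_indicator measurableSet_Ioi, hμ, Measure.restrict_restrict measurableSet_Ioi, hsec s hs,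
      integral_mul_const, ← integral_Ioo_of_le hs.2.le, betaVal p q s t hs.2, mul_assoc]
  have hin2 : ∀ r ∈ Ioo a t, ∫ s, K r s ∂μ = (t - r) ^ (-p) * ∫ s in a..r, (r - s) ^ (-q) * f s := by
    intro r hr
    rw [hK2 r, integral_indicator measurableSet_Iio, hμ, Measure.restrict_restrict measurableSet_Iio, hsec2 r hr,
      integral_Ioo_of_le hr.1.le, ← integral_const_mul]
    simp only [mul_assoc]
  have hin1n : ∀ s ∈ Ioo a t, ∫ r, ‖K r s‖ ∂μ = betaC p q * ((t - s) ^ (1 - p - q) * ‖f s‖) := by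
    intro s hs
    rw [hK1n s, integral_indicator measurableSet_Ioi, hμ, Measure.restrict_restrict measurableSet_Ioi, hsec s hs]
    have : ∫ r in Ioo s t, ‖(t - r) ^ (-p) * (r - s) ^ (-q) * f s‖ = ∫ r in Ioo s t, (t - r) ^ (-p) * (r - s) ^ (-q) * ‖f s‖ := by
      apply setIntegral_congr_fun measurableSet_Ioo
      intro r hr
      simp only
      rw [norm_mul, Real.norm_of_nonneg]
      exact mul_nonneg (Real.rpow_nonneg (by linarith [hr.2]) _) (Real.rpow_nonneg (by linarith [hr.1]) _)
    rw [this, integral_mul_const, ← integral_Ioo_of_le hs.2.le, betaVal p q s t hs.2, mul_assoc]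
  have hpq : ∀ g : ℝ → ℝ, Continuous g → IntervalIntegrable (fun s => (t - s) ^ (1 - p - q) * g s) volume a t := by
    intro g hg
    have := kerInt (-(1 - p - q)) (by linarith) t a t
    rw [neg_neg] at this
    exact this.mul_continuousOn hg.continuousOn
  have hKint : Integrable (Function.uncurry K) (μ.prod μ) := by
    rw [integrable_prod_iff']
    · constructor
      · refine (ae_restrict_iff' measurableSet_Ioo).2 (Filter.Eventually.of_forall fun s hs => ?_)
        simp only [Function.uncurry_apply_pair]
        rw [hK1 s, integrable_indicator_iff measurableSet_Ioi, IntegrableOn, Measure.restrict_restrict measurableSet_Ioi, hsec s hs]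
        have := (betaInt p q hp0 hp hq0 hq s t hs.2).mul_const (f s)
        rw [intervalIntegrable_iff_integrableOn_Ioo_of_le hs.2.le] at this
        exact this
      · have := (hpq (fun s => ‖f s‖) hf.norm).const_mul (betaC p q)
        rw [intervalIntegrable_iff_integrableOn_Ioo_of_le hat] at this
        refine Integrable.congr this ?_
        refine (ae_restrict_iff' measurableSet_Ioo).2 (Filter.Eventually.of_forall fun s hs => ?_)
        exact (hin1n s hs).symm
    · apply Measurable.aestronglyMeasurable
      refine Measurable.ite (measurableSet_lt measurable_snd measurable_fst) ?_ measurable_const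
      have := hf.measurable
      fun_prop
  constructor
  · rw [intervalIntegrable_iff_integrableOn_Ioo_of_le hat]
    refine Integrable.congr hKint.integral_prod_left ?_
    refine (ae_restrict_iff' measurableSet_Ioo).2 (Filter.Eventually.of_forall fun r hr => ?_)
    exact hin2 r hr
  · have hsw := integral_integral_swap hKint
    rw [integral_Ioo_of_le hat, integral_Ioo_of_le hat, ← integral_const_mul]
    rw [setIntegral_congr_fun measurableSet_Ioo hin2, setIntegral_congr_fun measurableSet_Ioo hin1] at hsw
    exact hsw

lemma semigroup (p q : ℝ) (hp0 : 0 ≤ p) (hp : p < 1) (hq0 : 0 ≤ q) (hq : q < 1) (a t : ℝ) (hat : a ≤ t)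
    (f : ℝ → ℝ) (hf : ContinuousOn f (Icc a t)) :
    IntervalIntegrable (fun r => (t - r) ^ (-p) * ∫ s in a..r, (r - s) ^ (-q) * f s) volume a t ∧
    ∫ r in a..t, (t - r) ^ (-p) * (∫ s in a..r, (r - s) ^ (-q) * f s)
      = betaC p q * ∫ s in a..t, (t - s) ^ (1 - p - q) * f s := by
  have hc : Continuous (IccExtend hat ((Icc a t).domRestrict f)) :=
    (continuousOn_iff_continuous_domRestrict.1 hf).Icc_extend'
  have he : ∀ x ∈ Icc a t, IccExtend hat ((Icc a t).domRestrict f) x = f x := by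
    intro x hx; rw [IccExtend_of_mem hat _ hx]; rfl
  obtain ⟨h1, h2⟩ := semigroup_aux p q hp0 hp hq0 hq a t hat _ hc
  have hr : ∀ r ∈ Icc a t, ∫ s in a..r, (r - s) ^ (-q) * IccExtend hat ((Icc a t).domRestrict f) s
      = ∫ s in a..r, (r - s) ^ (-q) * f s := by
    intro r hr
    apply intervalIntegral.integral_congr
    intro s hs
    rw [uIcc_of_le hr.1] at hs
    simp only
    rw [he s ⟨hs.1, hs.2.trans hr.2⟩]
  constructor
  · refine h1.congr ?_
    intro r hr'
    rw [uIoc_of_le hat] at hr'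
    simp only
    rw [hr r ⟨hr'.1.le, hr'.2⟩]
  · have e1 : ∫ r in a..t, (t - r) ^ (-p) * (∫ s in a..r, (r - s) ^ (-q) * f s) =
      ∫ r in a..t, (t - r) ^ (-p) * (∫ s in a..r, (r - s) ^ (-q) * IccExtend hat ((Icc a t).domRestrict f) s) := by
      apply intervalIntegral.integral_congr
      intro r hr'
      rw [uIcc_of_le hat] at hr'
      simp only
      rw [hr r hr']
    have e2 : ∫ s in a..t, (t - s) ^ (1 - p - q) * f s =
      ∫ s in a..t, (t - s) ^ (1 - p - q) * IccExtend hat ((Icc a t).domRestrict f) s := by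
      apply intervalIntegral.integral_congr
      intro r hr'
      rw [uIcc_of_le hat] at hr'
      simp only
      rw [he r hr']
    rw [e1, e2, h2]

lemma parts_ineq (c d : ℝ) (hcd : c ≤ d) (Q Q' v v' : ℝ → ℝ)
    (hQ : ∀ x ∈ Icc c d, HasDerivAt Q (Q' x) x) (hQc : ContinuousOn Q' (Icc c d)) (hQn : ∀ x ∈ Icc c d, Q' x ≤ 0)
    (hv : ∀ x ∈ Icc c d, HasDerivAt v (v' x) x) (hvc : ContinuousOn v' (Icc c d)) (hvn : ∀ x ∈ Icc c d, 0 ≤ v x) :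
    Q d * v d - Q c * v c ≤ ∫ x in c..d, Q x * v' x := by
  rw [← uIcc_of_le hcd] at hQ hQc hv hvc
  rw [intervalIntegral.integral_mul_deriv_eq_deriv_mul hQ hv hQc.intervalIntegrable hvc.intervalIntegrable]
  have : 0 ≤ ∫ x in c..d, -(Q' x * v x) := by
    apply intervalIntegral.integral_nonneg hcd
    intro x hx
    nlinarith [hQn x hx, hvn x hx, mul_nonneg (neg_nonneg.2 (hQn x hx)) (hvn x hx)]
  rw [intervalIntegral.integral_neg] at this
  linarith

lemma kerDeriv (e y s : ℝ) (h : s < y) :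
    HasDerivAt (fun s : ℝ => (y - s) ^ e) (-(e * (y - s) ^ (e - 1))) s := by
  have h1 : HasDerivAt (fun s : ℝ => y - s) (-1) s := by
    simpa using (hasDerivAt_id s).const_sub y
  have := h1.rpow_const (p := e) (Or.inl (by linarith))
  convert this using 1
  ring

lemma kerCont (e y c d : ℝ) (h : d < y) : ContinuousOn (fun s : ℝ => (y - s) ^ e) (Icc c d) :=
  fun s hs => (kerDeriv e y s (by linarith [hs.2])).continuousAt.continuousWithinAt

lemma tendsto_prim (a x : ℝ) (hax : a < x) (f : ℝ → ℝ) (hf : IntervalIntegrable f volume a x) :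
    Filter.Tendsto (fun c => ∫ s in a..c, f s) (nhdsWithin x (Iio x)) (nhds (∫ s in a..x, f s)) := by
  have h := intervalIntegral.continuousOn_primitive_interval (a := a) (b := x) (μ := volume) (f := f)
    ((intervalIntegrable_iff' (by simp)).1 hf)
  rw [uIcc_of_le hax.le] at h
  have h2 := h x ⟨hax.le, le_rfl⟩
  have h3 : Filter.Tendsto (fun c => ∫ s in a..c, f s) (nhdsWithin x (Ico a x)) (nhds (∫ s in a..x, f s)) :=
    h2.mono_left (nhdsWithin_mono _ Ico_subset_Icc_self)
  rwa [nhdsWithin_Ico_eq_nhdsLT hax] at h3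

lemma spatial_left (γ a x0 : ℝ) (hγ0 : 0 < γ) (hγ : γ < 1) (ha : a < x0) (f f' : ℝ → ℝ)
    (hd : ∀ x ∈ Icc a x0, HasDerivAt f (f' x) x) (hc : ContinuousOn f' (Icc a x0))
    (hmin : ∀ x ∈ Icc a x0, f x0 ≤ f x) (h : ℝ) (hh : 0 < h) :
    0 ≤ ∫ s in a..x0, ((x0 + h - s) ^ (-γ) - (x0 - s) ^ (-γ)) * f' s := by
  have hI : IntervalIntegrable (fun s => ((x0 + h - s) ^ (-γ) - (x0 - s) ^ (-γ)) * f' s) volume a x0 := by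
    apply IntervalIntegrable.mul_continuousOn
    · exact (kerInt γ hγ _ _ _).sub (kerInt γ hγ _ _ _)
    · rwa [uIcc_of_le ha.le]
  obtain ⟨M, hM⟩ := isCompact_Icc.exists_bound_of_continuousOn hc
  have hlip : ∀ c ∈ Icc a x0, f c - f x0 ≤ M * (x0 - c) := by
    intro c hcc
    have := (convex_Icc a x0).norm_image_sub_le_of_norm_hasDerivWithin_le
      (fun x hx => (hd x hx).hasDerivWithinAt) hM (right_mem_Icc.2 ha.le) hcc
    rw [Real.norm_eq_abs, Real.norm_eq_abs, abs_sub_comm c x0, abs_of_nonneg (by linarith [hcc.2] : 0 ≤ x0 - c)] at this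
    exact (le_abs_self _).trans this
  have hlow : ∀ c ∈ Ioo a x0, -(M * (x0 - c) ^ (1 - γ)) ≤
      ∫ s in a..c, ((x0 + h - s) ^ (-γ) - (x0 - s) ^ (-γ)) * f' s := by
    intro c hcc
    have hsub : Icc a c ⊆ Icc a x0 := Icc_subset_Icc_right hcc.2.le
    have hQle : ∀ s ∈ Icc a c, (x0 + h - s) ^ (-γ) - (x0 - s) ^ (-γ) ≤ 0 := by
      intro s hs
      have := Real.rpow_le_rpow_of_nonpos (x := x0 - s) (y := x0 + h - s) (z := -γ) (by linarith [hs.2, hcc.2]) (by linarith) (by linarith)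
      linarith
    have hp := parts_ineq a c hcc.1.le (fun s => (x0 + h - s) ^ (-γ) - (x0 - s) ^ (-γ))
      (fun s => -(-γ * (x0 + h - s) ^ (-γ - 1)) - -(-γ * (x0 - s) ^ (-γ - 1))) (fun s => f s - f x0) f'
      (fun s hs => (kerDeriv (-γ) (x0 + h) s (by linarith [hs.2, hcc.2])).sub (kerDeriv (-γ) x0 s (by linarith [hs.2, hcc.2])))
      (((continuousOn_const.mul (kerCont (-γ - 1) (x0 + h) a c (by linarith [hcc.2]))).neg).sub
        ((continuousOn_const.mul (kerCont (-γ - 1) x0 a c hcc.2)).neg))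
      (fun s hs => by
        have := Real.rpow_le_rpow_of_nonpos (x := x0 - s) (y := x0 + h - s) (z := -γ - 1) (by linarith [hs.2, hcc.2]) (by linarith) (by linarith)
        nlinarith)
      (fun s hs => (hd s (hsub hs)).sub_const _) (hc.mono hsub) (fun s hs => by linarith [hmin s (hsub hs)])
    refine le_trans ?_ hp
    have ha0 := mul_nonneg (neg_nonneg.2 (hQle a ⟨le_rfl, hcc.1.le⟩)) (sub_nonneg.2 (hmin a ⟨le_rfl, ha.le⟩))
    have hpos : 0 < x0 - c := by linarith [hcc.2]
    have k1 : 0 ≤ (x0 + h - c) ^ (-γ) := Real.rpow_nonneg (by linarith) _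
    have k2 : 0 ≤ (x0 - c) ^ (-γ) := Real.rpow_nonneg (by linarith) _
    have k3 : (x0 - c) ^ (1 - γ) = (x0 - c) * (x0 - c) ^ (-γ) := by
      rw [sub_eq_add_neg 1 γ, Real.rpow_add hpos, Real.rpow_one]
    have hcm : c ∈ Icc a x0 := ⟨hcc.1.le, hcc.2.le⟩
    have k4 := mul_le_mul_of_nonneg_left (hlip c hcm) k2
    have k5 := mul_nonneg k1 (sub_nonneg.2 (hmin c hcm))
    rw [k3]
    nlinarith
  have hl := tendsto_prim a x0 ha _ hI
  have hr : Filter.Tendsto (fun c => -(M * (x0 - c) ^ (1 - γ))) (nhdsWithin x0 (Iio x0)) (nhds 0) := by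
    have : ContinuousAt (fun c => -(M * (x0 - c) ^ (1 - γ))) x0 := by
      have h1 : ContinuousAt (fun c => (x0 - c)) x0 := by fun_prop
      exact (continuousAt_const.mul (h1.rpow_const (Or.inr (by linarith)))).neg
    have h2 := this.tendsto
    simp only [sub_self] at h2
    rw [Real.zero_rpow (by linarith), mul_zero, neg_zero] at h2
    exact h2.mono_left nhdsWithin_le_nhds
  refine le_of_tendsto_of_tendsto hr hl ?_
  filter_upwards [Ioo_mem_nhdsLT ha] with c hcc using hlow c hcc

lemma spatial_right (γ x0 X : ℝ) (hγ0 : 0 < γ) (hγ : γ < 1) (hX : x0 < X) (f f' : ℝ → ℝ)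
    (hd : ∀ x ∈ Icc x0 X, HasDerivAt f (f' x) x) (hc : ContinuousOn f' (Icc x0 X))
    (hmin : ∀ x ∈ Icc x0 X, f x0 ≤ f x) :
    0 ≤ ∫ s in x0..X, (X - s) ^ (1 - γ) * f' s := by
  have hI : IntervalIntegrable (fun s => (X - s) ^ (1 - γ) * f' s) volume x0 X := by
    apply IntervalIntegrable.mul_continuousOn
    · have := kerInt (-(1 - γ)) (by linarith) X x0 X
      rwa [neg_neg] at this
    · rwa [uIcc_of_le hX.le]
  refine ge_of_tendsto (tendsto_prim x0 X hX _ hI) ?_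
  filter_upwards [Ioo_mem_nhdsLT hX] with c hcc
  have hsub : Icc x0 c ⊆ Icc x0 X := Icc_subset_Icc_right hcc.2.le
  have hp := parts_ineq x0 c hcc.1.le (fun s => (X - s) ^ (1 - γ))
      (fun s => -((1 - γ) * (X - s) ^ (1 - γ - 1))) (fun s => f s - f x0) f'
      (fun s hs => kerDeriv (1 - γ) X s (by linarith [hs.2, hcc.2]))
      ((continuousOn_const.mul (kerCont (1 - γ - 1) X x0 c hcc.2)).neg)
      (fun s hs => by
        have : 0 ≤ (X - s) ^ (1 - γ - 1) := Real.rpow_nonneg (by linarith [hs.2, hcc.2]) _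
        nlinarith)
      (fun s hs => (hd s (hsub hs)).sub_const _) (hc.mono hsub) (fun s hs => by linarith [hmin s (hsub hs)])
  refine le_trans ?_ hp
  have : 0 ≤ (X - c) ^ (1 - γ) := Real.rpow_nonneg (by linarith [hcc.2]) _
  have h2 := mul_nonneg this (sub_nonneg.2 (hmin c ⟨hcc.1.le, hcc.2.le⟩))
  simpa using h2

lemma spatial (γ a b x0 : ℝ) (hγ0 : 0 < γ) (hγ : γ < 1) (ha : a < x0) (hb : x0 < b) (f f' : ℝ → ℝ)
    (hd : ∀ x ∈ Icc a b, HasDerivAt f (f' x) x) (hc : ContinuousOn f' (Icc a b))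
    (hmin : ∀ x ∈ Icc a b, f x0 ≤ f x) (D : ℝ)
    (hD : HasDerivAt (fun x => ∫ s in a..x, (x - s) ^ (-γ) * f' s) D x0) : 0 ≤ D := by
  by_contra hneg
  push Not at hneg
  set g := (fun x => ∫ s in a..x, (x - s) ^ (-γ) * f' s) with hg
  have hkI : ∀ y c d, c ∈ Icc a b → d ∈ Icc a b → IntervalIntegrable (fun s => (y - s) ^ (-γ) * f' s) volume c d := by
    intro y c d h1 h2
    exact (kerInt γ hγ _ _ _).mul_continuousOn (hc.mono (uIcc_subset_Icc h1 h2))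
  have ham : a ∈ Icc a b := ⟨le_rfl, by linarith⟩
  have hxm : x0 ∈ Icc a b := ⟨ha.le, hb.le⟩
  have hev : ∀ᶠ r in nhdsWithin x0 (Ioi x0), g r < g x0 := by
    have h1 := (hasDerivAt_iff_tendsto_slope.1 hD).eventually (gt_mem_nhds hneg)
    have h2 := h1.filter_mono (nhdsWithin_mono x0 (fun y (hy : y ∈ Ioi x0) => ne_of_gt hy))
    filter_upwards [h2, self_mem_nhdsWithin] with r hr hr2
    rw [slope_def_field] at hr
    have : 0 < r - x0 := sub_pos.2 hr2
    by_contra hcon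
    have := div_nonneg (sub_nonneg.2 (not_lt.1 hcon)) this.le
    linarith
  obtain ⟨X, hX, hXs⟩ := (mem_nhdsGT_iff_exists_Ioo_subset' hb).1 (Filter.inter_mem hev (Ioo_mem_nhdsGT hb))
  have hX : x0 < X := hX
  obtain ⟨Y, hY1, hY2⟩ := exists_between hX
  have hYb : Y < b := (hXs ⟨hY1, hY2⟩).2.2
  have hS : ∀ r ∈ Ioo x0 Y, ∫ s in x0..r, (r - s) ^ (-γ) * f' s < 0 := by
    intro r hr
    have hlt : g r < g x0 := (hXs ⟨hr.1, hr.2.trans hY2⟩).1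
    have hrm : r ∈ Icc a b := ⟨by linarith [hr.1], by linarith [hr.2]⟩
    have hA := spatial_left γ a x0 hγ0 hγ ha f f' (fun x hx => hd x ⟨hx.1, hx.2.trans hb.le⟩)
      (hc.mono (Icc_subset_Icc_right hb.le)) (fun x hx => hmin x ⟨hx.1, hx.2.trans hb.le⟩) (r - x0) (by linarith [hr.1])
    have e : ∫ s in a..x0, ((x0 + (r - x0) - s) ^ (-γ) - (x0 - s) ^ (-γ)) * f' s
        = (∫ s in a..x0, (r - s) ^ (-γ) * f' s) - ∫ s in a..x0, (x0 - s) ^ (-γ) * f' s := by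
      rw [← intervalIntegral.integral_sub (hkI r a x0 ham hxm) (hkI x0 a x0 ham hxm)]
      simp only [sub_mul, add_sub_cancel]
    rw [e] at hA
    have e2 := intervalIntegral.integral_add_adjacent_intervals (hkI r a x0 ham hxm) (hkI r x0 r hxm hrm)
    simp only [hg] at hlt
    linarith
  have hsubY : Icc x0 Y ⊆ Icc a b := Icc_subset_Icc ha.le hYb.le
  obtain ⟨h1, h2⟩ := semigroup 0 γ le_rfl zero_lt_one hγ0.le hγ x0 Y hY1.le f' (hc.mono hsubY)
  have h3 := spatial_right γ x0 Y hγ0 hγ hY1 f f' (fun x hx => hd x (hsubY hx)) (hc.mono hsubY) (fun x hx => hmin x (hsubY hx))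
  simp only [neg_zero, Real.rpow_zero, one_mul, sub_zero] at h1 h2
  have h4 := intervalIntegral.intervalIntegral_pos_of_pos_on h1.neg (fun r hr => neg_pos.2 (hS r hr)) hY1
  have h5 := mul_nonneg (betaC_pos 0 γ le_rfl zero_lt_one hγ0.le hγ).le h3
  simp only [Pi.neg_apply, intervalIntegral.integral_neg] at h4
  linarith

lemma rlCont0 (α T : ℝ) (hα0 : 0 < α) (W : ℝ → ℝ) (hW : ContinuousOn W (Icc 0 T)) :
    ContinuousWithinAt (fun t => ∫ s in (0:ℝ)..t, (t - s) ^ (-(1 - α)) * W s) (Icc 0 T) 0 := by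
  obtain ⟨B, hB⟩ := isCompact_Icc.exists_bound_of_continuousOn hW
  rw [ContinuousWithinAt, intervalIntegral.integral_same]
  have hr : Filter.Tendsto (fun t : ℝ => B * (t ^ α / α)) (nhdsWithin 0 (Icc 0 T)) (nhds 0) := by
    have h1 : ContinuousAt (fun t : ℝ => B * (t ^ α / α)) 0 :=
      continuousAt_const.mul ((continuousAt_id.rpow_const (Or.inr hα0.le)).div_const _)
    have h2 := h1.tendsto
    simp only [Real.zero_rpow hα0.ne', zero_div, mul_zero] at h2
    exact h2.mono_left nhdsWithin_le_nhds
  refine squeeze_zero_norm' ?_ hr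
  filter_upwards [self_mem_nhdsWithin] with t ht
  have hk := kerInt (1 - α) (by linarith) t 0 t
  have h1 : ‖∫ s in (0:ℝ)..t, (t - s) ^ (-(1 - α)) * W s‖ ≤ ∫ s in (0:ℝ)..t, B * (t - s) ^ (-(1 - α)) := by
    refine intervalIntegral.norm_integral_le_of_norm_le ht.1 ?_ (hk.const_mul B)
    refine Filter.Eventually.of_forall fun s hs => ?_
    have h0 : 0 ≤ (t - s) ^ (-(1 - α)) := Real.rpow_nonneg (by linarith [hs.2]) _
    rw [norm_mul, Real.norm_of_nonneg h0, mul_comm]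
    exact mul_le_mul_of_nonneg_right (hB s ⟨hs.1.le, hs.2.trans ht.2⟩) h0
  have h2 : ∫ s in (0:ℝ)..t, B * (t - s) ^ (-(1 - α)) = B * (t ^ α / α) := by
    rw [intervalIntegral.integral_const_mul, intervalIntegral.integral_comp_sub_left (fun x : ℝ => x ^ (-(1 - α))) t,
      integral_rpow (Or.inl (by linarith))]
    simp only [sub_self, sub_zero]
    rw [show -(1 - α) + 1 = α by ring, Real.zero_rpow hα0.ne', sub_zero]
  exact h1.trans h2.le

lemma temporal (α t0 : ℝ) (hα0 : 0 < α) (hα : α < 1) (ht0 : 0 < t0) (W z : ℝ → ℝ) (hW : ContinuousOn W (Icc 0 t0))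
    (hz : ∀ t, z t = ∫ s in (0:ℝ)..t, (t - s) ^ (-(1 - α)) * W s)
    (hzc : ContinuousOn z (Icc 0 t0)) (z' : ℝ) (hz' : HasDerivAt z z' t0)
    (hmin : ∀ t ∈ Icc 0 t0, z t0 ≤ z t) (hneg : z t0 < 0) (hW0 : 0 ≤ W t0) : False := by
  set C := betaC α (1 - α) with hC
  have hCpos : 0 < C := betaC_pos α (1 - α) hα0.le hα (by linarith) (by linarith)
  have hM : ∀ t ∈ Icc 0 t0, ∫ r in (0:ℝ)..t, (t - r) ^ (-α) * z r = C * ∫ s in (0:ℝ)..t, W s := by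
    intro t ht
    have h := (semigroup α (1 - α) hα0.le hα (by linarith) (by linarith) 0 t ht.1 W (hW.mono (Icc_subset_Icc_right ht.2))).2
    simp only [sub_self, Real.rpow_zero, one_mul] at h
    simp only [← hz] at h
    exact h
  set δ := -z t0 * t0 ^ (-α) with hδ
  have hδpos : 0 < δ := mul_pos (by linarith) (Real.rpow_pos_of_pos ht0 _)
  obtain ⟨K, hKpos, hK⟩ := hz'.isBigO_sub.exists_pos
  have hK := hK.bound
  have hWe : ∀ᶠ r in nhdsWithin t0 (Icc 0 t0), -(δ / (2 * C)) < W r :=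
    (hW t0 ⟨ht0.le, le_rfl⟩).eventually (lt_mem_nhds (lt_of_lt_of_le (neg_lt_zero.2 (by positivity)) hW0))
  rw [eventually_nhdsWithin_iff] at hWe
  obtain ⟨η, hη, hηp⟩ := Metric.eventually_nhds_iff.1 (hK.and hWe)
  have hsm : ∀ᶠ h in nhdsWithin (0:ℝ) (Ioi 0), K * h ^ (1 - α) < δ / 2 := by
    have h1 : ContinuousAt (fun t : ℝ => K * t ^ (1 - α)) 0 :=
      continuousAt_const.mul (continuousAt_id.rpow_const (Or.inr (by linarith)))
    have h2 := h1.tendsto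
    simp only [Real.zero_rpow (by linarith : 1 - α ≠ 0), mul_zero] at h2
    exact (h2.eventually (gt_mem_nhds (by positivity))).filter_mono nhdsWithin_le_nhds
  obtain ⟨h, ⟨hh1, hh2⟩, hh3⟩ := ((hsm.and (Ioo_mem_nhdsGT hη)).and (Ioo_mem_nhdsGT ht0)).exists
  have hh0 : 0 < h := hh2.1
  set t1 := t0 - h with ht1
  have ht1p : 0 < t1 := by linarith [hh3.2]
  have ht10 : t1 < t0 := by linarith
  have hnear : ∀ r ∈ Icc t1 t0, z r - z t0 ≤ K * (t0 - r) ∧ -(δ / (2 * C)) < W r := by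
    intro r hr
    have hd : dist r t0 < η := by
      rw [Real.dist_eq, abs_sub_comm, abs_of_nonneg (by linarith [hr.2])]; linarith [hr.1, hh2.2]
    obtain ⟨h1, h2⟩ := hηp hd
    refine ⟨?_, h2 ⟨by linarith [hr.1], hr.2⟩⟩
    rw [Real.norm_eq_abs, Real.norm_eq_abs, abs_sub_comm r t0, abs_of_nonneg (by linarith [hr.2] : 0 ≤ t0 - r)] at h1
    exact (le_abs_self _).trans h1
  have hWI : ∀ c d, c ∈ Icc 0 t0 → d ∈ Icc 0 t0 → IntervalIntegrable W volume c d :=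
    fun c d h1 h2 => (hW.mono (uIcc_subset_Icc h1 h2)).intervalIntegrable
  have m0 : (0:ℝ) ∈ Icc 0 t0 := ⟨le_rfl, ht0.le⟩
  have m1 : t1 ∈ Icc 0 t0 := ⟨ht1p.le, ht10.le⟩
  have m2 : t0 ∈ Icc 0 t0 := ⟨ht0.le, le_rfl⟩
  -- lower bound
  have hlow : -(δ / (2 * C)) * h ≤ ∫ s in t1..t0, W s := by
    have := intervalIntegral.integral_mono_on ht10.le (intervalIntegrable_const (c := -(δ / (2 * C)))) (hWI t1 t0 m1 m2)
      (fun r hr => (hnear r hr).2.le)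
    rw [intervalIntegral.integral_const, smul_eq_mul] at this
    rw [show t0 - t1 = h by rw [ht1]; ring] at this
    linarith
  have hdiff : (∫ r in (0:ℝ)..t0, (t0 - r) ^ (-α) * z r) - (∫ r in (0:ℝ)..t1, (t1 - r) ^ (-α) * z r) ≥ -(δ / 2) * h := by
    rw [hM t0 m2, hM t1 m1, ← mul_sub, ← intervalIntegral.integral_add_adjacent_intervals (hWI 0 t1 m0 m1) (hWI t1 t0 m1 m2), add_sub_cancel_left]
    have := mul_le_mul_of_nonneg_left hlow hCpos.le
    have e : C * (-(δ / (2 * C)) * h) = -(δ / 2) * h := by field_simp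
    linarith
  have hpI : ∀ y c d, c ∈ Icc 0 t0 → d ∈ Icc 0 t0 → IntervalIntegrable (fun r => (y - r) ^ (-α) * (z r - z t0)) volume c d :=
    fun y c d h1 h2 => (kerInt α hα _ _ _).mul_continuousOn ((hzc.mono (uIcc_subset_Icc h1 h2)).sub continuousOn_const)
  have hsplit : ∀ t ∈ Icc 0 t0, ∫ r in (0:ℝ)..t, (t - r) ^ (-α) * z r
      = (∫ r in (0:ℝ)..t, (t - r) ^ (-α) * (z r - z t0)) + z t0 * ∫ r in (0:ℝ)..t, r ^ (-α) := by
    intro t ht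
    have e : ∫ r in (0:ℝ)..t, r ^ (-α) = ∫ r in (0:ℝ)..t, (t - r) ^ (-α) := by
      rw [intervalIntegral.integral_comp_sub_left (fun x : ℝ => x ^ (-α)) t]; simp
    rw [e, ← intervalIntegral.integral_const_mul, ← intervalIntegral.integral_add (hpI t 0 t m0 ht) ((kerInt α hα _ _ _).const_mul _)]
    congr 1; ext r; ring
  have hrI : ∀ c d : ℝ, IntervalIntegrable (fun r : ℝ => r ^ (-α)) volume c d :=
    fun c d => intervalIntegral.intervalIntegrable_rpow' (by linarith)
  have hpow : h * t0 ^ (-α) ≤ (∫ r in (0:ℝ)..t0, r ^ (-α)) - ∫ r in (0:ℝ)..t1, r ^ (-α) := by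
    rw [← intervalIntegral.integral_add_adjacent_intervals (hrI 0 t1) (hrI t1 t0), add_sub_cancel_left]
    have := intervalIntegral.integral_mono_on ht10.le (intervalIntegrable_const (c := t0 ^ (-α))) (hrI t1 t0)
      (fun r hr => Real.rpow_le_rpow_of_nonpos (by linarith [hr.1]) hr.2 (by linarith))
    rw [intervalIntegral.integral_const, smul_eq_mul] at this
    rw [show t0 - t1 = h by rw [ht1]; ring] at this
    exact this
  have hN1 : ∫ r in (0:ℝ)..t1, (t0 - r) ^ (-α) * (z r - z t0) ≤ ∫ r in (0:ℝ)..t1, (t1 - r) ^ (-α) * (z r - z t0) := by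
    apply intervalIntegral.integral_mono_on_of_le_Ioo ht1p.le (hpI t0 0 t1 m0 m1) (hpI t1 0 t1 m0 m1)
    intro r hr
    apply mul_le_mul_of_nonneg_right
    · exact Real.rpow_le_rpow_of_nonpos (by linarith [hr.2]) (by linarith) (by linarith)
    · linarith [hmin r ⟨hr.1.le, hr.2.le.trans ht10.le⟩]
  have hN2 : ∫ r in t1..t0, (t0 - r) ^ (-α) * (z r - z t0) ≤ h * (K * h ^ (1 - α)) := by
    have := intervalIntegral.integral_mono_on_of_le_Ioo ht10.le (hpI t0 t1 t0 m1 m2) (intervalIntegrable_const (c := K * h ^ (1 - α)))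
      (fun r hr => by
        have h1 := (hnear r ⟨hr.1.le, hr.2.le⟩).1
        have hp : 0 < t0 - r := by linarith [hr.2]
        have h2 : 0 ≤ (t0 - r) ^ (-α) := Real.rpow_nonneg hp.le _
        have h3 : (t0 - r) ^ (1 - α) ≤ h ^ (1 - α) := Real.rpow_le_rpow hp.le (by linarith [hr.1]) (by linarith)
        have k3 : (t0 - r) ^ (1 - α) = (t0 - r) * (t0 - r) ^ (-α) := by
          rw [sub_eq_add_neg 1 α, Real.rpow_add hp, Real.rpow_one]
        calc (t0 - r) ^ (-α) * (z r - z t0) ≤ (t0 - r) ^ (-α) * (K * (t0 - r)) := mul_le_mul_of_nonneg_left h1 h2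
          _ = K * (t0 - r) ^ (1 - α) := by rw [k3]; ring
          _ ≤ _ := mul_le_mul_of_nonneg_left h3 hKpos.le)
    rw [intervalIntegral.integral_const, smul_eq_mul] at this
    rwa [show t0 - t1 = h by rw [ht1]; ring] at this
  rw [hsplit t0 m2, hsplit t1 m1, ← intervalIntegral.integral_add_adjacent_intervals (hpI t0 0 t1 m0 m1) (hpI t0 t1 t0 m1 m2)] at hdiff
  have f1 := mul_le_mul_of_nonneg_left hpow (by linarith : 0 ≤ -z t0)
  have f2 := mul_lt_mul_of_pos_left hh1 hh0
  have f3 : -z t0 * (h * t0 ^ (-α)) = h * δ := by rw [hδ]; ring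
  rw [f3] at f1
  nlinarith

lemma seqAux_eq (β₁ β₂ a x : ℝ) (hβ₁ : 0 < β₁ ∧ β₁ < 1) (hβ₂ : 0 < β₂ ∧ β₂ < 1) (hx : a ≤ x) (f : ℝ → ℝ)
    (hf : ContinuousOn (deriv f) (Icc a x)) :
    seqCaputoAux β₁ β₂ a f x = (1 / Real.Gamma (1 - β₁) * (1 / Real.Gamma (1 - β₂)) * betaC β₁ β₂) *
      ∫ s in a..x, (x - s) ^ (-(β₁ + β₂ - 1)) * deriv f s := by
  have h := (semigroup β₁ β₂ hβ₁.1.le hβ₁.2 hβ₂.1.le hβ₂.2 a x hx (deriv f) hf).2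
  unfold seqCaputoAux caputo
  rw [show -(β₁ + β₂ - 1) = 1 - β₁ - β₂ by ring, mul_assoc _ (betaC β₁ β₂), ← h, mul_assoc,
    ← intervalIntegral.integral_const_mul (1 / Real.Gamma (1 - β₂))]
  congr 2
  ext s
  ring

lemma seq_nonneg (β₁ β₂ a b x0 : ℝ) (hβ₁ : 0 < β₁ ∧ β₁ < 1) (hβ₂ : 0 < β₂ ∧ β₂ < 1) (hsum : 1 < β₁ + β₂)
    (ha : a < x0) (hb : x0 < b) (f : ℝ → ℝ)
    (hd : ∀ x ∈ Icc a b, HasDerivAt f (deriv f x) x) (hc : ContinuousOn (deriv f) (Icc a b))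
    (hmin : ∀ x ∈ Icc a b, f x0 ≤ f x) (D : ℝ) (hD : HasDerivAt (seqCaputoAux β₁ β₂ a f) D x0) : 0 ≤ D := by
  set k := 1 / Real.Gamma (1 - β₁) * (1 / Real.Gamma (1 - β₂)) * betaC β₁ β₂ with hk
  have hkpos : 0 < k := by
    have h1 := Real.Gamma_pos_of_pos (by linarith [hβ₁.2] : 0 < 1 - β₁)
    have h2 := Real.Gamma_pos_of_pos (by linarith [hβ₂.2] : 0 < 1 - β₂)
    have h3 := betaC_pos β₁ β₂ hβ₁.1.le hβ₁.2 hβ₂.1.le hβ₂.2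
    positivity
  have hev : (fun x => ∫ s in a..x, (x - s) ^ (-(β₁ + β₂ - 1)) * deriv f s) =ᶠ[nhds x0]
      fun x => k⁻¹ * seqCaputoAux β₁ β₂ a f x := by
    filter_upwards [Ioo_mem_nhds ha hb] with x hx
    rw [seqAux_eq β₁ β₂ a x hβ₁ hβ₂ hx.1.le f (hc.mono (Icc_subset_Icc_right hx.2.le)), ← hk, inv_mul_cancel_left₀ hkpos.ne']
  have h2 := (hD.const_mul k⁻¹).congr_of_eventuallyEq hev
  have h3 := spatial (β₁ + β₂ - 1) a b x0 (by linarith) (by linarith [hβ₁.2, hβ₂.2]) ha hb f (deriv f) hd hc hmin _ h2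
  by_contra hcon
  have : 0 < k⁻¹ := inv_pos.2 hkpos
  nlinarith

/-- nonnegativity (minimum principle) for the time-space
fractional pseudo-parabolic equation
`∂u/∂t = ν D^{1−α}_{0+,t}[𝒟^{β₁}_{a+,x}𝒟^{β₂}_{a+,x} u] + F` with nonnegative
data. -/
theorem pseudo_parabolic_nonneg
    (α β₁ β₂ ν a b T : ℝ)
    (hα : 0 < α ∧ α < 1) (hβ₁ : 0 < β₁ ∧ β₁ < 1) (hβ₂ : 0 < β₂ ∧ β₂ < 1)
    (hsum : 1 < β₁ + β₂) (hν : 0 < ν) (hab : a < b) (hT : 0 < T)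
    (u F : ℝ → ℝ → ℝ) (φ ψ₁ ψ₂ : ℝ → ℝ)
    -- `u` is continuous on `[a,b] × [0,T]`
    (hu : ContinuousOn (Function.uncurry u) (Set.Icc a b ×ˢ Set.Icc 0 T))
    -- `x ↦ u(x,t)` is continuously differentiable on `[a,b]`
    (hux : ∀ t ∈ Set.Icc (0:ℝ) T, ∀ x ∈ Set.Icc a b,
      HasDerivAt (fun y => u y t) (deriv (fun y => u y t) x) x)
    (hux' : ∀ t ∈ Set.Icc (0:ℝ) T, ContinuousOn (deriv (fun y => u y t)) (Set.Icc a b))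
    -- `t ↦ u(x,t)` is continuously differentiable on `(0,T]`
    (hut : ∀ x ∈ Set.Icc a b, ∀ t ∈ Set.Ioc (0:ℝ) T, HasDerivAt (u x) (deriv (u x) t) t)
    (hut' : ∀ x ∈ Set.Icc a b, ContinuousOn (deriv (u x)) (Set.Ioc 0 T))
    -- `w = 𝒟^{β₁}𝒟^{β₂}_x u` exists and is continuous on `[a,b] × [0,T]`
    (hDxex : ∀ t ∈ Set.Icc (0:ℝ) T, ∀ x ∈ Set.Ioo a b,
      HasDerivAt (seqCaputoAux β₁ β₂ a (fun y => u y t))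
        (seqCaputo β₁ β₂ a (fun y => u y t) x) x)
    (hw : ContinuousOn (fun p : ℝ × ℝ => seqCaputo β₁ β₂ a (fun y => u y p.2) p.1)
      (Set.Icc a b ×ˢ Set.Icc 0 T))
    -- the Riemann–Liouville time derivative of `w` exists and is continuous on
    -- `[a,b] × (0,T]`
    (hrlex : ∀ x ∈ Set.Icc a b, ∀ t ∈ Set.Ioc (0:ℝ) T,
      HasDerivAt (rlAux (1 - α) (fun τ => seqCaputo β₁ β₂ a (fun y => u y τ) x))
        (rlDeriv (1 - α) (fun τ => seqCaputo β₁ β₂ a (fun y => u y τ) x) t) t)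
    (hrlc : ContinuousOn
      (fun p : ℝ × ℝ => rlDeriv (1 - α) (fun τ => seqCaputo β₁ β₂ a (fun y => u y τ) p.1) p.2)
      (Set.Icc a b ×ˢ Set.Ioc 0 T))
    -- data
    (hF : ContinuousOn (Function.uncurry F) (Set.Icc a b ×ˢ Set.Icc 0 T))
    (hφ : ContinuousOn φ (Set.Icc a b))
    (hψ₁ : ContinuousOn ψ₁ (Set.Icc 0 T)) (hψ₂ : ContinuousOn ψ₂ (Set.Icc 0 T))
    -- the pseudo-parabolic equation on `Ω = (a,b) × (0,T]`
    (heq : ∀ x ∈ Set.Ioo a b, ∀ t ∈ Set.Ioc (0:ℝ) T,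
      deriv (u x) t
        = ν * rlDeriv (1 - α) (fun τ => seqCaputo β₁ β₂ a (fun y => u y τ) x) t + F x t)
    -- initial and boundary conditions
    (hinit : ∀ x ∈ Set.Icc a b, u x 0 = φ x)
    (hbd1 : ∀ t ∈ Set.Icc (0:ℝ) T, u a t = ψ₁ t)
    (hbd2 : ∀ t ∈ Set.Icc (0:ℝ) T, u b t = ψ₂ t)
    -- sign conditions
    (hFpos : ∀ x ∈ Set.Icc a b, ∀ t ∈ Set.Icc (0:ℝ) T, 0 ≤ F x t)
    (hφpos : ∀ x ∈ Set.Icc a b, 0 ≤ φ x)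
    (hψ₁pos : ∀ t ∈ Set.Icc (0:ℝ) T, 0 ≤ ψ₁ t)
    (hψ₂pos : ∀ t ∈ Set.Icc (0:ℝ) T, 0 ≤ ψ₂ t) :
    ∀ x ∈ Set.Icc a b, ∀ t ∈ Set.Icc (0:ℝ) T, 0 ≤ u x t := by
  by_contra hcon
  push Not at hcon
  obtain ⟨x1, hx1, t1, ht1, hneg1⟩ := hcon
  obtain ⟨⟨x0, t0⟩, ⟨hx0, ht0⟩, hmin⟩ := (isCompact_Icc.prod isCompact_Icc).exists_isMinOn ⟨(x1, t1), hx1, ht1⟩ hu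
  have hmin : ∀ x ∈ Icc a b, ∀ t ∈ Icc 0 T, u x0 t0 ≤ u x t := fun x hx t ht =>
    isMinOn_iff.1 hmin (x, t) ⟨hx, ht⟩
  simp only at hx0 ht0
  have hneg : u x0 t0 < 0 := lt_of_le_of_lt (hmin x1 hx1 t1 ht1) hneg1
  have hxa : a < x0 := by
    refine lt_of_le_of_ne hx0.1 fun h => ?_
    rw [← h, hbd1 t0 ht0] at hneg
    linarith [hψ₁pos t0 ht0]
  have hxb : x0 < b := by
    refine lt_of_le_of_ne hx0.2 fun h => ?_
    rw [h, hbd2 t0 ht0] at hneg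
    linarith [hψ₂pos t0 ht0]
  have ht0p : 0 < t0 := by
    refine lt_of_le_of_ne ht0.1 fun h => ?_
    rw [← h, hinit x0 hx0] at hneg
    linarith [hφpos x0 hx0]
  set W : ℝ → ℝ := fun τ => seqCaputo β₁ β₂ a (fun y => u y τ) x0 with hWdef
  have hW : ContinuousOn W (Icc 0 T) := by
    have h1 : ContinuousOn (fun τ : ℝ => ((x0, τ) : ℝ × ℝ)) (Icc 0 T) := by fun_prop
    have h2 : MapsTo (fun τ : ℝ => ((x0, τ) : ℝ × ℝ)) (Icc 0 T) (Icc a b ×ˢ Icc 0 T) :=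
      fun τ hτ => mk_mem_prod hx0 hτ
    have h3 := ContinuousOn.comp hw h1 h2
    simpa only [Function.comp_def] using h3
  have hW0 : 0 ≤ W t0 :=
    seq_nonneg β₁ β₂ a b x0 hβ₁ hβ₂ hsum hxa hxb (fun y => u y t0) (hux t0 ht0) (hux' t0 ht0)
      (fun x hx => hmin x hx t0 ht0) _ (hDxex t0 ht0 x0 ⟨hxa, hxb⟩)
  set z : ℝ → ℝ := fun t => ∫ s in (0:ℝ)..t, (t - s) ^ (-(1 - α)) * W s with hz
  set G := 1 / Real.Gamma (1 - (1 - α)) with hG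
  have hGpos : 0 < G := by
    have := Real.Gamma_pos_of_pos (by linarith [hα.1] : 0 < 1 - (1 - α))
    positivity
  have hrl : rlAux (1 - α) W = fun t => G * z t := rfl
  have hz0 : z 0 = 0 := by simp [hz]
  have hzd : ∀ t ∈ Ioc 0 T, HasDerivAt z (G⁻¹ * rlDeriv (1 - α) W t) t := by
    intro t ht
    have h1 := (hrlex x0 hx0 t ht).const_mul G⁻¹
    refine h1.congr_of_eventuallyEq (Filter.Eventually.of_forall fun s => ?_)
    show z s = G⁻¹ * (G * z s)
    rw [inv_mul_cancel_left₀ hGpos.ne']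
  have hzc : ContinuousOn z (Icc 0 T) := by
    intro t ht
    rcases eq_or_lt_of_le ht.1 with h | h
    · rw [← h]; exact rlCont0 α T hα.1 W hW
    · exact (hzd t ⟨h, ht.2⟩).continuousAt.continuousWithinAt
  have huc : ContinuousOn (u x0) (Icc 0 T) := by
    have h1 : ContinuousOn (fun τ : ℝ => ((x0, τ) : ℝ × ℝ)) (Icc 0 T) := by fun_prop
    have h2 : MapsTo (fun τ : ℝ => ((x0, τ) : ℝ × ℝ)) (Icc 0 T) (Icc a b ×ˢ Icc 0 T) :=
      fun τ hτ => mk_mem_prod hx0 hτ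
    have h3 := ContinuousOn.comp hu h1 h2
    simpa only [Function.comp_def, Function.uncurry_apply_pair] using h3
  have hanti : AntitoneOn (fun t => ν * G * z t - u x0 t) (Icc 0 T) := by
    have hd : ∀ t ∈ Ioo 0 T, HasDerivAt (fun t => ν * G * z t - u x0 t) (-F x0 t) t := by
      intro t ht
      have ht' : t ∈ Ioc 0 T := ⟨ht.1, ht.2.le⟩
      have h1 := ((hzd t ht').const_mul (ν * G)).sub (hut x0 hx0 t ht')
      rw [heq x0 ⟨hxa, hxb⟩ t ht'] at h1
      have e : ν * G * (G⁻¹ * rlDeriv (1 - α) W t) - (ν * rlDeriv (1 - α) W t + F x0 t) = -F x0 t := by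
        rw [mul_assoc ν, mul_inv_cancel_left₀ hGpos.ne']
        ring
      rw [← e]
      exact h1
    have hcc : ContinuousOn (fun t => ν * G * z t - u x0 t) (Icc 0 T) := (continuousOn_const.mul hzc).sub huc
    apply antitoneOn_of_deriv_nonpos (convex_Icc 0 T) hcc
    · rw [interior_Icc]
      exact fun t ht => (hd t ht).differentiableAt.differentiableWithinAt
    · rw [interior_Icc]
      intro t ht
      rw [(hd t ht).deriv]
      linarith [hFpos x0 hx0 t ⟨ht.1.le, ht.2.le⟩]
  have hνG : 0 < ν * G := mul_pos hν hGpos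
  have hsub : Icc 0 t0 ⊆ Icc 0 T := Icc_subset_Icc_right ht0.2
  refine temporal α t0 hα.1 hα.2 ht0p W z (hW.mono hsub) (fun _ => rfl) (hzc.mono hsub) _ (hzd t0 ⟨ht0p, ht0.2⟩) ?_ ?_ hW0
  · intro t ht
    have h1 := hanti (hsub ht) ht0 ht.2
    have h2 := hmin x0 hx0 t (hsub ht)
    simp only at h1
    by_contra hc
    push Not at hc
    have := mul_lt_mul_of_pos_left hc hνG
    linarith
  · have h1 := hanti ⟨le_rfl, hT.le⟩ ht0 ht0.1
    simp only [hz0, hinit x0 hx0] at h1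
    have h2 := hφpos x0 hx0
    by_contra hc
    push Not at hc
    have := mul_nonneg hνG.le hc
    linarith
end

section
/- Let 0 < α < 1, 0 < β₁, β₂ < 1 with 1 < β₁ + β₂, ν > 0, −∞ < a < b < +∞, T > 0, and let F : [a,b] × [0,T] → ℝ, φ : [a,b] → ℝ, ψ₁, ψ₂ : [0,T] → ℝ be continuous. Then there is at most one continuous function u : [a,b] × [0,T] → ℝ (with t ↦ u(x,t) continuously differentiable on (0,T] for each x, x ↦ u(x,t) continuously differentiable on [a,b] for each t, the spatial sequential Caputo derivative 𝒟^{β₁}_{a+,x}𝒟^{β₂}_{a+,x} u continuous on [a,b] × [0,T], and its Riemann–Liouville time derivative D^{1−α}_{0+,t}[𝒟^{β₁}_{a+,x}𝒟^{β₂}_{a+,x} u] existing and continuous on [a,b] × (0,T]) satisfying ∂u/∂t(x,t) = ν · D^{1−α}_{0+,t}[𝒟^{β₁}_{a+,x}𝒟^{β₂}_{a+,x} u](x,t) + F(x,t) on (a,b) × (0,T], u(x,0) = φ(x) for x ∈ [a,b], and u(a,t) = ψ₁(t), u(b,t) = ψ₂(t) for t ∈ [0,T]. -/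
open Set

open MeasureTheory Filter Topology

noncomputable def fracI (p c : ℝ) (f : ℝ → ℝ) (x : ℝ) : ℝ :=
  (1 / Real.Gamma p) * ∫ s in c..x, (x - s) ^ (p - 1) * f s

lemma ker_int {p : ℝ} (hp : 0 < p) (c x : ℝ) :
    IntervalIntegrable (fun s => (x - s) ^ (p - 1)) volume c x := by
  have h := (intervalIntegral.intervalIntegrable_rpow' (a := 0) (b := x - c) (r := p - 1)
    (by linarith)).comp_sub_left x
  simpa using h.symm

lemma ker_integral {p : ℝ} (hp : 0 < p) (c x : ℝ) :
    ∫ s in c..x, (x - s) ^ (p - 1) = (x - c) ^ p / p := by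
  rw [intervalIntegral.integral_comp_sub_left (fun s => s ^ (p - 1)) x]
  rw [integral_rpow (Or.inl (by linarith))]
  simp [Real.zero_rpow hp.ne']

lemma kerf_int {p : ℝ} (hp : 0 < p) {c x : ℝ} {f : ℝ → ℝ} (hf : Continuous f) :
    IntervalIntegrable (fun s => (x - s) ^ (p - 1) * f s) volume c x :=
  (ker_int hp c x).mul_continuousOn hf.continuousOn

lemma integral_bound {p : ℝ} (hp : 0 < p) {c x M : ℝ} (hcx : c ≤ x) {f : ℝ → ℝ}
    (hM : ∀ s ∈ Set.Ioo c x, |f s| ≤ M) :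
    |∫ s in c..x, (x - s) ^ (p - 1) * f s| ≤ M * ((x - c) ^ p / p) := by
  have h := intervalIntegral.norm_integral_le_of_norm_le (μ := volume)
    (f := fun s => (x - s) ^ (p - 1) * f s)
    (g := fun s => M * (x - s) ^ (p - 1)) hcx ?_ ((ker_int hp c x).const_mul M)
  · rw [intervalIntegral.integral_const_mul, ker_integral hp] at h
    exact h
  · have : ∀ᵐ t : ℝ, t ≠ x := by simp [ae_iff]
    filter_upwards [this] with t ht ht'
    have h1 : t < x := lt_of_le_of_ne ht'.2 ht
    have h2 : 0 ≤ (x - t) ^ (p - 1) := Real.rpow_nonneg (by linarith) _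
    rw [Real.norm_eq_abs, abs_mul, abs_of_nonneg h2, mul_comm]
    exact mul_le_mul_of_nonneg_right (hM t ⟨ht'.1, h1⟩) h2

lemma fracI_bound {p : ℝ} (hp : 0 < p) {c x M : ℝ} (hcx : c ≤ x) {f : ℝ → ℝ}
    (hM : ∀ s ∈ Set.Ioo c x, |f s| ≤ M) :
    |fracI p c f x| ≤ (1 / Real.Gamma p) * (M * ((x - c) ^ p / p)) := by
  have hG : 0 < 1 / Real.Gamma p := by have := Real.Gamma_pos_of_pos hp; positivity
  rw [fracI, abs_mul, abs_of_pos hG]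
  exact mul_le_mul_of_nonneg_left (integral_bound hp hcx hM) hG.le

lemma fracI_congr {p c x : ℝ} (hcx : c ≤ x) {f g : ℝ → ℝ}
    (h : ∀ s ∈ Set.Ioo c x, f s = g s) : fracI p c f x = fracI p c g x := by
  unfold fracI
  congr 1
  rw [intervalIntegral.integral_of_le hcx, intervalIntegral.integral_of_le hcx,
    integral_Ioc_eq_integral_Ioo, integral_Ioc_eq_integral_Ioo]
  exact setIntegral_congr_fun measurableSet_Ioo fun s hs => by simp only [h s hs]

lemma beta_int {p q r x : ℝ} (hp : 0 < p) (hq : 0 < q) (hrx : r < x) :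
    ∫ s in r..x, (x - s) ^ (p - 1) * (s - r) ^ (q - 1)
      = (x - r) ^ (p + q - 1) * (Real.Gamma p * Real.Gamma q / Real.Gamma (p + q)) := by
  have hc := Complex.betaIntegral_scaled (q : ℂ) (p : ℂ) (a := x - r) (by linarith)
  rw [Complex.betaIntegral_eq_Gamma_mul_div _ _ (by simpa) (by simpa)] at hc
  have h1 : ∫ s in r..x, (x - s) ^ (p - 1) * (s - r) ^ (q - 1)
      = ∫ s in (0:ℝ)..(x - r), s ^ (q - 1) * ((x - r) - s) ^ (p - 1) := by
    have := intervalIntegral.integral_comp_sub_right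
      (fun s => s ^ (q - 1) * ((x - r) - s) ^ (p - 1)) r (a := r) (b := x)
    rw [sub_self] at this
    rw [← this]
    congr 1; ext s
    rw [mul_comm]; congr 2; ring
  rw [h1]
  have h2 : ((∫ s in (0:ℝ)..(x - r), s ^ (q - 1) * ((x - r) - s) ^ (p - 1) : ℝ) : ℂ)
     = ∫ s in (0:ℝ)..(x - r), (s : ℂ) ^ ((q:ℂ) - 1) * (((x - r : ℝ) : ℂ) - s) ^ ((p:ℂ) - 1) := by
    rw [← intervalIntegral.integral_ofReal]
    apply intervalIntegral.integral_congr
    intro s hs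
    rw [Set.uIcc_of_le (by linarith)] at hs
    simp only
    push_cast
    rw [Complex.ofReal_cpow hs.1, Complex.ofReal_cpow (by linarith [hs.2])]
    push_cast
    rfl
  apply Complex.ofReal_injective
  rw [h2, hc]
  push_cast
  rw [Complex.ofReal_cpow (by linarith), ← Complex.Gamma_ofReal, ← Complex.Gamma_ofReal,
    ← Complex.Gamma_ofReal]
  push_cast
  rw [add_comm (q:ℂ) p, mul_comm (Complex.Gamma q)]

lemma semigroup_int {p q : ℝ} (hp : 0 < p) (hq : 0 < q) {c x : ℝ} (hcx : c ≤ x) {f : ℝ → ℝ}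
    (hf : Continuous f) :
    ∫ s in c..x, (x - s) ^ (p - 1) * ∫ r in c..s, (s - r) ^ (q - 1) * f r
      = (Real.Gamma p * Real.Gamma q / Real.Gamma (p + q)) *
        ∫ r in c..x, (x - r) ^ (p + q - 1) * f r := by
  classical
  set μ : Measure ℝ := volume.restrict (Set.Ioc c x) with hμ
  let K : ℝ → ℝ → ℝ := fun s r =>
    if r < s then (x - s) ^ (p - 1) * ((s - r) ^ (q - 1) * f r) else 0
  obtain ⟨M, hM⟩ := (isCompact_Icc (a := c) (b := x)).exists_bound_of_continuousOn hf.continuousOn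
  have hM0 : 0 ≤ M := (norm_nonneg _).trans (hM c ⟨le_rfl, hcx⟩)
  have hmeas : Measurable (Function.uncurry K) := by
    apply Measurable.ite
    · exact measurableSet_lt measurable_snd measurable_fst
    · have := hf.measurable
      fun_prop
    · fun_prop
  have hKs : ∀ s, (K s) = (Set.Iio s).indicator
      (fun r => (x - s) ^ (p - 1) * ((s - r) ^ (q - 1) * f r)) := by
    intro s; ext r; simp [K, Set.indicator]
  have hset : ∀ s ∈ Set.Ioc c x, Set.Iio s ∩ Set.Ioc c x = Set.Ioo c s := by
    intro s hs; ext r; simp only [Set.mem_inter_iff, Set.mem_Iio, Set.mem_Ioc, Set.mem_Ioo]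
    constructor
    · rintro ⟨h1, h2, h3⟩; exact ⟨h2, h1⟩
    · rintro ⟨h1, h2⟩; exact ⟨h2, h1, h2.le.trans hs.2⟩
  have hint : Integrable (Function.uncurry K) (μ.prod μ) := by
    rw [integrable_prod_iff hmeas.aestronglyMeasurable]
    constructor
    · rw [hμ]
      filter_upwards [ae_restrict_mem measurableSet_Ioc] with s hs
      simp only [Function.uncurry]
      rw [show (fun y => K s y) = K s from rfl, hKs, integrable_indicator_iff measurableSet_Iio,
        IntegrableOn, Measure.restrict_restrict measurableSet_Iio, hset s hs]
      have := ((kerf_int hq (c := c) (x := s) hf).const_mul ((x - s) ^ (p - 1))).1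
      exact this.mono_set Set.Ioo_subset_Ioc_self
    · have hb : Integrable (fun s => (x - s) ^ (p - 1) * (M * ((x - c) ^ q / q))) μ :=
        ((ker_int hp c x).1).mul_const _
      refine hb.mono' (hmeas.aestronglyMeasurable.norm.integral_prod_right') ?_
      rw [hμ]
      filter_upwards [ae_restrict_mem measurableSet_Ioc] with s hs
      have hxs : 0 ≤ (x - s) ^ (p - 1) := Real.rpow_nonneg (by linarith [hs.2]) _
      rw [Real.norm_of_nonneg (integral_nonneg fun _ => norm_nonneg _)]
      simp only [Function.uncurry]
      simp_rw [hKs, Set.indicator, ]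
      have e1 : ∫ y in Set.Ioc c x, ‖if y ∈ Set.Iio s then
          (x - s) ^ (p - 1) * ((s - y) ^ (q - 1) * f y) else 0‖ =
          ∫ y in Set.Ioo c s, (x - s) ^ (p - 1) * ((s - y) ^ (q - 1) * |f y|) := by
        rw [← hset s hs, ← Measure.restrict_restrict measurableSet_Iio,
          ← integral_indicator measurableSet_Iio]
        apply integral_congr_ae
        filter_upwards with y
        by_cases hy : y < s
        · have : 0 ≤ (s - y) ^ (q - 1) := Real.rpow_nonneg (by linarith) _
          simp [Set.indicator, hy, abs_of_nonneg this, abs_of_nonneg hxs]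
        · simp [Set.indicator, hy]
      rw [e1, integral_const_mul]
      refine mul_le_mul_of_nonneg_left ?_ hxs
      rw [← integral_Ioc_eq_integral_Ioo, ← intervalIntegral.integral_of_le hs.1.le]
      refine (le_abs_self _).trans ((integral_bound hq hs.1.le (M := M) ?_).trans ?_)
      · intro y hy
        rw [abs_abs]
        exact hM y ⟨hy.1.le, hy.2.le.trans hs.2⟩
      · have : (s - c) ^ q ≤ (x - c) ^ q :=
          Real.rpow_le_rpow (by linarith [hs.1]) (by linarith [hs.2]) hq.le
        gcongr
  have hswap := integral_integral_swap hint
  have hL : ∫ s, ∫ r, K s r ∂μ ∂μ =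
      ∫ s in c..x, (x - s) ^ (p - 1) * ∫ r in c..s, (s - r) ^ (q - 1) * f r := by
    rw [intervalIntegral.integral_of_le hcx]
    refine setIntegral_congr_fun measurableSet_Ioc fun s hs => ?_
    rw [show (fun y => K s y) = K s from rfl, hKs, integral_indicator measurableSet_Iio, hμ,
        Measure.restrict_restrict measurableSet_Iio, hset s hs, integral_const_mul,
        intervalIntegral.integral_of_le hs.1.le, integral_Ioc_eq_integral_Ioo]
  have hR : ∫ r, ∫ s, K s r ∂μ ∂μ = (Real.Gamma p * Real.Gamma q / Real.Gamma (p + q)) *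
        ∫ r in c..x, (x - r) ^ (p + q - 1) * f r := by
    rw [← intervalIntegral.integral_const_mul, intervalIntegral.integral_of_le hcx,
      integral_Ioc_eq_integral_Ioo, hμ, integral_Ioc_eq_integral_Ioo]
    refine setIntegral_congr_fun measurableSet_Ioo fun r hr => ?_
    have e1 : (fun s => K s r) = (Set.Ioi r).indicator
        (fun s => ((x - s) ^ (p - 1) * (s - r) ^ (q - 1)) * f r) := by
      ext s; simp [K, Set.indicator, mul_assoc]
    have e2 : Set.Ioi r ∩ Set.Ioc c x = Set.Ioc r x := by
      ext s; simp only [Set.mem_inter_iff, Set.mem_Ioi, Set.mem_Ioc]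
      constructor
      · rintro ⟨h1, h2, h3⟩; exact ⟨h1, h3⟩
      · rintro ⟨h1, h2⟩; exact ⟨h1, hr.1.trans h1, h2⟩
    rw [e1, integral_indicator measurableSet_Ioi, Measure.restrict_restrict measurableSet_Ioi, e2,
      integral_mul_const, ← intervalIntegral.integral_of_le hr.2.le, beta_int hp hq hr.2]
    ring
  rw [← hL, hswap, hR]

lemma fracI_semigroup {p q : ℝ} (hp : 0 < p) (hq : 0 < q) {c x : ℝ} (hcx : c ≤ x) {f : ℝ → ℝ}
    (hf : Continuous f) : fracI p c (fracI q c f) x = fracI (p + q) c f x := by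
  have h1 := (Real.Gamma_pos_of_pos hp).ne'
  have h2 := (Real.Gamma_pos_of_pos hq).ne'
  have h3 := (Real.Gamma_pos_of_pos (add_pos hp hq)).ne'
  have h := semigroup_int hp hq hcx hf
  unfold fracI
  have e : ∀ s, (x - s) ^ (p - 1) * (1 / Real.Gamma q * ∫ r in c..s, (s - r) ^ (q - 1) * f r)
    = (1 / Real.Gamma q) * ((x - s) ^ (p - 1) * ∫ r in c..s, (s - r) ^ (q - 1) * f r) := by
    intro s; ring
  simp_rw [e]
  rw [intervalIntegral.integral_const_mul, h]
  field_simp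

lemma fracI_comm {p q : ℝ} (hp : 0 < p) (hq : 0 < q) {c d x t M : ℝ} (hcx : c ≤ x) (hdt : d ≤ t)
    {G : ℝ → ℝ → ℝ} (hG : Continuous (Function.uncurry G)) (hM : ∀ x t, |G x t| ≤ M) :
    fracI p d (fun τ => fracI q c (fun y => G y τ) x) t
      = fracI q c (fun y => fracI p d (fun τ => G y τ) t) x := by
  have hint : Integrable (Function.uncurry fun τ y =>
      ((t - τ) ^ (p - 1) * (x - y) ^ (q - 1)) * G y τ)
      ((volume.restrict (Set.Ioc d t)).prod (volume.restrict (Set.Ioc c x))) := by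
    have h1 := ((ker_int hp d t).1).mul_prod ((ker_int hq c x).1)
    refine h1.mul_bdd (c := M) ?_ ?_
    · exact (hG.comp continuous_swap).aestronglyMeasurable
    · exact ae_of_all _ fun z => hM _ _
  have hswap := integral_integral_swap hint
  unfold fracI
  have e1 : ∀ τ, (t - τ) ^ (p - 1) * (1 / Real.Gamma q * ∫ y in c..x, (x - y) ^ (q - 1) * G y τ)
      = (1 / Real.Gamma q) * ∫ y in Set.Ioc c x, ((t - τ) ^ (p - 1) * (x - y) ^ (q - 1)) * G y τ := by
    intro τ
    rw [intervalIntegral.integral_of_le hcx]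
    simp_rw [mul_assoc]
    rw [integral_const_mul]
    ring
  have e2 : ∀ y, (x - y) ^ (q - 1) * (1 / Real.Gamma p * ∫ τ in d..t, (t - τ) ^ (p - 1) * G y τ)
      = (1 / Real.Gamma p) * ∫ τ in Set.Ioc d t, ((t - τ) ^ (p - 1) * (x - y) ^ (q - 1)) * G y τ := by
    intro y
    rw [intervalIntegral.integral_of_le hdt]
    simp_rw [mul_comm ((t - _) ^ (p - 1)) ((x - y) ^ (q - 1)), mul_assoc]
    rw [integral_const_mul]
    ring
  simp_rw [e1, e2]
  rw [intervalIntegral.integral_of_le hcx, intervalIntegral.integral_of_le hdt,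
    integral_const_mul, integral_const_mul, hswap]
  ring

lemma fracI_bound_pow {β a b x K : ℝ} (hβ : 1 ≤ β) (hax : a ≤ x) (hxb : x ≤ b) (n : ℕ)
    {f : ℝ → ℝ} (hf : ∀ y ∈ Set.Ioo a x, |f y| ≤ K * ((y - a) ^ n / n.factorial)) :
    |fracI β a f x| ≤ (1 / Real.Gamma β * (b - a) ^ (β - 1)) * K *
      ((x - a) ^ (n + 1) / (n + 1).factorial) := by
  have hG : 0 < 1 / Real.Gamma β := by
    have := Real.Gamma_pos_of_pos (show 0 < β by linarith); positivity
  have hC : 0 ≤ (b - a) ^ (β - 1) := Real.rpow_nonneg (by linarith) _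
  rw [fracI, abs_mul, abs_of_pos hG, mul_assoc, mul_assoc]
  refine mul_le_mul_of_nonneg_left ?_ hG.le
  have h := intervalIntegral.norm_integral_le_of_norm_le (μ := volume)
    (f := fun s => (x - s) ^ (β - 1) * f s)
    (g := fun s => (b - a) ^ (β - 1) * (K * ((s - a) ^ n / n.factorial))) hax ?_
    (Continuous.intervalIntegrable (by fun_prop) _ _)
  · refine h.trans (le_of_eq ?_)
    rw [intervalIntegral.integral_const_mul, intervalIntegral.integral_const_mul,
      intervalIntegral.integral_div, intervalIntegral.integral_comp_sub_right (fun s => s ^ n),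
      integral_pow]
    rw [Nat.factorial_succ]
    push_cast
    have : (n.factorial : ℝ) ≠ 0 := by positivity
    have : (n + 1 : ℝ) ≠ 0 := by positivity
    simp
    left; left
    field_simp
  · have : ∀ᵐ t : ℝ, t ≠ x := by simp [ae_iff]
    filter_upwards [this] with t ht ht'
    have h1 : t < x := lt_of_le_of_ne ht'.2 ht
    have h2 : 0 ≤ (x - t) ^ (β - 1) := Real.rpow_nonneg (by linarith) _
    have h3 : (x - t) ^ (β - 1) ≤ (b - a) ^ (β - 1) :=
      Real.rpow_le_rpow (by linarith) (by linarith [ht'.1]) (by linarith)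
    rw [Real.norm_eq_abs, abs_mul, abs_of_nonneg h2]
    exact mul_le_mul h3 (hf t ⟨ht'.1, h1⟩) (abs_nonneg _) hC

lemma fracI_const_mul (p c k : ℝ) (f : ℝ → ℝ) (x : ℝ) :
    fracI p c (fun s => k * f s) x = k * fracI p c f x := by
  unfold fracI
  simp_rw [mul_left_comm _ k]
  rw [intervalIntegral.integral_const_mul]
  ring

lemma iter_bound {α β ν a b T M : ℝ} (hα : 0 < α) (hβ : 1 < β) (hν : 0 < ν)
    {G : ℝ → ℝ → ℝ} (hG : Continuous (Function.uncurry G)) (hM : ∀ x t, |G x t| ≤ M)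
    (h : ∀ x ∈ Set.Ioo a b, ∀ t ∈ Set.Ioo 0 T,
      fracI β a (fun y => G y t) x = ν * fracI α 0 (G x) t) (n : ℕ) :
    ∀ x ∈ Set.Ioo a b, ∀ t ∈ Set.Ioo 0 T, |fracI ((n + 1 : ℕ) * α) 0 (G x) t| ≤
      ((ν⁻¹ * (1 / Real.Gamma β * (b - a) ^ (β - 1))) ^ (n + 1) * M) *
        ((x - a) ^ (n + 1) / (n + 1).factorial) := by
  have hM0 : 0 ≤ M := (abs_nonneg _).trans (hM 0 0)
  have hΓ := Real.Gamma_pos_of_pos (show 0 < β by linarith)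
  induction n with
  | zero =>
    intro x hx t ht
    have hC : 0 ≤ (b - a) ^ (β - 1) := Real.rpow_nonneg (by linarith [hx.1, hx.2]) _
    have e : fracI ((0 + 1 : ℕ) * α) 0 (G x) t = ν⁻¹ * fracI β a (fun y => G y t) x := by
      rw [h x hx t ht]
      field_simp
      simp
    rw [e, abs_mul, abs_of_pos (inv_pos.2 hν)]
    have := fracI_bound_pow (b := b) (f := fun y => G y t) hβ.le hx.1.le hx.2.le (K := M) 0
      (fun y hy => by simpa using hM y t)
    calc _ ≤ ν⁻¹ * _ := mul_le_mul_of_nonneg_left this (inv_pos.2 hν).le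
      _ = _ := by ring
  | succ n ih =>
    intro x hx t ht
    have hC : 0 ≤ (b - a) ^ (β - 1) := Real.rpow_nonneg (by linarith [hx.1, hx.2]) _
    have hn : 0 < ((n + 1 : ℕ) : ℝ) * α := by positivity
    have hGx : Continuous (G x) := hG.comp (by fun_prop : Continuous fun t : ℝ => (x, t))
    have e : fracI ((n + 1 + 1 : ℕ) * α) 0 (G x) t
        = ν⁻¹ * fracI β a (fun y => fracI ((n + 1 : ℕ) * α) 0 (G y) t) x := by
      rw [show ((n + 1 + 1 : ℕ) : ℝ) * α = (n + 1 : ℕ) * α + α by push_cast; ring,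
        ← fracI_semigroup hn hα ht.1.le hGx,
        fracI_congr (g := fun τ => ν⁻¹ * fracI β a (fun y => G y τ) x) ht.1.le,
        fracI_const_mul, fracI_comm hn (by linarith) hx.1.le ht.1.le hG hM]
      intro τ hτ
      rw [h x hx τ ⟨hτ.1, hτ.2.trans ht.2⟩]
      field_simp
    rw [e, abs_mul, abs_of_pos (inv_pos.2 hν)]
    have := fracI_bound_pow (b := b) (f := fun y => fracI ((n + 1 : ℕ) * α) 0 (G y) t)
      hβ.le hx.1.le hx.2.le
      (K := (ν⁻¹ * (1 / Real.Gamma β * (b - a) ^ (β - 1))) ^ (n + 1) * M) (n + 1)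
      (fun y hy => ih y ⟨hy.1, hy.2.trans hx.2⟩ t ht)
    calc _ ≤ ν⁻¹ * _ := mul_le_mul_of_nonneg_left this (inv_pos.2 hν).le
      _ = _ := by ring

lemma gamma_est {α E ε : ℝ} (hα : 0 < α) (hα1 : α < 1) (hE : 0 ≤ E) (hε : 0 < ε) :
    ∃ K, 0 ≤ K ∧ ∀ n : ℕ, 1 ≤ n →
      Real.Gamma (n * α) * (E ^ n / n.factorial) ≤ K * ε ^ n := by
  set Q : ℝ := (E / ε) ^ (1 / (1 - α)) with hQ
  have hQ0 : 0 ≤ Q := by positivity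
  refine ⟨1 / α * (Real.exp Q) ^ (1 - α), by positivity, fun n hn => ?_⟩
  have hn' : (1 : ℝ) ≤ n := by exact_mod_cast hn
  have hnα : (0:ℝ) < n * α := by positivity
  have hf : (0:ℝ) < n.factorial := by positivity
  have h1 : Real.Gamma (n * α + 1) ≤ (n.factorial : ℝ) ^ α := by
    have := Real.Gamma_mul_add_mul_le_rpow_Gamma_mul_rpow_Gamma (s := (n:ℝ) + 1) (t := 1)
      (a := α) (b := 1 - α) (by positivity) one_pos hα (by linarith) (by ring)
    simp only [Real.Gamma_one, Real.one_rpow, mul_one, Real.Gamma_nat_eq_factorial] at this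
    convert this using 2
    ring
  rw [Real.Gamma_add_one hnα.ne'] at h1
  have hΓ := Real.Gamma_pos_of_pos hnα
  have h2 : α * Real.Gamma (n * α) ≤ (n.factorial : ℝ) ^ α := by
    refine le_trans ?_ h1
    nlinarith [mul_pos hα hΓ]
  have h3 : (E / ε) ^ n ≤ (Real.exp Q) ^ (1 - α) * (n.factorial : ℝ) ^ (1 - α) := by
    have h := Real.pow_div_factorial_le_exp Q hQ0 n
    rw [div_le_iff₀ hf] at h
    have h' := Real.rpow_le_rpow (by positivity) h (show 0 ≤ 1 - α by linarith)
    rw [Real.mul_rpow (by positivity) hf.le] at h'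
    refine le_trans (le_of_eq ?_) h'
    rw [hQ, ← Real.rpow_natCast, ← Real.rpow_natCast, ← Real.rpow_mul (by positivity),
      ← Real.rpow_mul (by positivity)]
    congr 1
    have : 1 - α ≠ 0 := by linarith
    field_simp
  have h4 : (n.factorial : ℝ) ^ (1 - α) * (n.factorial : ℝ) ^ α = n.factorial := by
    rw [← Real.rpow_add hf]; simp
  have h5 : E ^ n = (E / ε) ^ n * ε ^ n := by
    rw [← mul_pow]; congr 1; field_simp
  have h2' : Real.Gamma (n * α) ≤ 1 / α * (n.factorial : ℝ) ^ α := by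
    rw [one_div, ← div_eq_inv_mul, le_div_iff₀ hα]; linarith
  calc Real.Gamma (n * α) * (E ^ n / n.factorial)
      ≤ (1 / α * (n.factorial : ℝ) ^ α) *
        (((Real.exp Q) ^ (1 - α) * (n.factorial : ℝ) ^ (1 - α)) * ε ^ n / n.factorial) := by
        rw [h5]; gcongr
    _ = 1 / α * (Real.exp Q) ^ (1 - α) * ε ^ n *
        (((n.factorial : ℝ) ^ (1 - α) * (n.factorial : ℝ) ^ α) / n.factorial) := by ring
    _ = _ := by rw [h4, div_self hf.ne', mul_one]

lemma one_sub_exp_hasSum (z : ℝ) :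
    HasSum (fun k : ℕ => (-1) ^ k * z ^ (k + 1) / (k + 1).factorial) (1 - Real.exp (-z)) := by
  have h : HasSum (fun n : ℕ => (-z) ^ n / n.factorial) (Real.exp (-z)) := by
    have := NormedSpace.expSeries_div_hasSum_exp (𝔸 := ℝ) (-z)
    rwa [← Real.exp_eq_exp_ℝ] at this
  have h2 := ((hasSum_nat_add_iff' 1).2 h).neg
  simp only [Finset.range_one, Finset.sum_singleton, pow_zero, Nat.factorial_zero, Nat.cast_one,
    div_one, neg_sub] at h2
  have e : (fun k : ℕ => (-1) ^ k * z ^ (k + 1) / ((k + 1).factorial : ℝ))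
      = fun k : ℕ => -((-z) ^ (k + 1) / ((k + 1).factorial : ℝ)) := by
    funext k
    rw [neg_pow z (k + 1)]
    ring
  rw [e]
  exact h2

lemma moment_step {α t c K H : ℝ} (hα : 0 < α) (hc : 0 < c) (hct : c < t) (hK : 0 ≤ K)
    {h : ℝ → ℝ} (hh : Continuous h) (hH : ∀ s, |h s| ≤ H)
    (hm : ∀ n : ℕ, 1 ≤ n → |∫ s in (0:ℝ)..t, s ^ (n * α - 1) * h s| ≤ K * (c ^ α / 2) ^ n)
    {N : ℕ} (hN : 1 ≤ N * α) :
    |∫ s in (0:ℝ)..t, s⁻¹ * (1 - Real.exp (-(((s / c) ^ α) ^ N))) * h s|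
      ≤ K * Real.exp 1 * (1 / 2) ^ N := by
  have ht : 0 < t := hc.trans hct
  have hH0 : 0 ≤ H := (abs_nonneg _).trans (hH 0)
  have hN1 : 1 ≤ N := by
    rcases Nat.eq_zero_or_pos N with h0 | h0
    · subst h0; norm_num at hN
    · exact h0
  have key : ∀ (s : ℝ), 0 < s → ∀ n : ℕ, s⁻¹ * ((s / c) ^ α) ^ n
      = ((c ^ α) ^ n)⁻¹ * s ^ (n * α - 1) := by
    intro s hs n
    rw [Real.rpow_sub hs, Real.rpow_one, Real.div_rpow hs.le hc.le, div_pow, mul_comm (n:ℝ) α,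
      Real.rpow_mul hs.le, Real.rpow_natCast]
    field_simp
  let F : ℕ → ℝ → ℝ := fun k s =>
    s⁻¹ * ((-1) ^ k * (((s / c) ^ α) ^ N) ^ (k + 1) / (k + 1).factorial) * h s
  set B : ℝ := ((c ^ α) ^ N)⁻¹ * t ^ (N * α - 1) with hB
  have hB0 : 0 ≤ B := by positivity
  set Z : ℝ := ((t / c) ^ α) ^ N with hZ
  have hZ0 : 0 ≤ Z := by positivity
  have hsumZ : Summable fun k : ℕ => B * (Z ^ k / k.factorial) * H :=
    ((Real.summable_pow_div_factorial Z).mul_left B).mul_right H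
  have hFsum : HasSum (fun k => ∫ s in (0:ℝ)..t, F k s)
      (∫ s in (0:ℝ)..t, s⁻¹ * (1 - Real.exp (-(((s / c) ^ α) ^ N))) * h s) := by
    refine intervalIntegral.hasSum_integral_of_dominated_convergence
      (fun k _ => B * (Z ^ k / k.factorial) * H) ?_ ?_ ?_ ?_ ?_
    · intro k
      have := hh.measurable
      exact Measurable.aestronglyMeasurable (by fun_prop)
    · intro k
      refine ae_of_all _ fun s hs => ?_
      rw [Set.uIoc_of_le ht.le] at hs
      have hs0 := hs.1
      have hz : (0:ℝ) ≤ ((s / c) ^ α) ^ N := by positivity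
      simp only [F]
      rw [norm_mul]
      refine mul_le_mul ?_ (hH s) (norm_nonneg _) (by positivity)
      rw [Real.norm_eq_abs, abs_mul, abs_div, abs_mul, abs_pow, abs_neg, abs_one, one_pow, one_mul,
        abs_of_pos (inv_pos.2 hs0), abs_of_nonneg (pow_nonneg hz _), Nat.abs_cast, pow_succ]
      have h1 : s⁻¹ * ((s / c) ^ α) ^ N ≤ B := by
        rw [key s hs0, hB]
        have := Real.rpow_le_rpow hs0.le hs.2 (show 0 ≤ N * α - 1 by linarith)
        gcongr
      have h2 : ((s / c) ^ α) ^ N ≤ Z := by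
        rw [hZ]
        have h3 := hs.2
        have : (s / c) ^ α ≤ (t / c) ^ α :=
          Real.rpow_le_rpow (by positivity) (by gcongr) hα.le
        gcongr
      have h3 : (k.factorial : ℝ) ≤ (k + 1).factorial := by
        exact_mod_cast Nat.factorial_le (Nat.le_succ k)
      calc s⁻¹ * ((((s / c) ^ α) ^ N) ^ k * ((s / c) ^ α) ^ N / (k + 1).factorial)
          = (s⁻¹ * ((s / c) ^ α) ^ N) * ((((s / c) ^ α) ^ N) ^ k / (k + 1).factorial) := by ring
        _ ≤ B * (Z ^ k / k.factorial) := by gcongr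
    · exact ae_of_all _ fun s _ => hsumZ
    · exact intervalIntegrable_const
    · exact ae_of_all _ fun s _ => ((one_sub_exp_hasSum _).mul_left _).mul_right _
  have hterm : ∀ k, ‖∫ s in (0:ℝ)..t, F k s‖ ≤ K * (1 / 2) ^ N * (1 / k.factorial) := by
    intro k
    have e : ∫ s in (0:ℝ)..t, F k s = ((-1) ^ k / (k + 1).factorial *
        ((c ^ α) ^ (N * (k + 1)))⁻¹) *
        ∫ s in (0:ℝ)..t, s ^ ((N * (k + 1) : ℕ) * α - 1) * h s := by
      rw [← intervalIntegral.integral_const_mul, intervalIntegral.integral_of_le ht.le,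
        intervalIntegral.integral_of_le ht.le]
      refine setIntegral_congr_fun measurableSet_Ioc fun s hs => ?_
      simp only [F]
      have := key s hs.1 (N * (k + 1))
      rw [← pow_mul]
      calc _ = (-1) ^ k / ((k + 1).factorial : ℝ) * (s⁻¹ * ((s / c) ^ α) ^ (N * (k + 1))) * h s := by
            ring
        _ = _ := by rw [this]; ring
    have hcp : 0 < (c ^ α) ^ (N * (k + 1)) := by positivity
    rw [e, norm_mul, norm_mul, norm_div, norm_pow, norm_neg, norm_one, one_pow, norm_inv,
      Real.norm_of_nonneg hcp.le, Real.norm_natCast]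
    have h1 := hm (N * (k + 1)) (Nat.mul_pos hN1 (Nat.succ_pos k))
    have h3 : (k.factorial : ℝ) ≤ (k + 1).factorial := by
      exact_mod_cast Nat.factorial_le (Nat.le_succ k)
    have h4 : ((1:ℝ) / 2) ^ (N * (k + 1)) ≤ (1 / 2) ^ N :=
      pow_le_pow_of_le_one (by norm_num) (by norm_num) (Nat.le_mul_of_pos_right _ (Nat.succ_pos k))
    calc 1 / ((k + 1).factorial : ℝ) * ((c ^ α) ^ (N * (k + 1)))⁻¹ *
          ‖∫ s in (0:ℝ)..t, s ^ ((N * (k + 1) : ℕ) * α - 1) * h s‖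
        ≤ 1 / ((k + 1).factorial : ℝ) * ((c ^ α) ^ (N * (k + 1)))⁻¹ *
          (K * (c ^ α / 2) ^ (N * (k + 1))) := by
          exact mul_le_mul_of_nonneg_left h1 (by positivity)
      _ = 1 / ((k + 1).factorial : ℝ) * (K * (1 / 2) ^ (N * (k + 1))) := by
          rw [div_pow, one_div_pow]; field_simp
      _ ≤ 1 / (k.factorial : ℝ) * (K * (1 / 2) ^ N) := by gcongr
      _ = _ := by ring
  have hexp : HasSum (fun k : ℕ => K * (1 / 2) ^ N * (1 / (k.factorial : ℝ)))
      (K * (1 / 2) ^ N * Real.exp 1) := by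
    have := NormedSpace.expSeries_div_hasSum_exp (𝔸 := ℝ) 1
    rw [← Real.exp_eq_exp_ℝ] at this
    simpa using this.mul_left (K * (1 / 2) ^ N)
  rw [← hFsum.tsum_eq]
  refine (tsum_of_norm_bounded hexp hterm).trans (le_of_eq (by ring))

lemma moment_lim {α t c H : ℝ} (hα : 0 < α) (hc : 0 < c) (hct : c < t)
    {h : ℝ → ℝ} (hh : Continuous h) (hH : ∀ s, |h s| ≤ H) :
    Tendsto (fun N : ℕ => ∫ s in (0:ℝ)..t, s⁻¹ * (1 - Real.exp (-(((s / c) ^ α) ^ N))) * h s)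
      atTop (𝓝 (∫ s in c..t, s⁻¹ * h s)) := by
  have ht : 0 < t := hc.trans hct
  have hH0 : 0 ≤ H := (abs_nonneg _).trans (hH 0)
  have e : ∫ s in c..t, s⁻¹ * h s = ∫ s in (0:ℝ)..t, (Set.Ioi c).indicator (fun s => s⁻¹ * h s) s := by
    rw [intervalIntegral.integral_of_le ht.le, intervalIntegral.integral_of_le hct.le,
      integral_indicator measurableSet_Ioi, Measure.restrict_restrict measurableSet_Ioi]
    congr 2
    ext s; simp only [Set.mem_inter_iff, Set.mem_Ioi, Set.mem_Ioc]
    constructor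
    · rintro ⟨h1, h2⟩; exact ⟨h1, hc.trans h1, h2⟩
    · rintro ⟨h1, _, h3⟩; exact ⟨h1, h3⟩
  rw [e]
  refine intervalIntegral.tendsto_integral_filter_of_dominated_convergence (fun _ => c⁻¹ * H)
    ?_ ?_ ?_ ?_
  · refine Eventually.of_forall fun N => ?_
    have := hh.measurable
    exact Measurable.aestronglyMeasurable (by fun_prop)
  · have hev : ∀ᶠ N : ℕ in atTop, 1 ≤ N * α := by
      have : Tendsto (fun N : ℕ => (N : ℝ) * α) atTop atTop :=
        tendsto_natCast_atTop_atTop.atTop_mul_const hα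
      exact this.eventually_ge_atTop 1
    filter_upwards [hev] with N hN
    refine ae_of_all _ fun s hs => ?_
    rw [Set.uIoc_of_le ht.le] at hs
    have hs0 := hs.1
    have hz : (0:ℝ) ≤ ((s / c) ^ α) ^ N := by positivity
    have h0 : 0 ≤ 1 - Real.exp (-(((s / c) ^ α) ^ N)) := by
      have := Real.exp_le_one_iff.2 (neg_nonpos.2 hz); linarith
    rw [norm_mul, norm_mul, norm_inv, Real.norm_of_nonneg hs0.le, Real.norm_of_nonneg h0]
    refine mul_le_mul ?_ (hH s) (norm_nonneg _) (by positivity)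
    rcases le_total c s with hcs | hcs
    · have h1 : 1 - Real.exp (-(((s / c) ^ α) ^ N)) ≤ 1 := by linarith [Real.exp_pos (-(((s / c) ^ α) ^ N))]
      calc _ ≤ c⁻¹ * 1 := by gcongr
        _ = _ := mul_one _
    · have h1 : 1 - Real.exp (-(((s / c) ^ α) ^ N)) ≤ ((s / c) ^ α) ^ N := by
        linarith [Real.add_one_le_exp (-(((s / c) ^ α) ^ N))]
      have h2 : ((s / c) ^ α) ^ N ≤ s / c := by
        rw [← Real.rpow_natCast, ← Real.rpow_mul (by positivity)]
        calc (s / c) ^ (α * N) ≤ (s / c) ^ (1:ℝ) :=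
              Real.rpow_le_rpow_of_exponent_ge (by positivity) ((div_le_one hc).2 hcs) (by linarith)
          _ = _ := Real.rpow_one _
      calc _ ≤ s⁻¹ * (s / c) := by gcongr; exact h1.trans h2
        _ = c⁻¹ := by field_simp
  · exact intervalIntegrable_const
  · have : ∀ᵐ s : ℝ, s ≠ c := by simp [ae_iff]
    filter_upwards [this] with s hsc hs
    rw [Set.uIoc_of_le ht.le] at hs
    have hs0 := hs.1
    rcases lt_or_gt_of_ne hsc with hlt | hgt
    · have hy : (s / c) ^ α < 1 := Real.rpow_lt_one (by positivity) ((div_lt_one hc).2 hlt) hα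
      have h1 := tendsto_pow_atTop_nhds_zero_of_lt_one (by positivity) hy
      have h2 : Tendsto (fun N : ℕ => Real.exp (-(((s / c) ^ α) ^ N))) atTop (𝓝 (Real.exp (-0))) :=
        (Real.continuous_exp.tendsto _).comp h1.neg
      have h3 := ((h2.const_sub 1).const_mul s⁻¹).mul_const (h s)
      simpa [Set.indicator, not_lt.2 hlt.le] using h3
    · have hy : 1 < (s / c) ^ α := Real.one_lt_rpow ((one_lt_div hc).2 hgt) hα
      have h1 := tendsto_pow_atTop_atTop_of_one_lt hy
      have h2 : Tendsto (fun N : ℕ => Real.exp (-(((s / c) ^ α) ^ N))) atTop (𝓝 0) :=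
        Real.tendsto_exp_neg_atTop_nhds_zero.comp h1
      have h3 := ((h2.const_sub 1).const_mul s⁻¹).mul_const (h s)
      simpa [Set.indicator, hgt] using h3

lemma moment_zero {α t H : ℝ} (hα : 0 < α)
    {h : ℝ → ℝ} (hh : Continuous h) (hH : ∀ s, |h s| ≤ H)
    (hm : ∀ ε > 0, ∃ K, 0 ≤ K ∧ ∀ n : ℕ, 1 ≤ n →
      |∫ s in (0:ℝ)..t, s ^ (n * α - 1) * h s| ≤ K * ε ^ n) :
    ∀ c ∈ Set.Ioo 0 t, h c = 0 := by
  have hz : ∀ c ∈ Set.Ioo 0 t, ∫ s in c..t, s⁻¹ * h s = 0 := by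
    intro c hc
    have hc0 := hc.1
    obtain ⟨K, hK, hm⟩ := hm (c ^ α / 2) (by positivity)
    refine tendsto_nhds_unique (moment_lim hα hc.1 hc.2 hh hH) ?_
    have hev : ∀ᶠ N : ℕ in atTop, 1 ≤ N * α := by
      have : Tendsto (fun N : ℕ => (N : ℝ) * α) atTop atTop :=
        tendsto_natCast_atTop_atTop.atTop_mul_const hα
      exact this.eventually_ge_atTop 1
    refine squeeze_zero_norm' (a := fun N : ℕ => K * Real.exp 1 * (1 / 2) ^ N) ?_ ?_
    · filter_upwards [hev] with N hN
      exact moment_step hα hc.1 hc.2 hK hh hH hm hN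
    · have := (tendsto_pow_atTop_nhds_zero_of_lt_one (r := (1:ℝ) / 2) (by norm_num)
        (by norm_num)).const_mul (K * Real.exp 1)
      simpa using this
  intro c hc
  have hc0 := hc.1
  have hcont : ∀ x ∈ Set.Icc c t, ContinuousAt (fun s => s⁻¹ * h s) x := fun x hx =>
    (continuousAt_inv₀ (hc0.trans_le hx.1).ne').mul hh.continuousAt
  have hii : IntervalIntegrable (fun s => s⁻¹ * h s) volume c t := by
    apply ContinuousOn.intervalIntegrable
    rw [Set.uIcc_of_le hc.2.le]
    exact fun x hx => (hcont x hx).continuousWithinAt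
  have hd := intervalIntegral.integral_hasDerivAt_left hii
    (Measurable.stronglyMeasurable (by have := hh.measurable; fun_prop)).stronglyMeasurableAtFilter
    (hcont c ⟨le_rfl, hc.2.le⟩)
  have hd0 : HasDerivAt (fun u => ∫ s in u..t, s⁻¹ * h s) 0 c := by
    refine (hasDerivAt_const c (0:ℝ)).congr_of_eventuallyEq ?_
    filter_upwards [isOpen_Ioo.mem_nhds hc] with u hu
    exact hz u hu
  have := hd.unique hd0
  have h2 : c⁻¹ * h c = 0 := by linarith
  rcases mul_eq_zero.1 h2 with h3 | h3
  · exact absurd (inv_eq_zero.1 h3) hc0.ne'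
  · exact h3

theorem core {α β ν a b T M : ℝ} (hα : 0 < α) (hα1 : α < 1) (hβ : 1 < β) (hν : 0 < ν)
    {G : ℝ → ℝ → ℝ} (hG : Continuous (Function.uncurry G)) (hM : ∀ x t, |G x t| ≤ M)
    (h : ∀ x ∈ Set.Ioo a b, ∀ t ∈ Set.Ioo 0 T,
      fracI β a (fun y => G y t) x = ν * fracI α 0 (G x) t) :
    ∀ x ∈ Set.Ioo a b, ∀ t ∈ Set.Ioo 0 T, G x t = 0 := by
  intro x hx t ht
  have hM0 : 0 ≤ M := (abs_nonneg _).trans (hM 0 0)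
  have hΓ := Real.Gamma_pos_of_pos (show 0 < β by linarith)
  have hba : 0 < b - a := by linarith [hx.1, hx.2]
  have hGx : Continuous (G x) := hG.comp (by fun_prop : Continuous fun t : ℝ => (x, t))
  obtain ⟨t', h1, h2⟩ := exists_between ht.2
  have ht0 := ht.1
  set D := ν⁻¹ * (1 / Real.Gamma β * (b - a) ^ (β - 1)) with hD
  have hD0 : 0 ≤ D := by positivity
  have hxa : 0 ≤ x - a := by linarith [hx.1]
  have := moment_zero (t := t') hα (h := fun s => G x (t' - s)) (H := M) (by fun_prop)
    (fun s => hM _ _) ?_ (t' - t) ⟨by linarith, by linarith⟩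
  · simpa using this
  intro ε hε
  obtain ⟨K, hK, hKn⟩ := gamma_est hα hα1 (show 0 ≤ D * (x - a) by positivity) hε
  refine ⟨M * K, by positivity, fun n hn => ?_⟩
  obtain ⟨m, rfl⟩ : ∃ m, n = m + 1 := ⟨n - 1, by omega⟩
  have hb := iter_bound hα hβ hν hG hM h m x hx t' ⟨by linarith, h2⟩
  have hΓ' := Real.Gamma_pos_of_pos (show 0 < ((m + 1 : ℕ) : ℝ) * α by positivity)
  have e : ∫ s in (0:ℝ)..t', s ^ ((m + 1 : ℕ) * α - 1) * G x (t' - s)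
      = Real.Gamma ((m + 1 : ℕ) * α) * fracI ((m + 1 : ℕ) * α) 0 (G x) t' := by
    have := intervalIntegral.integral_comp_sub_left
      (fun s => s ^ (((m + 1 : ℕ) : ℝ) * α - 1) * G x (t' - s)) t' (a := 0) (b := t')
    simp only [sub_sub_cancel, sub_self, sub_zero] at this
    rw [← this, fracI]
    field_simp
  rw [← hD] at hb
  rw [e, abs_mul, abs_of_pos hΓ']
  calc _ ≤ _ := mul_le_mul_of_nonneg_left hb hΓ'.le
    _ = M * (Real.Gamma ((m + 1 : ℕ) * α) * ((D * (x - a)) ^ (m + 1) / (m + 1).factorial)) := by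
      rw [mul_pow D]; ring
    _ ≤ M * (K * ε ^ (m + 1)) := mul_le_mul_of_nonneg_left (hKn _ hn) hM0
    _ = _ := by ring

lemma fracI_zero_base (p c : ℝ) (f : ℝ → ℝ) : fracI p c f c = 0 := by
  simp [fracI]

lemma fracI_one (c : ℝ) (f : ℝ → ℝ) (x : ℝ) : fracI 1 c f x = ∫ s in c..x, f s := by
  simp [fracI]

lemma fracI_cont_base {p : ℝ} (hp : 0 < p) {c d M : ℝ} {f : ℝ → ℝ}
    (hM : ∀ s ∈ Set.Icc c d, |f s| ≤ M) : ContinuousWithinAt (fracI p c f) (Set.Icc c d) c := by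
  rw [ContinuousWithinAt, fracI_zero_base]
  refine squeeze_zero_norm' (a := fun x => (1 / Real.Gamma p) * (M * ((x - c) ^ p / p))) ?_ ?_
  · filter_upwards [self_mem_nhdsWithin] with x hx
    exact fracI_bound hp hx.1 fun s hs => hM s ⟨hs.1.le, hs.2.le.trans hx.2⟩
  · have h1 : Continuous fun x : ℝ => (1 / Real.Gamma p) * (M * ((x - c) ^ p / p)) := by
      have : Continuous fun x : ℝ => (x - c) ^ p :=
        (continuous_id.sub continuous_const).rpow_const fun _ => Or.inr hp.le
      fun_prop
    have h2 := (h1.tendsto c).mono_left (nhdsWithin_le_nhds (s := Set.Icc c d))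
    simpa [Real.zero_rpow hp.ne'] using h2

lemma fracI_sub {p : ℝ} (hp : 0 < p) {c x : ℝ} {f g : ℝ → ℝ} (hf : Continuous f)
    (hg : Continuous g) : fracI p c (fun s => f s - g s) x = fracI p c f x - fracI p c g x := by
  unfold fracI
  simp_rw [mul_sub]
  rw [intervalIntegral.integral_sub (kerf_int hp hf) (kerf_int hp hg)]
  ring

lemma caputo_eq (γ a : ℝ) (f : ℝ → ℝ) (x : ℝ) : caputo γ a f x = fracI (1 - γ) a (deriv f) x := by
  unfold caputo fracI
  rw [show 1 - γ - 1 = -γ by ring]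

lemma seqCaputoAux_eq (α β a : ℝ) (f : ℝ → ℝ) (x : ℝ) :
    seqCaputoAux α β a f x = fracI (1 - α) a (caputo β a f) x := by
  unfold seqCaputoAux fracI
  rw [show 1 - α - 1 = -α by ring]

lemma rlAux_eq (α : ℝ) (f : ℝ → ℝ) (x : ℝ) :
    rlAux (1 - α) f x = fracI α 0 f x := by
  unfold rlAux fracI
  rw [show 1 - (1 - α) = α by ring, show -(1 - α) = α - 1 by ring]

lemma space_rep {β₁ β₂ a b : ℝ} (hβ₁ : 0 < β₁ ∧ β₁ < 1) (hβ₂ : 0 < β₂ ∧ β₂ < 1)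
    (hsum : 1 < β₁ + β₂) (hab : a < b) {f g : ℝ → ℝ}
    (hf : ∀ x ∈ Set.Icc a b, HasDerivAt f (deriv f x) x)
    (hf' : ContinuousOn (deriv f) (Set.Icc a b))
    (hD : ∀ x ∈ Set.Ioo a b, HasDerivAt (seqCaputoAux β₁ β₂ a f) (g x) x)
    (hg : Continuous g) {x : ℝ} (hx : x ∈ Set.Ioo a b) :
    fracI (β₁ + β₂) a g x = f x - f a := by
  set D : ℝ → ℝ := fun y => deriv f (Set.projIcc a b hab.le y) with hDdef
  have hDc : Continuous D := hf'.comp_continuous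
    (continuous_subtype_val.comp continuous_projIcc) fun y => (Set.projIcc a b hab.le y).2
  have hDe : ∀ y ∈ Set.Icc a b, D y = deriv f y := fun y hy => by
    simp [hDdef, Set.projIcc_of_mem hab.le hy]
  have hp : 0 < (1 - β₁) + (1 - β₂) := by linarith [hβ₁.2, hβ₂.2]
  have hJ : ∀ y ∈ Set.Icc a b,
      seqCaputoAux β₁ β₂ a f y = fracI ((1 - β₁) + (1 - β₂)) a D y := by
    intro y hy
    rw [seqCaputoAux_eq, ← fracI_semigroup (by linarith [hβ₁.2]) (by linarith [hβ₂.2]) hy.1 hDc]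
    refine fracI_congr hy.1 fun s hs => ?_
    rw [caputo_eq]
    refine fracI_congr hs.1.le fun r hr => (hDe r ⟨hr.1.le, ?_⟩).symm
    exact hr.2.le.trans (hs.2.le.trans hy.2)
  obtain ⟨M, hM⟩ := (isCompact_Icc (a := a) (b := b)).exists_bound_of_continuousOn hDc.continuousOn
  have hI : ∀ y ∈ Set.Ioo a b, fracI 1 a g y = fracI ((1 - β₁) + (1 - β₂)) a D y := by
    intro y hy
    have hc : ContinuousOn (seqCaputoAux β₁ β₂ a f) (Set.Icc a y) := by
      intro z hz
      rcases eq_or_lt_of_le hz.1 with h | h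
      · subst h
        have h1 := (fracI_cont_base hp hM).mono (Set.Icc_subset_Icc_right hy.2.le)
        refine h1.congr (fun w hw => hJ w ⟨hw.1, hw.2.trans hy.2.le⟩) (hJ _ ⟨le_rfl, hab.le⟩)
      · exact (hD z ⟨h, hz.2.trans_lt hy.2⟩).continuousAt.continuousWithinAt
    have := intervalIntegral.integral_eq_sub_of_hasDerivAt_of_le hy.1.le hc
      (fun z hz => hD z ⟨hz.1, hz.2.trans hy.2⟩) (hg.intervalIntegrable _ _)
    rw [fracI_one, this, hJ y ⟨hy.1.le, hy.2.le⟩, hJ a ⟨le_rfl, hab.le⟩, fracI_zero_base, sub_zero]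
  have hq : 0 < β₁ + β₂ - 1 := by linarith
  have h1 : fracI 1 a D x = f x - f a := by
    rw [fracI_one]
    have := intervalIntegral.integral_eq_sub_of_hasDerivAt (f := f) (f' := D) (a := a) (b := x)
      (fun z hz => by
        rw [Set.uIcc_of_le hx.1.le] at hz
        have hz' : z ∈ Set.Icc a b := ⟨hz.1, hz.2.trans hx.2.le⟩
        rw [hDe z hz']; exact hf z hz') (hDc.intervalIntegrable _ _)
    exact this
  calc fracI (β₁ + β₂) a g x = fracI ((β₁ + β₂ - 1) + 1) a g x := by rw [sub_add_cancel]
    _ = fracI (β₁ + β₂ - 1) a (fracI 1 a g) x := (fracI_semigroup hq one_pos hx.1.le hg).symm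
    _ = fracI (β₁ + β₂ - 1) a (fracI ((1 - β₁) + (1 - β₂)) a D) x :=
      fracI_congr hx.1.le fun y hy => hI y ⟨hy.1, hy.2.trans hx.2⟩
    _ = fracI ((β₁ + β₂ - 1) + ((1 - β₁) + (1 - β₂))) a D x := fracI_semigroup hq hp hx.1.le hDc
    _ = fracI 1 a D x := by congr 1; ring
    _ = _ := h1

lemma ext2 {a b T : ℝ} (hab : a ≤ b) (hT : 0 ≤ T) {g : ℝ → ℝ → ℝ}
    (hg : ContinuousOn (fun p : ℝ × ℝ => g p.1 p.2) (Set.Icc a b ×ˢ Set.Icc 0 T)) :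
    ∃ (G : ℝ → ℝ → ℝ) (M : ℝ), Continuous (Function.uncurry G) ∧ (∀ x t, |G x t| ≤ M) ∧
      ∀ x ∈ Set.Icc a b, ∀ t ∈ Set.Icc 0 T, G x t = g x t := by
  obtain ⟨M, hM⟩ := (isCompact_Icc.prod isCompact_Icc).exists_bound_of_continuousOn hg
  refine ⟨fun x t => g (Set.projIcc a b hab x) (Set.projIcc 0 T hT t), M, ?_, ?_, ?_⟩
  · have hc : Continuous fun p : ℝ × ℝ =>
        (((Set.projIcc a b hab p.1 : ℝ), (Set.projIcc 0 T hT p.2 : ℝ)) : ℝ × ℝ) :=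
      (continuous_subtype_val.comp (continuous_projIcc.comp continuous_fst)).prodMk
        (continuous_subtype_val.comp (continuous_projIcc.comp continuous_snd))
    exact hg.comp_continuous hc fun p => ⟨(Set.projIcc a b hab p.1).2, (Set.projIcc 0 T hT p.2).2⟩
  · intro x t
    exact hM ((Set.projIcc a b hab x : ℝ), (Set.projIcc 0 T hT t : ℝ))
      ⟨(Set.projIcc a b hab x).2, (Set.projIcc 0 T hT t).2⟩
  · intro x hx t ht
    simp [Set.projIcc_of_mem hab hx, Set.projIcc_of_mem hT ht]

/-- uniqueness for the time-space fractional pseudo-parabolic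
equation `∂u/∂t = ν D^{1−α}_{0+,t}[𝒟^{β₁}_{a+,x}𝒟^{β₂}_{a+,x} u] + F`. -/
theorem pseudo_parabolic_unique
    (α β₁ β₂ ν a b T : ℝ)
    (hα : 0 < α ∧ α < 1) (hβ₁ : 0 < β₁ ∧ β₁ < 1) (hβ₂ : 0 < β₂ ∧ β₂ < 1)
    (hsum : 1 < β₁ + β₂) (hν : 0 < ν) (hab : a < b) (hT : 0 < T)
    (F : ℝ → ℝ → ℝ) (φ ψ₁ ψ₂ : ℝ → ℝ)
    (hF : ContinuousOn (Function.uncurry F) (Set.Icc a b ×ˢ Set.Icc 0 T))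
    (hφ : ContinuousOn φ (Set.Icc a b))
    (hψ₁ : ContinuousOn ψ₁ (Set.Icc 0 T)) (hψ₂ : ContinuousOn ψ₂ (Set.Icc 0 T))
    (u v : ℝ → ℝ → ℝ)
    -- regularity of `u`
    (hu : ContinuousOn (Function.uncurry u) (Set.Icc a b ×ˢ Set.Icc 0 T))
    (hux : ∀ t ∈ Set.Icc (0:ℝ) T, ∀ x ∈ Set.Icc a b,
      HasDerivAt (fun y => u y t) (deriv (fun y => u y t) x) x)
    (hux' : ∀ t ∈ Set.Icc (0:ℝ) T, ContinuousOn (deriv (fun y => u y t)) (Set.Icc a b))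
    (hut : ∀ x ∈ Set.Icc a b, ∀ t ∈ Set.Ioc (0:ℝ) T, HasDerivAt (u x) (deriv (u x) t) t)
    (hut' : ∀ x ∈ Set.Icc a b, ContinuousOn (deriv (u x)) (Set.Ioc 0 T))
    (hDxexu : ∀ t ∈ Set.Icc (0:ℝ) T, ∀ x ∈ Set.Ioo a b,
      HasDerivAt (seqCaputoAux β₁ β₂ a (fun y => u y t))
        (seqCaputo β₁ β₂ a (fun y => u y t) x) x)
    (hwu : ContinuousOn (fun p : ℝ × ℝ => seqCaputo β₁ β₂ a (fun y => u y p.2) p.1)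
      (Set.Icc a b ×ˢ Set.Icc 0 T))
    (hrlexu : ∀ x ∈ Set.Icc a b, ∀ t ∈ Set.Ioc (0:ℝ) T,
      HasDerivAt (rlAux (1 - α) (fun τ => seqCaputo β₁ β₂ a (fun y => u y τ) x))
        (rlDeriv (1 - α) (fun τ => seqCaputo β₁ β₂ a (fun y => u y τ) x) t) t)
    (hrlcu : ContinuousOn
      (fun p : ℝ × ℝ => rlDeriv (1 - α) (fun τ => seqCaputo β₁ β₂ a (fun y => u y τ) p.1) p.2)
      (Set.Icc a b ×ˢ Set.Ioc 0 T))
    -- regularity of `v`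
    (hv : ContinuousOn (Function.uncurry v) (Set.Icc a b ×ˢ Set.Icc 0 T))
    (hvx : ∀ t ∈ Set.Icc (0:ℝ) T, ∀ x ∈ Set.Icc a b,
      HasDerivAt (fun y => v y t) (deriv (fun y => v y t) x) x)
    (hvx' : ∀ t ∈ Set.Icc (0:ℝ) T, ContinuousOn (deriv (fun y => v y t)) (Set.Icc a b))
    (hvt : ∀ x ∈ Set.Icc a b, ∀ t ∈ Set.Ioc (0:ℝ) T, HasDerivAt (v x) (deriv (v x) t) t)
    (hvt' : ∀ x ∈ Set.Icc a b, ContinuousOn (deriv (v x)) (Set.Ioc 0 T))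
    (hDxexv : ∀ t ∈ Set.Icc (0:ℝ) T, ∀ x ∈ Set.Ioo a b,
      HasDerivAt (seqCaputoAux β₁ β₂ a (fun y => v y t))
        (seqCaputo β₁ β₂ a (fun y => v y t) x) x)
    (hwv : ContinuousOn (fun p : ℝ × ℝ => seqCaputo β₁ β₂ a (fun y => v y p.2) p.1)
      (Set.Icc a b ×ˢ Set.Icc 0 T))
    (hrlexv : ∀ x ∈ Set.Icc a b, ∀ t ∈ Set.Ioc (0:ℝ) T,
      HasDerivAt (rlAux (1 - α) (fun τ => seqCaputo β₁ β₂ a (fun y => v y τ) x))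
        (rlDeriv (1 - α) (fun τ => seqCaputo β₁ β₂ a (fun y => v y τ) x) t) t)
    (hrlcv : ContinuousOn
      (fun p : ℝ × ℝ => rlDeriv (1 - α) (fun τ => seqCaputo β₁ β₂ a (fun y => v y τ) p.1) p.2)
      (Set.Icc a b ×ˢ Set.Ioc 0 T))
    -- both satisfy the equation, initial and boundary conditions
    (hequ : ∀ x ∈ Set.Ioo a b, ∀ t ∈ Set.Ioc (0:ℝ) T,
      deriv (u x) t
        = ν * rlDeriv (1 - α) (fun τ => seqCaputo β₁ β₂ a (fun y => u y τ) x) t + F x t)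
    (heqv : ∀ x ∈ Set.Ioo a b, ∀ t ∈ Set.Ioc (0:ℝ) T,
      deriv (v x) t
        = ν * rlDeriv (1 - α) (fun τ => seqCaputo β₁ β₂ a (fun y => v y τ) x) t + F x t)
    (hinitu : ∀ x ∈ Set.Icc a b, u x 0 = φ x)
    (hinitv : ∀ x ∈ Set.Icc a b, v x 0 = φ x)
    (hbdu : ∀ t ∈ Set.Icc (0:ℝ) T, u a t = ψ₁ t ∧ u b t = ψ₂ t)
    (hbdv : ∀ t ∈ Set.Icc (0:ℝ) T, v a t = ψ₁ t ∧ v b t = ψ₂ t) :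
    ∀ x ∈ Set.Icc a b, ∀ t ∈ Set.Icc (0:ℝ) T, u x t = v x t := by
  intro x hx t ht
  obtain ⟨Gu, Mu, hGuc, hGuM, hGue⟩ := ext2 hab.le hT.le
    (g := fun x t => seqCaputo β₁ β₂ a (fun y => u y t) x) hwu
  obtain ⟨Gv, Mv, hGvc, hGvM, hGve⟩ := ext2 hab.le hT.le
    (g := fun x t => seqCaputo β₁ β₂ a (fun y => v y t) x) hwv
  have sx : ∀ {G : ℝ → ℝ → ℝ}, Continuous (Function.uncurry G) → ∀ t, Continuous fun y => G y t :=
    fun hG t => hG.comp (by fun_prop : Continuous fun y : ℝ => (y, t))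
  have st : ∀ {G : ℝ → ℝ → ℝ}, Continuous (Function.uncurry G) → ∀ y, Continuous (G y) :=
    fun hG y => hG.comp (by fun_prop : Continuous fun t : ℝ => (y, t))
  have hspace : ∀ x ∈ Set.Ioo a b, ∀ t ∈ Set.Icc 0 T,
      fracI (β₁ + β₂) a (fun y => Gu y t - Gv y t) x = u x t - v x t := by
    intro x hx t ht
    rw [fracI_sub (by linarith) (sx hGuc t) (sx hGvc t),
      space_rep hβ₁ hβ₂ hsum hab (hux t ht) (hux' t ht) (fun y hy => by
        rw [hGue y ⟨hy.1.le, hy.2.le⟩ t ht]; exact hDxexu t ht y hy) (sx hGuc t) hx,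
      space_rep hβ₁ hβ₂ hsum hab (hvx t ht) (hvx' t ht) (fun y hy => by
        rw [hGve y ⟨hy.1.le, hy.2.le⟩ t ht]; exact hDxexv t ht y hy) (sx hGvc t) hx,
      (hbdu t ht).1, (hbdv t ht).1]
    ring
  have htime : ∀ x ∈ Set.Ioo a b, ∀ t ∈ Set.Icc 0 T,
      u x t - v x t = ν * fracI α 0 (fun τ => Gu x τ - Gv x τ) t := by
    intro x hx t ht
    have hxI : x ∈ Set.Icc a b := ⟨hx.1.le, hx.2.le⟩
    have hRu : ∀ τ ∈ Set.Icc 0 T,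
        rlAux (1 - α) (fun τ => seqCaputo β₁ β₂ a (fun y => u y τ) x) τ = fracI α 0 (Gu x) τ := by
      intro τ hτ
      rw [rlAux_eq]
      exact fracI_congr hτ.1 fun s hs => (hGue x hxI s ⟨hs.1.le, hs.2.le.trans hτ.2⟩).symm
    have hRv : ∀ τ ∈ Set.Icc 0 T,
        rlAux (1 - α) (fun τ => seqCaputo β₁ β₂ a (fun y => v y τ) x) τ = fracI α 0 (Gv x) τ := by
      intro τ hτ
      rw [rlAux_eq]
      exact fracI_congr hτ.1 fun s hs => (hGve x hxI s ⟨hs.1.le, hs.2.le.trans hτ.2⟩).symm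
    set E : ℝ → ℝ := fun τ =>
      (u x τ - ν * rlAux (1 - α) (fun τ => seqCaputo β₁ β₂ a (fun y => u y τ) x) τ) -
      (v x τ - ν * rlAux (1 - α) (fun τ => seqCaputo β₁ β₂ a (fun y => v y τ) x) τ) with hE
    have h0 : (0:ℝ) ∈ Set.Icc 0 T := ⟨le_rfl, hT.le⟩
    have hEd : ∀ τ ∈ Set.Ioc 0 T, HasDerivAt E 0 τ := by
      intro τ hτ
      have h1 := ((hut x hxI τ hτ).sub ((hrlexu x hxI τ hτ).const_mul ν)).sub
        ((hvt x hxI τ hτ).sub ((hrlexv x hxI τ hτ).const_mul ν))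
      rw [hequ x hx τ hτ, heqv x hx τ hτ] at h1
      exact h1.congr_deriv (by ring)
    have cu : ContinuousOn (u x) (Set.Icc 0 T) :=
      hu.comp (f := fun τ : ℝ => (x, τ)) (by fun_prop) fun τ hτ => ⟨hxI, hτ⟩
    have cv : ContinuousOn (v x) (Set.Icc 0 T) :=
      hv.comp (f := fun τ : ℝ => (x, τ)) (by fun_prop) fun τ hτ => ⟨hxI, hτ⟩
    have hEc : ContinuousOn E (Set.Icc 0 t) := by
      intro τ hτ
      rcases eq_or_lt_of_le hτ.1 with h | h
      · subst h
        have b1 : ContinuousWithinAt (rlAux (1 - α)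
            (fun τ => seqCaputo β₁ β₂ a (fun y => u y τ) x)) (Set.Icc 0 T) 0 :=
          (fracI_cont_base hα.1 fun s _ => hGuM x s).congr hRu (hRu 0 h0)
        have b2 : ContinuousWithinAt (rlAux (1 - α)
            (fun τ => seqCaputo β₁ β₂ a (fun y => v y τ) x)) (Set.Icc 0 T) 0 :=
          (fracI_cont_base hα.1 fun s _ => hGvM x s).congr hRv (hRv 0 h0)
        exact (((cu 0 h0).sub (b1.const_mul ν)).sub ((cv 0 h0).sub (b2.const_mul ν))).mono
          (Set.Icc_subset_Icc_right ht.2)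
      · exact (hEd τ ⟨h, hτ.2.trans ht.2⟩).continuousAt.continuousWithinAt
    have hEt := intervalIntegral.integral_eq_sub_of_hasDerivAt_of_le (f' := fun _ => (0:ℝ)) ht.1 hEc
      (fun τ hτ => hEd τ ⟨hτ.1, hτ.2.le.trans ht.2⟩) intervalIntegrable_const
    simp only [intervalIntegral.integral_zero, hE] at hEt
    rw [hRu t ht, hRv t ht, hRu 0 h0, hRv 0 h0, fracI_zero_base, fracI_zero_base, hinitu x hxI,
      hinitv x hxI] at hEt
    rw [fracI_sub hα.1 (st hGuc x) (st hGvc x)]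
    linarith
  rcases eq_or_lt_of_le hx.1 with h | hax
  · subst h; rw [(hbdu t ht).1, (hbdv t ht).1]
  rcases eq_or_lt_of_le hx.2 with h | hxb
  · subst h; rw [(hbdu t ht).2, (hbdv t ht).2]
  have hzero := core (G := fun x t => Gu x t - Gv x t) (M := Mu + Mv) (T := T) (a := a) (b := b)
    hα.1 hα.2 hsum hν (hGuc.sub hGvc)
    (fun x t => (abs_sub _ _).trans (add_le_add (hGuM x t) (hGvM x t)))
    (fun x hx t ht => by
      rw [hspace x hx t ⟨ht.1.le, ht.2.le⟩, htime x hx t ⟨ht.1.le, ht.2.le⟩])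
  have h1 := htime x ⟨hax, hxb⟩ t ht
  rw [fracI_congr (g := fun _ => 0) ht.1 (fun s hs => hzero x ⟨hax, hxb⟩ s
    ⟨hs.1, hs.2.trans_le ht.2⟩)] at h1
  simp only [fracI, mul_zero, intervalIntegral.integral_zero] at h1
  linarith
end
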